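/- arXiv:1304.3830 — 3 statements merged into one kernel-verified Lean document; each statement's English description precedes it below -/
import Mathlib

section
/- If G is an acyclic locally finite Borel graph on a standard Borel space X in which every vertex has degree ≥ 2, then there is a partial Borel antimatching f of G such that the restriction of G to the complement of dom(f) is 2-regular. -/
open Set Function MeasureTheory PiNat

/-- A sequence of sets is *Borel-escapable* if it can be enlarged to a sequence of measurable sets
with empty intersection. -/
def BorelEscapable {α : Type*} [MeasurableSpace α] (A : ℕ → Set α) : Prop :=
  ∃ E : ℕ → Set α, (∀ n, A n ⊆ E n) ∧ (∀ n, MeasurableSet (E n)) ∧ ⋂ n, E n = ∅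

/-- Splitting one member of a sequence into countably many pieces preserves Borel-escapability. -/
theorem BorelEscapable.of_split {α : Type*} [MeasurableSpace α] {A : ℕ → Set α}
    {B : ℕ → ℕ → Set α} (k : ℕ) (hk : A k ⊆ ⋃ i, B i k) (hA : ∀ n, n ≠ k → ∀ i, A n ⊆ B i n)
    (hB : ∀ i, BorelEscapable (B i)) : BorelEscapable A := by
  choose E hBE hE hempty using hB
  refine ⟨fun n => if n = k then ⋃ i, E i k else ⋂ i, E i n, fun n => ?_, fun n => ?_, ?_⟩
  · dsimp only
    split_ifs with h
    · subst h
      exact hk.trans (iUnion_mono fun i => hBE i n)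
    · exact subset_iInter fun i => (hA n h i).trans (hBE i n)
  · dsimp only
    split_ifs
    · exact .iUnion fun i => hE i k
    · exact .iInter fun i => hE i n
  · refine eq_empty_of_forall_notMem fun x hx => ?_
    rw [mem_iInter] at hx
    have hxk := hx k
    simp only [if_true, mem_iUnion] at hxk
    obtain ⟨i, hi⟩ := hxk
    have : x ∈ ⋂ n, E i n := by
      refine mem_iInter.2 fun n => ?_
      by_cases h : n = k
      · exact h ▸ hi
      · have := hx n
        rw [if_neg h] at this
        exact mem_iInter.1 this i
    rw [hempty i] at this
    exact this

/-- If two members of a sequence lie in disjoint measurable sets, the sequence is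
Borel-escapable. -/
theorem BorelEscapable.of_disjoint {α : Type*} [MeasurableSpace α] {A : ℕ → Set α} {i j : ℕ}
    {U V : Set α} (hU : MeasurableSet U) (hV : MeasurableSet V) (hUV : Disjoint U V)
    (hi : A i ⊆ U) (hj : A j ⊆ V) : BorelEscapable A := by
  refine ⟨fun n => {x | (n = i → x ∈ U) ∧ (n = j → x ∈ V)}, fun n x hx => ?_, fun n => ?_, ?_⟩
  · exact ⟨fun h => hi (h ▸ hx), fun h => hj (h ▸ hx)⟩
  · exact (MeasurableSet.const (n = i)).imp hU |>.inter ((MeasurableSet.const (n = j)).imp hV)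
  · refine eq_empty_of_forall_notMem fun x hx => ?_
    rw [mem_iInter] at hx
    exact hUV.le_bot ⟨(hx i).1 rfl, (hx j).2 rfl⟩

/-- **Novikov's separation theorem** for ranges of continuous functions on the Baire space. -/
theorem borelEscapable_range {α : Type*} [TopologicalSpace α] [T2Space α] [MeasurableSpace α]
    [OpensMeasurableSpace α] {g : ℕ → (ℕ → ℕ) → α} (hg : ∀ n, Continuous (g n))
    (h : ⋂ n, range (g n) = ∅) : BorelEscapable fun n => range (g n) := by
  by_contra hcon
  let F : ℕ → (ℕ → ℕ) → α := fun n w => g n fun m => w (Nat.pair n m)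
  have hF : ∀ n, Continuous (F n) := fun n => (hg n).comp (by fun_prop)
  have hrange : ∀ n, F n '' univ = range (g n) := by
    intro n
    rw [image_univ]
    refine Subset.antisymm (range_subset_iff.2 fun w => mem_range_self _)
      (range_subset_iff.2 fun v => ⟨fun t => v t.unpair.2, ?_⟩)
    simp [F]
  have step : ∀ (t : ℕ) (z : ℕ → ℕ), ¬ BorelEscapable (fun n => F n '' cylinder z t) →
      ∃ i, ¬ BorelEscapable (fun n => F n '' cylinder (update z t i) (t + 1)) := by
    intro t z
    contrapose!
    refine BorelEscapable.of_split t.unpair.1 ?_ fun n hn i => ?_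
    · rw [← image_iUnion, iUnion_cylinder_update z t]
    · rintro _ ⟨w, hw, rfl⟩
      refine ⟨update w t i, fun m hm => ?_, ?_⟩
      · rcases eq_or_ne m t with rfl | hmt
        · simp
        · simpa [hmt] using hw m (by lia)
      · refine congrArg (g n) (funext fun m => update_of_ne ?_ _ _)
        rintro rfl
        simp at hn
  choose! c hc using step
  let z : ℕ → ℕ → ℕ := fun t => Nat.rec (fun _ => 0) (fun t y => update y t (c t y)) t
  have z_succ : ∀ t, z (t + 1) = update (z t) t (c t (z t)) := fun t => rfl
  have hz : ∀ t, ¬ BorelEscapable (fun n => F n '' cylinder (z t) t) := by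
    intro t
    induction t with
    | zero => simpa only [cylinder_zero, hrange] using hcon
    | succ t ih => exact hc t _ ih
  let x : ℕ → ℕ := fun m => z (m + 1) m
  have hstable : ∀ m t, m + 1 ≤ t → z t m = x m := by
    intro m
    refine Nat.le_induction rfl fun t hmt ih => ?_
    rw [z_succ, update_of_ne (by lia), ih]
  have hcyl : ∀ t, cylinder (z t) t = cylinder x t := fun t =>
    mem_cylinder_iff_eq.1 fun m hm => hstable m t hm
  have hne : ∃ n, F 0 x ≠ F n x := by
    by_contra! heq
    have : F 0 x ∈ ⋂ n, range (g n) :=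
      mem_iInter.2 fun n => heq n ▸ mem_range_self _
    rw [h] at this
    exact this
  obtain ⟨n, hn⟩ := hne
  obtain ⟨U, V, hU, hV, hxU, hxV, hUV⟩ := t2_separation hn
  have hnhds : F 0 ⁻¹' U ∩ F n ⁻¹' V ∈ nhds x :=
    ((hU.preimage (hF 0)).inter (hV.preimage (hF n))).mem_nhds ⟨hxU, hxV⟩
  obtain ⟨_, ⟨y, t, rfl⟩, hxt, ht⟩ :=
    (isTopologicalBasis_cylinders (fun _ => ℕ)).mem_nhds_iff.1 hnhds
  rw [← mem_cylinder_iff_eq.1 hxt] at ht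
  refine hz t (BorelEscapable.of_disjoint hU.measurableSet hV.measurableSet hUV (i := 0) (j := n)
    ?_ ?_)
  · rw [hcyl]
    exact image_subset_iff.2 fun w hw => (ht hw).1
  · rw [hcyl]
    exact image_subset_iff.2 fun w hw => (ht hw).2

/-- **Novikov's separation theorem**: a sequence of analytic sets with empty intersection can be
enlarged to a sequence of Borel sets with empty intersection. -/
theorem borelEscapable_of_analyticSet {α : Type*} [TopologicalSpace α] [T2Space α]
    [MeasurableSpace α] [OpensMeasurableSpace α] {A : ℕ → Set α} (hA : ∀ n, AnalyticSet (A n))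
    (h : ⋂ n, A n = ∅) : BorelEscapable A := by
  by_cases hne : ∃ n, A n = ∅
  · obtain ⟨n, hn⟩ := hne
    exact .of_disjoint (i := n) (j := n) .empty .empty disjoint_bot_left hn.le hn.le
  · push Not at hne
    have hA' : ∀ n, ∃ g : (ℕ → ℕ) → α, Continuous g ∧ range g = A n := by
      intro n
      have := hA n
      rw [AnalyticSet] at this
      exact this.resolve_left (hne n).ne_empty
    choose g hg hgA using hA'
    obtain rfl : (fun n => range (g n)) = A := funext hgA
    exact borelEscapable_range hg h

/-- A standard Borel space has countably many measurable sets separating points from finite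
sets. -/
theorem exists_seq_separating_finite (X : Type*) [MeasurableSpace X] [StandardBorelSpace X] :
    ∃ U : ℕ → Set X, (∀ n, MeasurableSet (U n)) ∧
      ∀ (s : Set X) (x : X), s.Finite → x ∉ s → ∃ n, x ∈ U n ∧ ∀ y ∈ s, y ∉ U n := by
  let := upgradeStandardBorel X
  obtain ⟨U, hU⟩ := ((TopologicalSpace.countable_countableBasis X).insert univ).exists_eq_range
    (insert_nonempty _ _)
  have hb := TopologicalSpace.isBasis_countableBasis X
  refine ⟨U, fun n => ?_, fun s x hs hx => ?_⟩
  · rcases hU.symm ▸ mem_range_self (f := U) n with h | h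
    · exact h ▸ .univ
    · exact (hb.isOpen h).measurableSet
  · obtain ⟨t, ht, hxt, hts⟩ := hb.mem_nhds_iff.1 (hs.isClosed.isOpen_compl.mem_nhds hx)
    obtain ⟨n, rfl⟩ := hU ▸ mem_insert_of_mem univ ht
    exact ⟨n, hxt, fun y hy hyU => hts hyU hy⟩

/-- A measurable relation whose sections are finite is a countable union of measurable graphs of
partial functions. -/
theorem exists_measurable_graph_cover {X : Type*} [MeasurableSpace X] [StandardBorelSpace X]
    {R : Set (X × X)} (hR : MeasurableSet R) (hfin : ∀ x, {y | (x, y) ∈ R}.Finite) :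
    ∃ B : ℕ → Set (X × X), (∀ n, MeasurableSet (B n)) ∧ ⋃ n, B n = R ∧
      ∀ n, InjOn Prod.fst (B n) := by
  obtain ⟨U, hUm, hU⟩ := exists_seq_separating_finite X
  let := upgradeStandardBorel X
  let T : ℕ → Set (X × X × X) := fun n =>
    {q | (q.1, q.2.1) ∈ R ∧ (q.1, q.2.2) ∈ R ∧ q.2.2 ∈ U n ∧ q.2.1 ≠ q.2.2}
  have hT : ∀ n, MeasurableSet (T n) := fun n =>
    (hR.preimage (by fun_prop)).inter <| (hR.preimage (by fun_prop)).inter <|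
      ((hUm n).preimage (by fun_prop)).inter
        (measurableSet_eq_fun (by fun_prop) (by fun_prop)).compl
  let A : ℕ → Set (X × X) := fun n =>
    (R ∩ {p | p.2 ∉ U n}) ∪ (fun q : X × X × X => (q.1, q.2.1)) '' T n
  have hRU : ∀ n, MeasurableSet (R ∩ {p | p.2 ∉ U n}) := fun n =>
    hR.inter ((hUm n).preimage measurable_snd).compl
  have hA : ∀ n, AnalyticSet (A n) := by
    intro n
    have h := AnalyticSet.iUnion (s := fun b : Bool => cond b (R ∩ {p | p.2 ∉ U n})
      ((fun q : X × X × X => (q.1, q.2.1)) '' T n)) (by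
        rintro (_ | _)
        · exact (hT n).analyticSet_image (by fun_prop)
        · exact (hRU n).analyticSet)
    rwa [← union_eq_iUnion] at h
  have hempty : ⋂ n, A n = ∅ := by
    refine eq_empty_of_forall_notMem fun p hp => ?_
    rw [mem_iInter] at hp
    obtain ⟨n, hn, hdisj⟩ := hU ({y | (p.1, y) ∈ R} \ {p.2}) p.2 ((hfin p.1).sdiff) (by simp)
    rcases hp n with h | ⟨q, ⟨-, hq, hqU, hne⟩, rfl⟩
    · exact h.2 hn
    · exact hdisj q.2.2 ⟨hq, hne.symm⟩ hqU
  obtain ⟨E, hAE, hE, hEempty⟩ := borelEscapable_of_analyticSet hA hempty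
  refine ⟨fun n => R \ E n, fun n => hR.diff (hE n), ?_, ?_⟩
  · rw [← sdiff_iInter, hEempty, sdiff_empty]
  · rintro n ⟨x, y⟩ ⟨hy, hyE⟩ ⟨x', y'⟩ ⟨hy', hyE'⟩ (rfl : x = x')
    by_contra hne
    have hyU : y' ∈ U n := by
      by_contra h
      exact hyE' (hAE n (Or.inl ⟨hy', h⟩))
    exact hyE (hAE n (Or.inr ⟨(x, y, y'), ⟨hy, hy', hyU, fun h => hne (by simp_all)⟩, rfl⟩))

/-- A measurable partial function extends to a total one by the identity. -/
theorem exists_measurable_extension {X : Type*} [MeasurableSpace X] [StandardBorelSpace X]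
    {B : Set (X × X)} (hB : MeasurableSet B) (hinj : InjOn Prod.fst B) :
    ∃ φ : X → X, Measurable φ ∧ (∀ x, φ x = x ∨ (x, φ x) ∈ B) ∧ ∀ p ∈ B, φ p.1 = p.2 := by
  classical
  let φ : X → X := fun x => if h : ∃ y, (x, y) ∈ B then h.choose else x
  have hφ : ∀ p ∈ B, φ p.1 = p.2 := by
    rintro ⟨x, y⟩ hp
    have h : ∃ y, (x, y) ∈ B := ⟨y, hp⟩
    have := hinj h.choose_spec hp rfl
    simpa [φ, h] using congrArg Prod.snd this
  refine ⟨φ, fun S hS => ?_, fun x => ?_, hφ⟩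
  · have key : φ ⁻¹' S = Prod.fst '' (B ∩ Prod.snd ⁻¹' S) ∪ ((Prod.fst '' B)ᶜ ∩ S) := by
      ext x
      by_cases h : ∃ y, (x, y) ∈ B
      · obtain ⟨y, hy⟩ := h
        have hxy : φ x = y := hφ _ hy
        have huniq : ∀ z, (x, z) ∈ B → z = y := fun z hz => (hφ _ hz).symm.trans hxy
        simp only [mem_preimage, hxy, mem_union, mem_image, mem_inter_iff, Prod.exists,
          exists_and_right, exists_eq_right, mem_compl_iff]
        refine ⟨fun h => Or.inl ⟨y, hy, h⟩, ?_⟩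
        rintro (⟨z, hz, hzS⟩ | ⟨h, -⟩)
        · exact huniq z hz ▸ hzS
        · exact absurd ⟨y, hy⟩ h
      · have hx : φ x = x := by simp [φ, h]
        simp only [mem_preimage, hx, mem_union, mem_image, mem_inter_iff, Prod.exists,
          exists_and_right, exists_eq_right, mem_compl_iff, h, not_false_eq_true, true_and]
        refine ⟨Or.inr, ?_⟩
        rintro (⟨z, hz, -⟩ | h')
        · exact absurd ⟨z, hz⟩ h
        · exact h'
    rw [key]
    refine .union ?_ (.inter (.compl ?_) hS)
    · exact (hB.inter (measurable_snd hS)).image_of_measurable_injOn measurable_fst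
        (hinj.mono inter_subset_left)
    · exact hB.image_of_measurable_injOn measurable_fst hinj
  · by_cases h : ∃ y, (x, y) ∈ B
    · obtain ⟨y, hy⟩ := h
      exact Or.inr ((hφ _ hy : φ x = y) ▸ hy)
    · exact Or.inl (by simp [φ, h])

/-- A locally finite Borel graph is generated by countably many measurable functions. -/
theorem SimpleGraph.exists_measurable_enumeration {X : Type*} [MeasurableSpace X]
    [StandardBorelSpace X] {G : SimpleGraph X} (hG : MeasurableSet {p : X × X | G.Adj p.1 p.2})
    (hfin : ∀ x, (G.neighborSet x).Finite) :
    ∃ φ : ℕ → X → X, (∀ n, Measurable (φ n)) ∧ (∀ n x, φ n x = x ∨ G.Adj x (φ n x)) ∧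
      ∀ x y, G.Adj x y → ∃ n, φ n x = y := by
  obtain ⟨B, hB, hBG, hinj⟩ := exists_measurable_graph_cover hG hfin
  choose φ hφ hφB hBφ using fun n => exists_measurable_extension (hB n) (hinj n)
  refine ⟨φ, hφ, fun n x => (hφB n x).imp_right fun h => ?_, fun x y hxy => ?_⟩
  · exact hBG.subset (mem_iUnion_of_mem n h)
  · obtain ⟨n, hn⟩ := mem_iUnion.1 (hBG.superset (show (x, y) ∈ _ from hxy))
    exact ⟨n, hBφ n _ hn⟩

/-- From a sequence of measurable functions one can measurably select one that moves a given
point, if there is any. -/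
theorem exists_measurable_moving {X : Type*} [MeasurableSpace X] [MeasurableEq X]
    {f : ℕ → X → X} (hf : ∀ n, Measurable (f n)) :
    ∃ F : X → X, Measurable F ∧ ∀ x,
      (F x = x ∧ ∀ n, f n x = x) ∨ ∃ n, F x = f n x ∧ F x ≠ x := by
  classical
  let p : ℕ → X → Prop := fun n x => f n x ≠ x ∨ ∀ m, f m x = x
  have hp : ∀ x, ∃ n, p n x := by
    intro x
    by_cases h : ∀ m, f m x = x
    · exact ⟨0, Or.inr h⟩
    · push Not at h
      exact h.imp fun n hn => Or.inl hn
  have hfix : ∀ n, MeasurableSet {x | f n x = x} := fun n =>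
    measurableSet_eq_fun (hf n) measurable_id
  refine ⟨fun x => f (Nat.find (hp x)) x, Measurable.find hf (fun n => ?_) hp, fun x => ?_⟩
  · refine (hfix n).compl.union ?_
    exact (MeasurableSet.iInter hfix).congr (ext fun _ => mem_iInter)
  · by_cases h : ∀ m, f m x = x
    · exact Or.inl ⟨h _, h⟩
    · exact Or.inr ⟨_, rfl, (Nat.find_spec (hp x)).resolve_right h⟩

/-- A locally finite Borel graph has a measurable proper coloring by natural numbers. -/
theorem SimpleGraph.exists_measurable_coloring {X : Type*} [MeasurableSpace X]
    [StandardBorelSpace X] {G : SimpleGraph X} (hfin : ∀ x, (G.neighborSet x).Finite)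
    {φ : ℕ → X → X} (hφ : ∀ n, Measurable (φ n)) (hφG : ∀ n x, φ n x = x ∨ G.Adj x (φ n x))
    (hGφ : ∀ x y, G.Adj x y → ∃ n, φ n x = y) :
    ∃ c : X → ℕ, Measurable c ∧ ∀ x y, G.Adj x y → c x ≠ c y := by
  classical
  obtain ⟨U, hUm, hU⟩ := exists_seq_separating_finite X
  let p : X → ℕ → Prop := fun x n => x ∈ U n ∧ ∀ i, φ i x = x ∨ φ i x ∉ U n
  have hp : ∀ x, ∃ n, p x n := by
    intro x
    obtain ⟨n, hn, h⟩ := hU _ x (hfin x) G.irrefl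
    exact ⟨n, hn, fun i => (hφG i x).imp_right fun hi => h _ hi⟩
  refine ⟨fun x => Nat.find (hp x), measurable_find hp fun n => ?_, fun x y hxy heq => ?_⟩
  · refine (hUm n).inter ?_
    exact (MeasurableSet.iInter fun i => (measurableSet_eq_fun (hφ i) measurable_id).union
      (hφ i (hUm n)).compl).congr (ext fun _ => mem_iInter)
  · obtain ⟨i, hi⟩ := hGφ x y hxy
    have hx := (Nat.find_spec (hp x)).2 i
    have hy := (Nat.find_spec (hp y)).1
    rw [← show Nat.find (hp x) = Nat.find (hp y) from heq] at hy
    rw [hi] at hx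
    exact hx.elim hxy.ne' fun h => h hy

/-- A locally finite Borel graph of minimum degree at least two has two measurable functions
selecting distinct neighbors of every vertex. -/
theorem SimpleGraph.exists_measurable_neighbors {X : Type*} [MeasurableSpace X]
    [MeasurableEq X] {G : SimpleGraph X} (hdeg : ∀ x, 2 ≤ (G.neighborSet x).encard)
    {φ : ℕ → X → X} (hφ : ∀ n, Measurable (φ n)) (hφG : ∀ n x, φ n x = x ∨ G.Adj x (φ n x))
    (hGφ : ∀ x y, G.Adj x y → ∃ n, φ n x = y) :
    ∃ a b : X → X, Measurable a ∧ Measurable b ∧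
      ∀ x, G.Adj x (a x) ∧ G.Adj x (b x) ∧ a x ≠ b x := by
  classical
  have htwo : ∀ x, ∃ y z, G.Adj x y ∧ G.Adj x z ∧ y ≠ z := by
    intro x
    obtain ⟨y, z, hy, hz, hyz⟩ :=
      one_lt_encard_iff.1 (lt_of_lt_of_le (by norm_num) (hdeg x))
    exact ⟨y, z, hy, hz, hyz⟩
  obtain ⟨a, ha, haφ⟩ := exists_measurable_moving hφ
  have haG : ∀ x, G.Adj x (a x) := by
    intro x
    rcases haφ x with ⟨-, h⟩ | ⟨n, h, hne⟩
    · obtain ⟨y, -, hy, -⟩ := htwo x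
      obtain ⟨n, rfl⟩ := hGφ x y hy
      exact absurd (h n) hy.ne'
    · exact h ▸ (hφG n x).resolve_left (h ▸ hne)
  obtain ⟨b, hb, hbφ⟩ := exists_measurable_moving
    (f := fun n x => if φ n x = a x then x else φ n x)
    fun n => .ite (measurableSet_eq_fun (hφ n) ha) measurable_id (hφ n)
  refine ⟨a, b, ha, hb, fun x => ⟨haG x, ?_⟩⟩
  rcases hbφ x with ⟨-, h⟩ | ⟨n, h, hne⟩
  · obtain ⟨y, hy, hya⟩ : ∃ y, G.Adj x y ∧ y ≠ a x := by
      obtain ⟨y, z, hy, hz, hyz⟩ := htwo x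
      by_cases hya : y = a x
      · exact ⟨z, hz, fun hza => hyz (hya.trans hza.symm)⟩
      · exact ⟨y, hy, hya⟩
    obtain ⟨n, rfl⟩ := hGφ x y hy
    have := h n
    rw [if_neg hya] at this
    exact absurd this hy.ne'
  · split_ifs at h with hna
    · exact absurd h hne
    · exact ⟨h ▸ (hφG n x).resolve_left (h ▸ hne), fun hab => hna (h ▸ hab.symm)⟩

/-- Given a partial antimatching `g` (with `g x = x` encoding that `g` is undefined at `x`), a
coloring `c`, and functions `a`, `b`, the vertex `y` may be sent to `w` at stage `n` if either `w`
is already sent elsewhere, or `w` is undefined of color `n` and does not reserve `y` as `a w` or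
`b w`. -/
def IsTarget {X : Type*} (c : X → ℕ) (a b : X → X) (n : ℕ) (g : X → X) (y w : X) : Prop :=
  g w ≠ y ∧ (g w ≠ w ∨ c w = n ∧ y ≠ a w ∧ y ≠ b w)

/-- `g'` extends the partial antimatching `g` to all vertices of `G` which have an admissible target
at stage `n`. -/
def IsExtension {X : Type*} (G : SimpleGraph X) (c : X → ℕ) (a b : X → X) (n : ℕ) (g g' : X → X) :
    Prop :=
  ∀ y, (g y ≠ y → g' y = g y) ∧
    (g y = y → (g' y = y ∧ ∀ w, G.Adj y w → ¬ IsTarget c a b n g y w) ∨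
      (G.Adj y (g' y) ∧ IsTarget c a b n g y (g' y)))

/-- Extensions of measurable partial antimatchings can be chosen measurable. -/
theorem exists_measurable_isExtension {X : Type*} [MeasurableSpace X] [MeasurableEq X]
    {G : SimpleGraph X} {φ : ℕ → X → X} (hφ : ∀ n, Measurable (φ n))
    (hφG : ∀ n x, φ n x = x ∨ G.Adj x (φ n x)) (hGφ : ∀ x y, G.Adj x y → ∃ n, φ n x = y)
    {c : X → ℕ} {a b : X → X} (hc : Measurable c) (ha : Measurable a) (hb : Measurable b) (n : ℕ)
    {g : X → X} (hg : Measurable g) :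
    ∃ g', Measurable g' ∧ IsExtension G c a b n g g' := by
  classical
  have htarget : ∀ i, MeasurableSet {y | IsTarget c a b n g y (φ i y)} := by
    intro i
    have hgφ := hg.comp (hφ i)
    refine (measurableSet_eq_fun hgφ measurable_id).compl.inter <|
      (measurableSet_eq_fun hgφ (hφ i)).compl.union <|
      ((hc.comp (hφ i)) (measurableSet_singleton n)).inter <|
      (measurableSet_eq_fun measurable_id (ha.comp (hφ i))).compl.inter
      (measurableSet_eq_fun measurable_id (hb.comp (hφ i))).compl
  obtain ⟨F, hF, hFf⟩ := exists_measurable_moving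
    (f := fun i y => if IsTarget c a b n g y (φ i y) then φ i y else y)
    fun i => .ite (htarget i) (hφ i) measurable_id
  refine ⟨fun y => if g y = y then F y else g y,
    .ite (measurableSet_eq_fun hg measurable_id) hF hg, fun y => ⟨fun h => if_neg h, fun h => ?_⟩⟩
  simp only [if_pos h]
  rcases hFf y with ⟨hFy, hall⟩ | ⟨i, hi, hne⟩
  · refine Or.inl ⟨hFy, fun w hw ht => ?_⟩
    obtain ⟨i, rfl⟩ := hGφ y w hw
    have := hall i
    rw [if_pos ht] at this
    exact hw.ne' this
  · right
    split_ifs at hi with ht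
    · rw [hi] at hne ⊢
      exact ⟨(hφG i y).resolve_left hne, ht⟩
    · exact absurd hi hne

/-- The invariants of the construction: `g` is a partial antimatching, and no vertex outside its
domain is the value of a vertex it reserves. -/
structure IsReservedAntimatching {X : Type*} (G : SimpleGraph X) (a b g : X → X) : Prop where
  adj : ∀ x, g x ≠ x → G.Adj x (g x)
  apply_apply_ne : ∀ x, g x ≠ x → g (g x) ≠ x
  not_reserved : ∀ x, g x ≠ x → g (g x) = g x → x ≠ a (g x) ∧ x ≠ b (g x)

/-- Extensions along a proper coloring preserve the invariants. -/
theorem IsReservedAntimatching.of_isExtension {X : Type*} {G : SimpleGraph X} {c : X → ℕ}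
    {a b : X → X} (hc : ∀ x y, G.Adj x y → c x ≠ c y) {n : ℕ} {g g' : X → X}
    (hg : IsReservedAntimatching G a b g) (h : IsExtension G c a b n g g') :
    IsReservedAntimatching G a b g' := by
  have hnew : ∀ x, g x = x → g' x ≠ x → G.Adj x (g' x) ∧ IsTarget c a b n g x (g' x) :=
    fun x hx hx' => ((h x).2 hx).resolve_left fun h => hx' h.1
  refine ⟨fun x hx => ?_, fun x hx => ?_, fun x hx hxx => ?_⟩
  · by_cases hgx : g x = x
    · exact (hnew x hgx hx).1
    · exact (h x).1 hgx ▸ hg.adj x hgx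
  · intro hxx
    by_cases hgx : g x = x
    · obtain ⟨hadj, hne, ht⟩ := hnew x hgx hx
      by_cases hw : g (g' x) = g' x
      · obtain ⟨-, -, ht'⟩ := hnew _ hw (hxx.trans_ne hadj.ne)
        rw [hxx] at ht'
        exact hc _ _ hadj ((ht'.resolve_left (not_not.2 hgx)).1.trans
          (ht.resolve_left (not_not.2 hw)).1.symm)
      · exact hne ((h _).1 hw ▸ hxx)
    · rw [(h x).1 hgx] at hxx
      by_cases hw : g (g x) = g x
      · obtain ⟨-, hne, -⟩ := hnew _ hw (hxx.trans_ne (hg.adj x hgx).ne)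
        rw [hxx] at hne
        exact hne rfl
      · exact hg.apply_apply_ne x hgx ((h _).1 hw ▸ hxx)
  · have hw : g (g' x) = g' x := by
      by_contra hw
      exact hw ((h _).1 hw ▸ hxx)
    by_cases hgx : g x = x
    · exact ((hnew x hgx hx).2.2.resolve_left (not_not.2 hw)).2
    · rw [(h x).1 hgx] at hw ⊢
      exact hg.not_reserved x hgx hw

/-- In the limit of the extensions, the vertices outside the domain have exactly the two neighbors
they reserve outside the domain. -/
theorem limit_isExtension {X : Type*} {G : SimpleGraph X} {c : X → ℕ} {a b : X → X}
    (hc : ∀ x y, G.Adj x y → c x ≠ c y)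
    (hab : ∀ x, G.Adj x (a x) ∧ G.Adj x (b x) ∧ a x ≠ b x) {g : ℕ → X → X} (hg0 : g 0 = id)
    (hg : ∀ n, IsExtension G c a b n (g n) (g (n + 1))) {h : X → X}
    (hgh : ∀ x, (h x = x ∧ ∀ n, g n x = x) ∨ ∃ n, h x = g n x ∧ h x ≠ x) :
    (∀ x, h x ≠ x → G.Adj x (h x) ∧ h (h x) ≠ x) ∧
      ∀ x, h x = x → {y | G.Adj x y ∧ h y = y} = {a x, b x} := by
  have hinv : ∀ n, IsReservedAntimatching G a b (g n) := by
    intro n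
    induction n with
    | zero => constructor <;> simp [hg0]
    | succ n ih => exact ih.of_isExtension hc (hg n)
  have hlim : ∀ x, ∃ N, ∀ n, N ≤ n → g n x = h x := by
    intro x
    rcases hgh x with ⟨hx, hall⟩ | ⟨N, hN, hne⟩
    · exact ⟨0, fun n _ => (hall n).trans hx.symm⟩
    · refine ⟨N, Nat.le_induction hN.symm fun n _ ih => ?_⟩
      rw [((hg n) x).1 (ih ▸ hne), ih]
  have hlim2 : ∀ x y, ∃ n, g n x = h x ∧ g n y = h y := by
    intro x y
    obtain ⟨N, hN⟩ := hlim x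
    obtain ⟨M, hM⟩ := hlim y
    exact ⟨max N M, hN _ (le_max_left _ _), hM _ (le_max_right _ _)⟩
  have hfix : ∀ x, h x = x → ∀ n, g n x = x := fun x hx =>
    (hgh x).elim (fun h => h.2) fun ⟨_, _, hne⟩ => absurd hx hne
  have hnt : ∀ x, h x = x → ∀ n w, G.Adj x w → ¬ IsTarget c a b n (g n) x w := by
    intro x hx n w hw ht
    rcases (hg n x).2 (hfix x hx n) with h' | h'
    · exact h'.2 w hw ht
    · exact h'.1.ne' (hfix x hx (n + 1))
  have hback : ∀ x w, h x = x → G.Adj x w → h w ≠ w → h w = x := by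
    intro x w hx hw hhw
    by_contra hne
    obtain ⟨n, hn⟩ := hlim w
    have hn := hn n le_rfl
    exact hnt x hx n w hw ⟨hn ▸ hne, Or.inl (hn ▸ hhw)⟩
  have hres : ∀ x w, h x = x → h w = x → w ≠ x → w ≠ a x ∧ w ≠ b x := by
    intro x w hx hw hne
    obtain ⟨n, hnw⟩ := hlim w
    have hnw := (hnw n le_rfl).trans hw
    have := (hinv n).not_reserved w (hnw.symm ▸ hne.symm)
    rw [hnw] at this
    exact this (hfix x hx n)
  refine ⟨fun x hx => ?_, fun x hx => Subset.antisymm ?_ ?_⟩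
  · obtain ⟨n, hn, hn'⟩ := hlim2 x (h x)
    have hadj := (hinv n).adj x (hn ▸ hx)
    have hne := (hinv n).apply_apply_ne x (hn ▸ hx)
    rw [hn] at hadj hne
    rw [hn'] at hne
    exact ⟨hadj, hne⟩
  · rintro w ⟨hw, hhw⟩
    by_contra hmem
    simp only [mem_insert_iff, mem_singleton_iff, not_or] at hmem
    exact hnt w hhw (c x) x hw.symm ⟨(hfix x hx _).symm ▸ hw.ne, Or.inr ⟨rfl, hmem⟩⟩
  · rintro w (rfl | rfl)
    · refine ⟨(hab x).1, ?_⟩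
      by_contra hne
      exact (hres x _ hx (hback x _ hx (hab x).1 hne) (hab x).1.ne').1 rfl
    · refine ⟨(hab x).2.1, ?_⟩
      by_contra hne
      exact (hres x _ hx (hback x _ hx (hab x).2.1 hne) (hab x).2.1.ne').2 rfl


/-- If `G` is an acyclic locally finite Borel graph on a standard Borel space `X` in
which every vertex has degree `≥ 2`, then there is a partial Borel antimatching `f` of
`G` (with Borel domain `D`) such that the restriction of `G` to the complement of
`dom(f)` is `2`-regular. -/
theorem stmt_15 (X : Type) [MeasurableSpace X] [StandardBorelSpace X]
    (G : SimpleGraph X)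
    (hGBorel : MeasurableSet {p : X × X | G.Adj p.1 p.2})
    (hGlf : ∀ x, (G.neighborSet x).Finite)
    (hGacyc : G.IsAcyclic)
    (hGdeg : ∀ x, 2 ≤ (G.neighborSet x).encard) :
    ∃ (D : Set X) (f : X → X),
      MeasurableSet D ∧ Measurable f ∧
      (∀ x ∈ D, G.Adj x (f x) ∧ (f x ∈ D → f (f x) ≠ x)) ∧
      (∀ x ∉ D, {y | G.Adj x y ∧ y ∉ D}.encard = 2) := by
  obtain ⟨φ, hφ, hφG, hGφ⟩ := SimpleGraph.exists_measurable_enumeration hGBorel hGlf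
  obtain ⟨c, hc, hcG⟩ := SimpleGraph.exists_measurable_coloring hGlf hφ hφG hGφ
  obtain ⟨a, b, ha, hb, hab⟩ := SimpleGraph.exists_measurable_neighbors hGdeg hφ hφG hGφ
  choose e he heG using fun (n : ℕ) (g : {g : X → X // Measurable g}) =>
    exists_measurable_isExtension hφ hφG hGφ hc ha hb n g.2
  let g : ℕ → {g : X → X // Measurable g} := fun n =>
    Nat.rec ⟨id, measurable_id⟩ (fun n g => ⟨e n g, he n g⟩) n
  obtain ⟨h, hh, hgh⟩ := exists_measurable_moving fun n => (g n).2
  obtain ⟨hanti, htwo⟩ :=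
    limit_isExtension hcG hab (g := fun n => (g n).1) rfl (fun n => heG n (g n)) hgh
  refine ⟨{x | h x ≠ x}, h, (measurableSet_eq_fun hh measurable_id).compl, hh, fun x hx =>
    ⟨(hanti x hx).1, fun _ => (hanti x hx).2⟩, fun x hx => ?_⟩
  have := htwo x (not_not.1 hx)
  simp only [mem_ofPred_eq, ne_eq, not_not, this]
  exact encard_pair (hab x).2.2
end

section
/- Let E and F be countable Borel equivalence relations on a standard Borel space X such that every E-class has cardinality ≥ 3 and every F-class has cardinality ≥ 2, and let μ be a Borel probability measure on X. Then E and F have Borel disjoint complete sections modulo a μ-null set: there exist disjoint Borel sets A, B ⊆ X such that A meets the E-class of μ-almost every point and B meets the F-class of μ-almost every point. -/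
open MeasureTheory

/-- A continuous image of the Baire space has a measurable section almost everywhere. -/
lemma exists_measurable_rightInverse_ae {X : Type*} [TopologicalSpace X] [T3Space X]
    [MeasurableSpace X] [BorelSpace X] (μ : Measure X) [IsFiniteMeasure μ]
    (q : (ℕ → ℕ) → X) (hq : Continuous q) :
    ∃ α : X → ℕ → ℕ, Measurable α ∧ ∀ᵐ x ∂μ, x ∈ Set.range q → q (α x) = x := by
  classical
  let A : List ℕ → Set X := fun σ => q '' {β | PiNat.res β σ.length = σ}
  let B : List ℕ → Set X := fun σ => toMeasurable μ (A σ) ∩ closure (A σ)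
  have hAB : ∀ σ, A σ ⊆ B σ := fun σ =>
    Set.subset_inter (subset_toMeasurable _ _) subset_closure
  have hBm : ∀ σ, MeasurableSet (B σ) := fun σ =>
    (measurableSet_toMeasurable _ _).inter isClosed_closure.measurableSet
  have hA : ∀ σ, A σ ⊆ ⋃ n, A (n :: σ) := by
    rintro σ _ ⟨β, hβ, rfl⟩
    refine Set.mem_iUnion.2 ⟨β σ.length, β, ?_, rfl⟩
    simpa [PiNat.res_succ] using hβ
  have hnull : ∀ᵐ x ∂μ, ∀ σ, x ∈ B σ → ∃ n, x ∈ B (n :: σ) := by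
    rw [ae_all_iff]
    intro σ
    have hm : MeasurableSet (⋃ n, B (n :: σ)) := MeasurableSet.iUnion fun n => hBm _
    have h0 : μ (toMeasurable μ (A σ) ∩ (⋃ n, B (n :: σ))ᶜ) = 0 := by
      rw [Measure.measure_toMeasurable_inter hm.compl (measure_ne_top _ _)]
      have : A σ ∩ (⋃ n, B (n :: σ))ᶜ = ∅ := by
        rw [← Set.sdiff_eq, Set.sdiff_eq_empty]
        exact (hA σ).trans (Set.iUnion_mono fun n => hAB _)
      rw [this, measure_empty]
    refine measure_mono_null ?_ h0
    intro x hx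
    simp only [Set.mem_compl_iff, Set.mem_ofPred_eq, Classical.not_imp, not_exists] at hx
    exact ⟨hx.1.1, by simpa using hx.2⟩
  have hex : ∀ σ x, ∃ n, x ∈ B (n :: σ) ∨ ∀ m, x ∉ B (m :: σ) := fun σ x => by
    by_cases h : ∃ n, x ∈ B (n :: σ)
    · exact h.imp fun n hn => Or.inl hn
    · exact ⟨0, Or.inr (not_exists.1 h)⟩
  let next : List ℕ → X → ℕ := fun σ x => Nat.find (hex σ x)
  let pre : ℕ → X → List ℕ := fun k x => Nat.rec [] (fun _ σ => next σ x :: σ) k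
  have hnext : ∀ σ n, MeasurableSet {x | next σ x = n} := by
    intro σ n
    have : Measurable (next σ) := by
      refine measurable_find (hex σ) fun n => (hBm _).union ?_
      have : MeasurableSet {x | ∀ m, x ∉ B (m :: σ)} := by
        simp only [Set.ofPred_forall]
        exact MeasurableSet.iInter fun m => (hBm _).compl
      exact this
    exact this (measurableSet_singleton n)
  have hpre : ∀ k σ, MeasurableSet {x | pre k x = σ} := by
    intro k
    induction k with
    | zero => intro σ; exact MeasurableSet.const ([] = σ)
    | succ k ih =>
      intro σ
      cases σ with
      | nil => simp [pre]
      | cons n σ =>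
        have : {x | pre (k + 1) x = n :: σ} = {x | next σ x = n} ∩ {x | pre k x = σ} := by
          ext x
          simp only [pre, List.cons.injEq, Set.mem_ofPred_eq, Set.mem_inter_iff]
          constructor
          · rintro ⟨h1, h2⟩; rw [h2] at h1; exact ⟨h1, h2⟩
          · rintro ⟨h1, h2⟩; rw [h2]; exact ⟨h1, rfl⟩
        rw [this]
        exact (hnext σ n).inter (ih σ)
  let α : X → ℕ → ℕ := fun x k => next (pre k x) x
  have hres : ∀ x k, PiNat.res (α x) k = pre k x := by
    intro x k
    induction k with
    | zero => rfl
    | succ k ih => rw [PiNat.res_succ, ih]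
  refine ⟨α, measurable_pi_iff.2 fun k => measurable_to_countable' fun n => ?_, ?_⟩
  · have : (fun x => α x k) ⁻¹' {n} = ⋃ σ, {x | next σ x = n} ∩ {x | pre k x = σ} := by
      ext x
      simp [α]
    rw [this]
    exact MeasurableSet.iUnion fun σ => (hnext σ n).inter (hpre k σ)
  · filter_upwards [hnull] with x hx hxq
    have hmem : ∀ k, x ∈ B (pre k x) := by
      intro k
      induction k with
      | zero =>
        apply hAB
        obtain ⟨β, rfl⟩ := hxq
        exact ⟨β, rfl, rfl⟩
      | succ k ih =>
        exact (Nat.find_spec (hex (pre k x) x)).resolve_right (not_forall_not.2 (hx _ ih))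
    by_contra hne
    obtain ⟨u, hu, hqu, hxu⟩ : ∃ u : Set X, IsClosed u ∧ u ∈ nhds (q (α x)) ∧ x ∉ u := by
      obtain ⟨u, hu, hc, hsub⟩ := exists_mem_nhds_isClosed_subset
        (isOpen_compl_singleton.mem_nhds (show q (α x) ∈ ({x} : Set X)ᶜ from hne))
      exact ⟨u, hc, hu, fun h => hsub h rfl⟩
    have hpre' := hq.continuousAt.preimage_mem_nhds hqu
    obtain ⟨v, ⟨y, n, rfl⟩, hv, hvu⟩ :=
      (PiNat.isTopologicalBasis_cylinders (fun _ : ℕ => ℕ)).mem_nhds_iff.1 hpre'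
    have hAu : A (pre n x) ⊆ u := by
      rintro _ ⟨β, hβ, rfl⟩
      apply hvu
      rw [PiNat.cylinder_eq_res] at hv ⊢
      have hl : (pre n x).length = n := by rw [← hres, PiNat.res_length]
      simp only [Set.mem_ofPred_eq] at hv hβ ⊢
      rw [hl, ← hres] at hβ
      rw [hβ, hv]
    exact hxu (closure_minimal hAu hu (hmem n).2)

/-- Almost everywhere measurable sections of a measurable map restricted to a measurable set. -/
lemma exists_measurable_section_ae {X Y : Type*} [MeasurableSpace X] [StandardBorelSpace X]
    [MeasurableSpace Y] [StandardBorelSpace Y] [Nonempty Y] (μ : Measure X) [IsFiniteMeasure μ]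
    {p : Y → X} (hp : Measurable p) {Q : Set Y} (hQ : MeasurableSet Q) :
    ∃ g : X → Y, Measurable g ∧ ∀ᵐ x ∂μ, x ∈ p '' Q → g x ∈ Q ∧ p (g x) = x := by
  let := upgradeStandardBorel X
  let tY := upgradeStandardBorel Y
  have hY : ‹MeasurableSpace Y› = @borel Y tY.toTopologicalSpace :=
    eq_borel_upgradeStandardBorel Y
  obtain ⟨t', ht, hpc, hpol⟩ := hp.exists_continuous
  have hbor := borel_eq_borel_of_le hpol tY.toPolishSpace ht
  clear ht
  clear_value tY
  let : TopologicalSpace Y := t'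
  have : BorelSpace Y := ⟨hY.trans hbor.symm⟩
  have hQa := hQ.analyticSet
  rw [AnalyticSet] at hQa
  obtain h | ⟨f, hf, hfQ⟩ := hQa
  · obtain ⟨y⟩ := ‹Nonempty Y›
    exact ⟨fun _ => y, measurable_const, by simp [h]⟩
  · obtain ⟨α, hα, hae⟩ := exists_measurable_rightInverse_ae μ (p ∘ f) (hpc.comp hf)
    refine ⟨f ∘ α, hf.measurable.comp hα, ?_⟩
    filter_upwards [hae] with x hx hxQ
    rw [← hfQ] at hxQ ⊢
    rw [← Set.range_comp] at hxQ
    exact ⟨⟨_, rfl⟩, hx hxQ⟩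

/-- Inside a measurable set on which each `f i` moves points within their `E`-class, there is a
measurable subset on which finitely many of the `f i` are injective and which almost every point
reaches through `E`. -/
lemma exists_measurableSet_injOn_ae {X ι : Type*} [MeasurableSpace X] [StandardBorelSpace X]
    [Nonempty X] (μ : Measure X) [IsFiniteMeasure μ] {E : X → X → Prop} (hE : Equivalence E)
    {f : ι → X → X} (hf : ∀ i, Measurable (f i)) {D : Set X} (hD : MeasurableSet D)
    (hDE : ∀ x ∈ D, ∀ i, E x (f i x)) (J : Finset ι) :
    ∃ (Q : Set X) (e : X → X), MeasurableSet Q ∧ Measurable e ∧ Q ⊆ D ∧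
      (∀ i ∈ J, Set.InjOn (f i) Q) ∧ ∀ᵐ x ∂μ, x ∈ D → e x ∈ Q ∧ E x (e x) := by
  classical
  induction J using Finset.induction_on with
  | empty =>
    exact ⟨D, id, hD, measurable_id, subset_rfl, by simp,
      Filter.Eventually.of_forall fun x hx => ⟨hx, hE.refl x⟩⟩
  | insert i J _ ih =>
    obtain ⟨Q, e, hQ, he, hQD, hinj, hae⟩ := ih
    obtain ⟨g, hg, hgae⟩ := exists_measurable_section_ae (μ.map (f i ∘ e)) (hf i) hQ
    refine ⟨Q ∩ {z | g (f i z) = z}, g ∘ f i ∘ e,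
      hQ.inter (measurableSet_eq_fun (hg.comp (hf i)) measurable_id),
      hg.comp ((hf i).comp he), Set.inter_subset_left.trans hQD, ?_, ?_⟩
    · intro j hj
      rcases Finset.mem_insert.1 hj with rfl | hj
      · intro a ha b hb hab
        rw [← ha.2, ← hb.2, hab]
      · exact (hinj j hj).mono Set.inter_subset_left
    · filter_upwards [hae, ae_of_ae_map ((hf i).comp he).aemeasurable hgae] with x hx hgx hxD
      obtain ⟨h1, h2⟩ := hx hxD
      obtain ⟨h3, h4⟩ := hgx ⟨e x, h1, rfl⟩
      simp only [Function.comp_apply] at h3 h4 ⊢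
      refine ⟨⟨h3, by simp only [Set.mem_ofPred_eq, h4]⟩, ?_⟩
      refine hE.trans h2 (hE.trans (hDE _ (hQD h1) i) ?_)
      have := hDE _ (hQD h3) i
      rw [h4] at this
      exact hE.symm this

/-- Finitely many distinct real numbers have distinct integer parts after scaling. -/
lemma exists_nat_injective_floor {ι : Type*} [Finite ι] {a : ι → ℝ} (ha : Function.Injective a) :
    ∃ N : ℕ, Function.Injective fun i => ⌊(N : ℝ) * a i⌋ := by
  have h : ∀ i j, ∀ᶠ N : ℕ in Filter.atTop, ⌊(N : ℝ) * a i⌋ = ⌊(N : ℝ) * a j⌋ → i = j := by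
    intro i j
    by_cases hij : i = j
    · simp [hij]
    · have hpos : 0 < |a i - a j| := abs_pos.2 (sub_ne_zero.2 fun h => hij (ha h))
      obtain ⟨N₀, hN₀⟩ := exists_nat_gt (1 / |a i - a j|)
      filter_upwards [Filter.eventually_ge_atTop N₀] with N hN hfl
      have h1 := Int.abs_sub_lt_one_of_floor_eq_floor hfl
      rw [← mul_sub, abs_mul, Nat.abs_cast] at h1
      have h2 : 1 / |a i - a j| < N := hN₀.trans_le (by exact_mod_cast hN)
      rw [div_lt_iff₀ hpos] at h2
      linarith
  obtain ⟨N, hN⟩ := (Filter.eventually_all.2 fun i => Filter.eventually_all.2 fun j => h i j).exists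
  exact ⟨N, fun i j => hN i j⟩

/-- If all classes of a Borel equivalence relation have at least `k` elements, there is a Borel
family of pairwise disjoint `k`-tuples of equivalent points meeting the class of almost every
point. -/
lemma exists_disjoint_tuples {X : Type*} [MeasurableSpace X] [StandardBorelSpace X]
    [Nonempty X] (μ : Measure X) [IsFiniteMeasure μ] {E : X → X → Prop} (hE : Equivalence E)
    (hEm : MeasurableSet {p : X × X | E p.1 p.2}) {k : ℕ} [NeZero k]
    (hk : ∀ x, (k : ℕ∞) ≤ {y | E x y}.encard) :
    ∃ (S : Set (ℕ × X)) (t : Fin k → ℕ × X → X), MeasurableSet S ∧ (∀ i, Measurable (t i)) ∧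
      (∀ s ∈ S, ∀ s' ∈ S, ∀ i j, t i s = t j s' → s = s' ∧ i = j) ∧
      (∀ s ∈ S, ∀ i j, E (t i s) (t j s)) ∧ ∀ᵐ x ∂μ, ∃ s ∈ S, ∃ i, E x (t i s) := by
  classical
  have hinjm : MeasurableSet {y : Fin k → X | Function.Injective y} := by
    have : {y : Fin k → X | Function.Injective y} = ⋂ i, ⋂ j, {y | y i = y j → i = j} := by
      ext y
      simp [Function.Injective]
    rw [this]
    refine MeasurableSet.iInter fun i => MeasurableSet.iInter fun j => ?_
    by_cases hij : i = j
    · simp [hij]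
    · simp only [hij, imp_false]
      exact (measurableSet_eq_fun (measurable_pi_apply i) (measurable_pi_apply j)).compl
  have hY : MeasurableSet {p : X × (Fin k → X) | Function.Injective p.2 ∧ ∀ i, E p.1 (p.2 i)} := by
    have : MeasurableSet {p : X × (Fin k → X) | ∀ i, E p.1 (p.2 i)} := by
      simp only [Set.ofPred_forall]
      refine MeasurableSet.iInter fun i => ?_
      have : Measurable fun p : X × (Fin k → X) => (p.1, p.2 i) :=
        measurable_fst.prodMk ((measurable_pi_apply i).comp measurable_snd)
      exact this hEm
    exact (measurable_snd hinjm).inter this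
  obtain ⟨g, hg, hgae⟩ := exists_measurable_section_ae μ measurable_fst hY
  let f : Fin k → X → X := fun i x => (g x).2 i
  have hf : ∀ i, Measurable (f i) := fun i => (measurable_pi_apply i).comp (measurable_snd.comp hg)
  let G : Set X := {x | Function.Injective (fun i => f i x) ∧ ∀ i, E x (f i x)}
  have hGm : MeasurableSet G :=
    (measurable_id.prodMk (measurable_pi_lambda _ hf)) hY
  have hGae : ∀ᵐ x ∂μ, x ∈ G := by
    filter_upwards [hgae] with x hx
    obtain ⟨T, hT, hTk⟩ := Set.exists_subset_encard_eq (hk x)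
    have hfin : T.Finite := Set.finite_of_encard_eq_coe hTk
    have hcard : Nat.card T = k := by
      rw [Nat.card_coe_set_eq, Set.ncard, hTk, ENat.toNat_natCast]
    have := hfin.to_subtype
    let eq := (Finite.equivFinOfCardEq hcard).symm
    obtain ⟨h1, h2⟩ := hx ⟨(x, fun i => eq i),
      ⟨fun i j h => eq.injective (Subtype.ext h), fun i => hT (eq i).2⟩, rfl⟩
    refine ⟨h1.1, fun i => ?_⟩
    have := h1.2 i
    rwa [h2] at this
  let c := embeddingReal X
  have hc : MeasurableEmbedding c := measurableEmbedding_embeddingReal X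
  obtain ⟨idx, hidx⟩ := exists_surjective_nat (ℕ × (Fin k → ℤ))
  let D : ℕ → Set X := fun n =>
    {x | x ∈ G ∧ Function.Injective (idx n).2 ∧ ∀ i, ⌊((idx n).1 : ℝ) * c (f i x)⌋ = (idx n).2 i}
  have hDm : ∀ n, MeasurableSet (D n) := fun n => by
    have : MeasurableSet {x | ∀ i, ⌊((idx n).1 : ℝ) * c (f i x)⌋ = (idx n).2 i} := by
      simp only [Set.ofPred_forall]
      exact MeasurableSet.iInter fun i =>
        (((hc.measurable.comp (hf i)).const_mul _).floor) (measurableSet_singleton _)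
    exact hGm.inter ((MeasurableSet.const _).inter this)
  choose Q e hQ he hQD hQinj hQae using fun n =>
    exists_measurableSet_injOn_ae μ hE hf (hDm n) (fun x hx i => hx.1.2 i) Finset.univ
  let C : ℕ → Set X := fun n =>
    Nat.rec ∅ (fun n C => C ∪ ⋃ i, f i '' {z | z ∈ Q n ∧ ∀ j, f j z ∉ C}) n
  let Q' : ℕ → Set X := fun n => {z | z ∈ Q n ∧ ∀ j, f j z ∉ C n}
  have hCsucc : ∀ n, C (n + 1) = C n ∪ ⋃ i, f i '' Q' n := fun n => rfl
  have hQ'of : ∀ n, MeasurableSet (C n) → MeasurableSet (Q' n) := fun n hn => by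
    have : MeasurableSet {z | ∀ j, f j z ∉ C n} := by
      simp only [Set.ofPred_forall]
      exact MeasurableSet.iInter fun j => (hf j hn).compl
    exact (hQ n).inter this
  have hCm : ∀ n, MeasurableSet (C n) := by
    intro n
    induction n with
    | zero => exact MeasurableSet.empty
    | succ n ih =>
      rw [hCsucc]
      exact ih.union (MeasurableSet.iUnion fun i => (hQ'of n ih).image_of_measurable_injOn (hf i)
        ((hQinj n i (Finset.mem_univ i)).mono fun z hz => hz.1))
  have hCmono : Monotone C := monotone_nat_of_le_succ fun n => Set.subset_union_left
  have hCsub : ∀ n y, y ∈ C n → ∃ m, ∃ z ∈ Q' m, ∃ j, f j z = y := by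
    intro n
    induction n with
    | zero => exact fun y hy => hy.elim
    | succ n ih =>
      intro y hy
      rw [hCsucc] at hy
      rcases hy with hy | hy
      · exact ih y hy
      · obtain ⟨j, z, hz, rfl⟩ := Set.mem_iUnion.1 hy
        exact ⟨n, z, hz, j, rfl⟩
  have hlt : ∀ n m z z' i j, n < m → z ∈ Q' n → z' ∈ Q' m → f i z ≠ f j z' := by
    intro n m z z' i j hnm hz hz' h
    refine hz'.2 j (hCmono (Nat.succ_le_of_lt hnm) ?_)
    rw [Nat.succ_eq_add_one, hCsucc, ← h]
    exact Or.inr (Set.mem_iUnion.2 ⟨i, z, hz, rfl⟩)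
  refine ⟨{s | s.2 ∈ Q' s.1}, fun i s => f i s.2, ?_, fun i => (hf i).comp measurable_snd,
    ?_, ?_, ?_⟩
  · have : {s : ℕ × X | s.2 ∈ Q' s.1} = ⋃ n, {n} ×ˢ Q' n := by
      ext ⟨n, x⟩
      simp
    rw [this]
    exact MeasurableSet.iUnion fun n => (measurableSet_singleton n).prod (hQ'of n (hCm n))
  · rintro ⟨n, z⟩ hz ⟨m, z'⟩ hz' i j h
    simp only [Set.mem_ofPred_eq] at hz hz' h
    rcases lt_trichotomy n m with hnm | rfl | hnm
    · exact (hlt n m z z' i j hnm hz hz' h).elim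
    · have hi := (hQD n hz.1).2.2 i
      have hj := (hQD n hz'.1).2.2 j
      have hij : i = j := (hQD n hz.1).2.1 (by rw [← hi, ← hj, h])
      subst hij
      exact ⟨by rw [hQinj n i (Finset.mem_univ i) hz.1 hz'.1 h], rfl⟩
    · exact (hlt m n z' z j i hnm hz' hz h.symm).elim
  · rintro ⟨n, z⟩ hz i j
    have := (hQD n hz.1).1.2
    exact hE.trans (hE.symm (this i)) (this j)
  · filter_upwards [hGae, ae_all_iff.2 hQae] with x hxG hx
    obtain ⟨N, hN⟩ := exists_nat_injective_floor (hc.injective.comp hxG.1)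
    obtain ⟨n, hn⟩ := hidx (N, fun i => ⌊(N : ℝ) * c (f i x)⌋)
    have hxD : x ∈ D n := ⟨hxG, by rw [hn]; exact hN, by simp [hn]⟩
    obtain ⟨h1, h2⟩ := hx n hxD
    have hz := (hQD n h1).1.2
    rcases Classical.em (e n x ∈ Q' n) with hmem | hmem
    · exact ⟨(n, e n x), hmem, 0, hE.trans h2 (hz 0)⟩
    · have : ∃ j, f j (e n x) ∈ C n := by
        refine Classical.byContradiction fun hcon => ?_
        exact hmem ⟨h1, not_exists.1 hcon⟩
      obtain ⟨j, hj⟩ := this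
      obtain ⟨m, z, hzm, i, hi⟩ := hCsub n _ hj
      exact ⟨(m, z), hzm, i, by rw [hi]; exact hE.trans h2 (hz j)⟩

/-- Iterating a measurable map `f` until a measurable set `S` is reached gives a measurable map. -/
lemma exists_measurable_firstHit {Y : Type*} [MeasurableSpace Y] {f : Y → Y} (hf : Measurable f)
    {S : Set Y} (hS : MeasurableSet S) :
    ∃ e : Y → Y, Measurable e ∧ ∀ x, (∃ n, f^[n] x ∈ S) →
      ∃ n, e x = f^[n] x ∧ f^[n] x ∈ S ∧ ∀ k < n, f^[k] x ∉ S := by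
  classical
  let p : ℕ → Y → Prop := fun n x => f^[n] x ∈ S ∨ ∀ m, f^[m] x ∉ S
  have hp : ∀ n, MeasurableSet {x | p n x} := fun n => by
    have : MeasurableSet {x | ∀ m, f^[m] x ∉ S} := by
      simp only [Set.ofPred_forall]
      exact MeasurableSet.iInter fun m => (hf.iterate m hS).compl
    exact (hf.iterate n hS).union this
  have h : ∀ x, ∃ n, p n x := fun x => by
    rcases Classical.em (∃ n, f^[n] x ∈ S) with ⟨n, hn⟩ | hx
    · exact ⟨n, Or.inl hn⟩
    · exact ⟨0, Or.inr (not_exists.1 hx)⟩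
  refine ⟨fun x => f^[Nat.find (h x)] x, Measurable.find (fun n => hf.iterate n) hp h, ?_⟩
  rintro x ⟨m, hm⟩
  refine ⟨Nat.find (h x), rfl, ?_, fun k hk hkS => Nat.find_min (h x) hk (Or.inl hkS)⟩
  exact (Nat.find_spec (h x)).resolve_right fun hno => hno m hm

/-- A set closed under `f` outside `S` contains all iterates up to the first visit to `S`. -/
lemma iterate_mem_of_forall_notMem {Y : Type*} {f : Y → Y} {S C : Set Y}
    (hC : ∀ z ∈ C, z ∉ S → f z ∈ C) {x : Y} (hx : x ∈ C) {n : ℕ} (hn : ∀ k < n, f^[k] x ∉ S) :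
    f^[n] x ∈ C := by
  induction n with
  | zero => exact hx
  | succ n ih =>
    rw [Function.iterate_succ_apply']
    exact hC _ (ih fun k hk => hn k (hk.trans n.lt_succ_self)) (hn n n.lt_succ_self)

/-- Iterates of points outside the range of an injective map are distinct. -/
lemma eq_of_iterate_eq_of_notMem_image {Y : Type*} {f : Y → Y} {S C : Set Y}
    (hC : ∀ z ∈ C, z ∉ S → f z ∈ C) (hinj : ∀ y ∈ C, ∀ z ∈ C, y ∉ S → z ∉ S → f y = f z → y = z)
    {a b : Y} (ha : a ∈ C) (hb : b ∈ C) (ha' : ∀ z ∈ C, z ∉ S → f z ≠ a)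
    (hb' : ∀ z ∈ C, z ∉ S → f z ≠ b) {n m : ℕ} (hn : ∀ k < n, f^[k] a ∉ S)
    (hm : ∀ k < m, f^[k] b ∉ S) (h : f^[n] a = f^[m] b) : a = b := by
  induction n generalizing m with
  | zero =>
    cases m with
    | zero => exact h
    | succ m =>
      rw [Function.iterate_succ_apply'] at h
      exact (ha' _ (iterate_mem_of_forall_notMem hC hb fun k hk => hm k (hk.trans m.lt_succ_self))
        (hm m m.lt_succ_self) h.symm).elim
  | succ n ih =>
    have hnC := iterate_mem_of_forall_notMem hC ha fun k hk => hn k (hk.trans n.lt_succ_self)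
    rw [Function.iterate_succ_apply'] at h
    cases m with
    | zero => exact (hb' _ hnC (hn n n.lt_succ_self) h).elim
    | succ m =>
      rw [Function.iterate_succ_apply'] at h
      exact ih (fun k hk => hn k (hk.trans n.lt_succ_self))
        (fun k hk => hm k (hk.trans m.lt_succ_self)) (hinj _ hnC _
          (iterate_mem_of_forall_notMem hC hb fun k hk => hm k (hk.trans m.lt_succ_self))
          (hn n n.lt_succ_self) (hm m m.lt_succ_self) h)

/-- A Borel involution of a standard Borel space has a Borel set containing exactly one point of
each of its two-point orbits. -/
lemma exists_measurableSet_involution {Y : Type*} [MeasurableSpace Y] [StandardBorelSpace Y]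
    {g : Y → Y} (hg : Measurable g) (hgg : ∀ y, g (g y) = y) :
    ∃ D : Set Y, MeasurableSet D ∧ ∀ y, g y ≠ y → (g y ∈ D ↔ y ∉ D) := by
  have hc := measurableEmbedding_embeddingReal Y
  refine ⟨{y | embeddingReal Y y < embeddingReal Y (g y)},
    measurableSet_lt hc.measurable (hc.measurable.comp hg), fun y hy => ?_⟩
  have : embeddingReal Y (g y) ≠ embeddingReal Y y := fun h => hy (hc.injective h)
  simp only [Set.mem_ofPred_eq, hgg, not_lt]
  exact ⟨le_of_lt, fun h => lt_of_le_of_ne h this⟩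

/-- `Linked g T M v w`: the points `v` and `w` lie in the same class of the equivalence relation
generated by the cells of `T` and by the pairs `{x, g x}` with `x ∈ M`. -/
def Linked {Y : Type*} (g : Y → Y) (T : Fin 3 → Y → Y) (M : Set Y) (v w : Y) : Prop :=
  ∀ S : Set Y, (∀ x i, x ∈ S ↔ T i x ∈ S) → (∀ x ∈ M, x ∈ S ↔ g x ∈ S) → (v ∈ S ↔ w ∈ S)

namespace Linked

variable {Y : Type*} {g : Y → Y} {T : Fin 3 → Y → Y} {M M' : Set Y} {u v w : Y}

lemma refl (v : Y) : Linked g T M v v := fun _ _ _ => Iff.rfl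

lemma trans (h : Linked g T M u v) (h' : Linked g T M v w) : Linked g T M u w :=
  fun S h1 h2 => (h S h1 h2).trans (h' S h1 h2)

lemma mono (h : Linked g T M v w) (hM : M ⊆ M') : Linked g T M' v w :=
  fun S h1 h2 => h S h1 fun x hx => h2 x (hM hx)

lemma of_mem (h : v ∈ M) : Linked g T M v (g v) := fun _ _ h2 => h2 v h

end Linked

/-- A stage in the construction of a Borel set `A` which meets almost every cell `{T i y | i}`
and contains at most one point of each pair `{y, g y}`. The points of `O` have been chosen, those
outside `P` are linked to a chosen point through the set `M` of pairs used for transport, and each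
`v ∈ P` is linked to `n + 2` free points `ρ i v`. -/
structure Stage {Y : Type*} [MeasurableSpace Y] (g : Y → Y) (T : Fin 3 → Y → Y) (n : ℕ) where
  P : Set Y
  M : Set Y
  O : Set Y
  ρ : Fin (n + 2) → Y → Y
  measurableSet_P : MeasurableSet P
  measurableSet_M : MeasurableSet M
  measurableSet_O : MeasurableSet O
  measurable_ρ : ∀ i, Measurable (ρ i)
  map_mem_M : ∀ y ∈ M, g y ∈ M
  notMem_O : ∀ y ∈ M, y ∉ O
  eq_of_mem_O : ∀ y ∈ O, g y ∈ O → g y = y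
  ρ_mem : ∀ v ∈ P, ∀ i, ρ i v ∈ P
  ρ_ρ : ∀ v ∈ P, ∀ i j, ρ j (ρ i v) = ρ j v
  ρ_injective : ∀ v ∈ P, ∀ i j, ρ i v = ρ j v → i = j
  ρ_notMem_M : ∀ v ∈ P, ∀ i, ρ i v ∉ M
  ρ_notMem_O : ∀ v ∈ P, ∀ i, ρ i v ∉ O
  map_ρ_notMem_O : ∀ v ∈ P, ∀ i, g (ρ i v) ∉ O
  linked_ρ : ∀ v ∈ P, ∀ i, Linked g T M v (ρ i v)
  exists_linked : ∀ v, v ∉ P → ∃ o ∈ O, Linked g T M v o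

namespace Stage

variable {Y : Type*} [MeasurableSpace Y] {n n' n'' : ℕ} {g : Y → Y} {T : Fin 3 → Y → Y}

/-- `s.Extends s'`: the stage `s'` is later than `s`. -/
def Extends (s : Stage g T n) (s' : Stage g T n') : Prop :=
  s.M ⊆ s'.M ∧ s.O ⊆ s'.O ∧ s'.P ⊆ s.P

lemma Extends.trans {s : Stage g T n} {s' : Stage g T n'} {s'' : Stage g T n''}
    (h : s.Extends s') (h' : s'.Extends s'') : s.Extends s'' :=
  ⟨h.1.trans h'.1, h.2.1.trans h'.2.1, h'.2.2.trans h.2.2⟩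

/-- The points `ρ 0 v`, for `v ∈ P`. -/
def heads (s : Stage g T n) : Set Y := {y | y ∈ s.P ∧ s.ρ 0 y = y}

/-- The points `ρ i v`, for `v ∈ P` and `i ≠ 0`. -/
def tails (s : Stage g T n) : Set Y := {y | y ∈ s.P ∧ ∃ i, i ≠ 0 ∧ s.ρ i y = y}

/-- The points whose head is matched by `g` with a different head. -/
def matched (s : Stage g T n) : Set Y :=
  {v | v ∈ s.P ∧ g (s.ρ 0 v) ∈ s.heads ∧ g (s.ρ 0 v) ≠ s.ρ 0 v}

variable (s : Stage g T n)

lemma ρ_zero_mem_heads {v : Y} (hv : v ∈ s.P) : s.ρ 0 v ∈ s.heads :=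
  ⟨s.ρ_mem v hv 0, s.ρ_ρ v hv 0 0⟩

lemma ρ_mem_tails {v : Y} (hv : v ∈ s.P) {i : Fin (n + 2)} (hi : i ≠ 0) : s.ρ i v ∈ s.tails :=
  ⟨s.ρ_mem v hv i, i, hi, s.ρ_ρ v hv i i⟩

lemma ρ_ne_of_mem_tails {y : Y} (hy : y ∈ s.tails) : s.ρ 0 y ≠ y := by
  obtain ⟨hP, i, hi, h⟩ := hy
  intro h0
  exact hi (s.ρ_injective y hP i 0 (h.trans h0.symm))

lemma notMem_heads_of_mem_tails {y : Y} (hy : y ∈ s.tails) : y ∉ s.heads :=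
  fun h => s.ρ_ne_of_mem_tails hy h.2

lemma mem_matched_ρ_iff {v : Y} (hv : v ∈ s.P) (i : Fin (n + 2)) :
    s.ρ i v ∈ s.matched ↔ v ∈ s.matched := by
  simp only [matched, Set.mem_ofPred_eq, s.ρ_ρ v hv i 0, hv, s.ρ_mem v hv i]

lemma measurableSet_heads [MeasurableEq Y] : MeasurableSet s.heads :=
  s.measurableSet_P.inter (measurableSet_eq_fun (s.measurable_ρ 0) measurable_id)

lemma measurableSet_tails [MeasurableEq Y] : MeasurableSet s.tails := by
  have : MeasurableSet {y | ∃ i, i ≠ 0 ∧ s.ρ i y = y} := by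
    simp only [Set.ofPred_exists]
    exact MeasurableSet.iUnion fun i => (MeasurableSet.const _).inter
      (measurableSet_eq_fun (s.measurable_ρ i) measurable_id)
  exact s.measurableSet_P.inter this

lemma measurableSet_matched [MeasurableEq Y] (hg : Measurable g) : MeasurableSet s.matched :=
  s.measurableSet_P.inter (((hg.comp (s.measurable_ρ 0)) s.measurableSet_heads).inter
    (measurableSet_eq_fun (hg.comp (s.measurable_ρ 0)) (s.measurable_ρ 0)).compl)

lemma map_mem_matched (hgg : ∀ y, g (g y) = y) {v : Y} (hv : v ∈ s.matched) :
    g (s.ρ 0 v) ∈ s.matched := by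
  obtain ⟨h1, h2, h3⟩ := hv
  refine ⟨h2.1, ?_, ?_⟩
  · rw [h2.2, hgg]
    exact s.ρ_zero_mem_heads h1
  · rw [h2.2, hgg]
    exact h3.symm

/-- Choosing the points of `O'` disposes of the points outside `P'`. -/
def close (ι : Fin (n' + 2) → Fin (n + 2)) (hι : Function.Injective ι) (P' O' : Set Y)
    (hP' : MeasurableSet P') (hO' : MeasurableSet O') (hgg : ∀ y, g (g y) = y) (hsub : P' ⊆ s.P)
    (hinv : ∀ v ∈ P', ∀ i, s.ρ (ι i) v ∈ P')
    (hO : ∀ o ∈ O', o ∈ s.P ∧ o ∉ P' ∧ ∃ i, s.ρ i o = o)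
    (hconf : ∀ o ∈ O', g o ∈ O' → g o = o) (hcov : ∀ v ∈ s.P, v ∉ P' → ∃ i, s.ρ i v ∈ O')
    (hfree : ∀ v ∈ P', ∀ i, g (s.ρ (ι i) v) ∉ O') : Stage g T n' where
  P := P'
  M := s.M
  O := s.O ∪ O'
  ρ := fun i => s.ρ (ι i)
  measurableSet_P := hP'
  measurableSet_M := s.measurableSet_M
  measurableSet_O := s.measurableSet_O.union hO'
  measurable_ρ := fun i => s.measurable_ρ (ι i)
  map_mem_M := s.map_mem_M
  notMem_O := by
    rintro y hy (h | h)
    · exact s.notMem_O y hy h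
    · obtain ⟨h1, -, i, h2⟩ := hO y h
      exact s.ρ_notMem_M y h1 i (by rwa [h2])
  eq_of_mem_O := by
    rintro y (hy | hy) (h | h)
    · exact s.eq_of_mem_O y hy h
    · obtain ⟨h1, -, i, h2⟩ := hO _ h
      exact (s.map_ρ_notMem_O _ h1 i (by rwa [h2, hgg])).elim
    · obtain ⟨h1, -, i, h2⟩ := hO _ hy
      exact (s.map_ρ_notMem_O _ h1 i (by rwa [h2])).elim
    · exact hconf y hy h
  ρ_mem := hinv
  ρ_ρ := fun v hv i j => s.ρ_ρ v (hsub hv) (ι i) (ι j)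
  ρ_injective := fun v hv i j h => hι (s.ρ_injective v (hsub hv) _ _ h)
  ρ_notMem_M := fun v hv i => s.ρ_notMem_M v (hsub hv) _
  ρ_notMem_O := by
    rintro v hv i (h | h)
    · exact s.ρ_notMem_O v (hsub hv) _ h
    · exact (hO _ h).2.1 (hinv v hv i)
  map_ρ_notMem_O := by
    rintro v hv i (h | h)
    · exact s.map_ρ_notMem_O v (hsub hv) _ h
    · exact hfree v hv i h
  linked_ρ := fun v hv i => s.linked_ρ v (hsub hv) _
  exists_linked := by
    intro v hv
    rcases Classical.em (v ∈ s.P) with h | h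
    · obtain ⟨i, hi⟩ := hcov v h hv
      exact ⟨_, Or.inr hi, s.linked_ρ v h i⟩
    · obtain ⟨o, ho, h⟩ := s.exists_linked v h
      exact ⟨o, Or.inl ho, h⟩

/-- No tail can be pushed forever along `y ↦ ρ 1 (g y)` through heads. -/
def Finitary : Prop :=
  ∀ y ∈ s.tails, ∃ k, g ((fun z => s.ρ 1 (g z))^[k] y) ∉ s.heads

lemma exists_finitary [MeasurableEq Y] (hg : Measurable g) (hgg : ∀ y, g (g y) = y) :
    ∃ s' : Stage g T n, s.Extends s' ∧ s'.Finitary := by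
  let q : Y → Y := fun z => s.ρ 1 (g z)
  have hq : Measurable q := (s.measurable_ρ 1).comp hg
  let I : Set Y := {y | y ∈ s.tails ∧ ∀ k, g (q^[k] y) ∈ s.heads}
  have hI : MeasurableSet I := by
    have : MeasurableSet {y | ∀ k, g (q^[k] y) ∈ s.heads} := by
      simp only [Set.ofPred_forall]
      exact MeasurableSet.iInter fun k => (hg.comp (hq.iterate k)) s.measurableSet_heads
    exact s.measurableSet_tails.inter this
  let P' : Set Y := {v | v ∈ s.P ∧ ∀ i, s.ρ i v ∉ I}
  have hP' : MeasurableSet P' := by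
    have : MeasurableSet {v | ∀ i, s.ρ i v ∉ I} := by
      simp only [Set.ofPred_forall]
      exact MeasurableSet.iInter fun i => (s.measurable_ρ i hI).compl
    exact s.measurableSet_P.inter this
  have hIP : ∀ o ∈ I, o ∉ P' := by
    rintro o ho h
    obtain ⟨-, i, -, hi⟩ := ho.1
    exact h.2 i (by rwa [hi])
  refine ⟨s.close id Function.injective_id P' I hP' hI hgg (fun v hv => hv.1) ?_ ?_ ?_ ?_ ?_,
    ⟨subset_rfl, Set.subset_union_left, fun v hv => hv.1⟩, ?_⟩
  · intro v hv i
    refine ⟨s.ρ_mem v hv.1 _, fun j => ?_⟩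
    rw [id, s.ρ_ρ v hv.1]
    exact hv.2 j
  · intro o ho
    obtain ⟨h, i, -, hi⟩ := ho.1
    exact ⟨h, hIP o ho, i, hi⟩
  · exact fun o ho hgo => (s.notMem_heads_of_mem_tails hgo.1 (ho.2 0)).elim
  · intro v hv hv'
    refine Classical.byContradiction fun h => hv' ⟨hv, not_exists.1 h⟩
  · intro v hv i h
    have h0 : s.ρ i v ∈ s.heads := by simpa [hgg] using h.2 0
    have hi : i = 0 := by
      refine s.ρ_injective v hv.1 _ _ ?_
      rw [← h0.2, s.ρ_ρ v hv.1]
    refine hv.2 1 ⟨s.ρ_mem_tails hv.1 (by simp), fun k => ?_⟩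
    have := h.2 (k + 1)
    rw [Function.iterate_succ_apply] at this
    simpa only [q, id, hgg, s.ρ_ρ v hv.1] using this
  · rintro y ⟨hy, i, hi, hiy⟩
    refine Classical.byContradiction fun h => hIP y ⟨⟨hy.1, i, hi, hiy⟩, fun k => ?_⟩ hy
    have := Classical.not_not.1 (not_exists.1 h k)
    exact ⟨this.1.1, this.2⟩

/-- The points reaching a matched point in `k` steps of `v ↦ g (ρ 0 v)` inside `P`. -/
def flow : ℕ → Set Y
  | 0 => s.matched
  | k + 1 => {v | v ∈ s.P ∧ g (s.ρ 0 v) ∈ flow k}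

lemma flow_subset (k : ℕ) : s.flow k ⊆ s.P := by
  cases k with
  | zero => exact fun v hv => hv.1
  | succ k => exact fun v hv => hv.1

lemma mem_flow_ρ_iff {v : Y} (hv : v ∈ s.P) (i : Fin (n + 2)) (k : ℕ) :
    s.ρ i v ∈ s.flow k ↔ v ∈ s.flow k := by
  cases k with
  | zero => exact s.mem_matched_ρ_iff hv i
  | succ k => simp only [flow, Set.mem_ofPred_eq, s.ρ_ρ v hv i 0, hv, s.ρ_mem v hv i]

lemma measurableSet_flow [MeasurableEq Y] (hg : Measurable g) (k : ℕ) :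
    MeasurableSet (s.flow k) := by
  induction k with
  | zero => exact s.measurableSet_matched hg
  | succ k ih => exact s.measurableSet_P.inter ((hg.comp (s.measurable_ρ 0)) ih)

lemma exists_flow [MeasurableEq Y] (hg : Measurable g) (hgg : ∀ y, g (g y) = y)
    (hs : s.Finitary) :
    ∃ s' : Stage g T n, s.Extends s' ∧ s'.Finitary ∧ ∀ v ∈ s'.P, ∃ k, v ∈ s'.flow k := by
  let D : Set Y := ⋃ k, s.flow k
  have hD : MeasurableSet D := MeasurableSet.iUnion fun k => s.measurableSet_flow hg k
  have hDP : D ⊆ s.P := Set.iUnion_subset fun k => s.flow_subset k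
  have hDρ : ∀ v ∈ s.P, ∀ i, s.ρ i v ∈ D ↔ v ∈ D := fun v hv i => by
    simp only [D, Set.mem_iUnion, s.mem_flow_ρ_iff hv]
  let O' : Set Y := s.heads \ D
  let s' : Stage g T n := s.close id Function.injective_id D O' hD
    (s.measurableSet_heads.diff hD) hgg hDP (fun v hv i => (hDρ v (hDP hv) i).2 hv)
    (fun o ho => ⟨ho.1.1, ho.2, 0, ho.1.2⟩)
    (by
      intro o ho hgo
      refine Classical.byContradiction fun h => ho.2 (Set.mem_iUnion.2 ⟨0, ho.1.1, ?_⟩)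
      rw [ho.1.2]
      exact ⟨hgo.1, h⟩)
    (fun v hv hvD => ⟨0, s.ρ_zero_mem_heads hv, fun h => hvD ((hDρ v hv 0).1 h)⟩)
    (by
      intro v hv i h
      obtain ⟨k, hk⟩ := Set.mem_iUnion.1 ((hDρ v (hDP hv) i).2 hv)
      refine h.2 (Set.mem_iUnion.2 ⟨k + 1, h.1.1, ?_⟩)
      rw [h.1.2, hgg]
      exact hk)
  have hmut : ∀ v ∈ s.matched, v ∈ s'.matched := fun v hv =>
    ⟨Set.mem_iUnion.2 ⟨0, hv⟩, ⟨Set.mem_iUnion.2 ⟨0, s.map_mem_matched hgg hv⟩, hv.2.1.2⟩, hv.2.2⟩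
  have hflow : ∀ k, ∀ v ∈ s.flow k, v ∈ s'.flow k := by
    intro k
    induction k with
    | zero => exact hmut
    | succ k ih => exact fun v hv => ⟨Set.mem_iUnion.2 ⟨k + 1, hv⟩, ih _ hv.2⟩
  refine ⟨s', ⟨subset_rfl, Set.subset_union_left, hDP⟩, ?_, fun v hv => ?_⟩
  · rintro y ⟨hy, i, hi, hiy⟩
    obtain ⟨k, hk⟩ := hs y ⟨hDP hy, i, hi, hiy⟩
    exact ⟨k, fun h => hk ⟨hDP h.1, h.2⟩⟩
  · obtain ⟨k, hk⟩ := Set.mem_iUnion.1 hv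
    exact ⟨k, hflow k v hk⟩

/-- Once all points flow to matched points and tails can only be pushed finitely often, cells can
be merged along `g` so that all points become matched. -/
lemma exists_forall_matched [MeasurableEq Y] (hg : Measurable g) (hgg : ∀ y, g (g y) = y)
    (hfin : s.Finitary) (hflow : ∀ v ∈ s.P, ∃ k, v ∈ s.flow k) :
    ∃ s' : Stage g T n, s.Extends s' ∧ ∀ v ∈ s'.P, v ∈ s'.matched := by
  classical
  let φ : Y → Y := fun v => g (s.ρ 0 v)
  let q : Y → Y := fun z => s.ρ 1 (g z)
  let U : Set Y := {y | g y ∉ s.heads}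
  let W : Set Y := {y | y ∈ s.heads ∧ y ∉ s.matched}
  let M' : Set Y := s.M ∪ (W ∪ g ⁻¹' W)
  have hφ : Measurable φ := hg.comp (s.measurable_ρ 0)
  have hq : Measurable q := (s.measurable_ρ 1).comp hg
  have hW : MeasurableSet W := s.measurableSet_heads.inter (s.measurableSet_matched hg).compl
  obtain ⟨κ, hκ, hκspec⟩ := exists_measurable_firstHit hφ (s.measurableSet_matched hg)
  obtain ⟨e, he, hespec⟩ := exists_measurable_firstHit hq
    (show MeasurableSet U from (hg s.measurableSet_heads).compl)
  have hMM' : s.M ⊆ M' := Set.subset_union_left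
  have hflow' : ∀ v ∈ s.P, v ∉ s.matched → φ v ∈ s.P := by
    intro v hv hvm
    obtain ⟨k, hk⟩ := hflow v hv
    cases k with
    | zero => exact (hvm hk).elim
    | succ k => exact s.flow_subset k hk.2
  have hreach : ∀ v ∈ s.P, ∃ k, φ^[k] v ∈ s.matched := by
    intro v hv
    obtain ⟨k, hk⟩ := hflow v hv
    induction k generalizing v with
    | zero => exact ⟨0, hk⟩
    | succ k ih =>
      obtain ⟨m, hm⟩ := ih _ (s.flow_subset k hk.2) hk.2
      exact ⟨m + 1, hm⟩
  have hκ_matched : ∀ v ∈ s.P, κ v ∈ s.matched := fun v hv => by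
    obtain ⟨k, hk, hkm, -⟩ := hκspec v (hreach v hv)
    rwa [hk]
  have hκ_of_matched : ∀ v ∈ s.matched, κ v = v := fun v hv => by
    obtain ⟨k, hk, -, hlt⟩ := hκspec v (hreach v hv.1)
    cases k with
    | zero => exact hk
    | succ k => exact (hlt 0 k.succ_pos hv).elim
  have hκ_step : ∀ v ∈ s.P, v ∉ s.matched → κ v = κ (φ v) := fun v hv hvm => by
    obtain ⟨k, hk, hkm, hlt⟩ := hκspec v (hreach v hv)
    obtain ⟨l, hl, hlm, hlt'⟩ := hκspec (φ v) (hreach _ (hflow' v hv hvm))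
    cases k with
    | zero => exact (hvm hkm).elim
    | succ k =>
      have : k = l := by
        rcases lt_trichotomy k l with h | h | h
        · exact (hlt' k h hkm).elim
        · exact h
        · exact (hlt (l + 1) (Nat.succ_lt_succ h) hlm).elim
      rw [hk, hl, this, Function.iterate_succ_apply]
  let h : Y → Y := fun v => s.ρ 0 (κ v)
  have hh_heads : ∀ v ∈ s.P, h v ∈ s.heads := fun v hv => s.ρ_zero_mem_heads (hκ_matched v hv).1
  have hh_matched : ∀ v ∈ s.P, h v ∈ s.matched := fun v hv =>
    (s.mem_matched_ρ_iff (hκ_matched v hv).1 0).2 (hκ_matched v hv)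
  have hh_of : ∀ v ∈ s.matched, v ∈ s.heads → h v = v := fun v hv hv' => by
    simp only [h, hκ_of_matched v hv, hv'.2]
  have hh_ρ : ∀ v ∈ s.P, ∀ i, h (s.ρ i v) = h v := fun v hv i => by
    rcases Classical.em (v ∈ s.matched) with hm | hm
    · simp only [h, hκ_of_matched v hm, hκ_of_matched _ ((s.mem_matched_ρ_iff hv i).2 hm),
        s.ρ_ρ v hv]
    · have hm' := fun h' => hm ((s.mem_matched_ρ_iff hv i).1 h')
      simp only [h, hκ_step v hv hm, hκ_step _ (s.ρ_mem v hv i) hm', φ, s.ρ_ρ v hv]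
  have hW_of : ∀ y ∈ s.tails, g y ∈ s.heads → g y ∈ W := fun y hy hgy => by
    refine ⟨hgy, fun hm => s.notMem_heads_of_mem_tails hy ?_⟩
    have := hm.2.1
    rwa [hgy.2, hgg] at this
  have hq_tails : ∀ y ∈ s.tails, y ∉ U → q y ∈ s.tails := fun y _ hyU =>
    s.ρ_mem_tails (Classical.not_not.1 hyU).1 (by simp)
  have hh_q : ∀ y ∈ s.tails, y ∉ U → h (q y) = h y := fun y hy hyU => by
    have hgy := Classical.not_not.1 hyU
    rw [show h (q y) = h (g y) from hh_ρ _ hgy.1 1]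
    simp only [h, hκ_step _ hgy.1 (hW_of y hy hgy).2, φ, hgy.2, hgg]
  have hlink_q : ∀ y ∈ s.tails, y ∉ U → Linked g T M' y (q y) := fun y hy hyU => by
    have hgy := Classical.not_not.1 hyU
    have hyM : y ∈ M' := Or.inr (Or.inr (hW_of y hy hgy))
    exact (Linked.of_mem hyM).trans
      ((s.linked_ρ _ hgy.1 1).mono hMM')
  have hq_inj : ∀ y ∈ s.tails, ∀ z ∈ s.tails, y ∉ U → z ∉ U → q y = q z → y = z := by
    intro y _ z _ hyU hzU hyz
    have hgy := Classical.not_not.1 hyU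
    have hgz := Classical.not_not.1 hzU
    have := congrArg (s.ρ 0) hyz
    simp only [q, s.ρ_ρ _ hgy.1, s.ρ_ρ _ hgz.1, hgy.2, hgz.2] at this
    rw [← hgg y, this, hgg]
  have hq_ne : ∀ v ∈ s.matched, ∀ i, ∀ z ∈ s.tails, z ∉ U → q z ≠ s.ρ i v := by
    intro v hv i z hz hzU hzv
    have hgz := Classical.not_not.1 hzU
    have := congrArg (s.ρ 0) hzv
    simp only [q, s.ρ_ρ _ hgz.1, s.ρ_ρ _ hv.1, hgz.2] at this
    refine (hW_of z hz hgz).2 ?_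
    rw [this]
    exact (s.mem_matched_ρ_iff hv.1 0).2 hv
  have he_mem : ∀ y ∈ s.tails, e y ∈ s.tails ∧ e y ∈ U ∧ h (e y) = h y ∧ Linked g T M' y (e y) := by
    intro y hy
    obtain ⟨k, hk, hkU, hlt⟩ := hespec y (hfin y hy)
    have := iterate_mem_of_forall_notMem (f := q) (S := U)
      (C := {z | z ∈ s.tails ∧ h z = h y ∧ Linked g T M' y z})
      (fun z hz hzU => ⟨hq_tails z hz.1 hzU, (hh_q z hz.1 hzU).trans hz.2.1,
        hz.2.2.trans (hlink_q z hz.1 hzU)⟩) ⟨hy, rfl, Linked.refl y⟩ hlt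
    rw [hk]
    exact ⟨this.1, hkU, this.2⟩
  have he_inj : ∀ v ∈ s.matched, ∀ i j, i ≠ 0 → j ≠ 0 → e (s.ρ i v) = e (s.ρ j v) → i = j := by
    intro v hv i j hi hj hij
    have hti := s.ρ_mem_tails hv.1 hi
    have htj := s.ρ_mem_tails hv.1 hj
    obtain ⟨k, hk, -, hlt⟩ := hespec _ (hfin _ hti)
    obtain ⟨l, hl, -, hlt'⟩ := hespec _ (hfin _ htj)
    rw [hk, hl] at hij
    exact s.ρ_injective v hv.1 i j (eq_of_iterate_eq_of_notMem_image hq_tails hq_inj hti htj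
      (hq_ne v hv i) (hq_ne v hv j) hlt hlt' hij)
  have hlink_h : ∀ v ∈ s.P, Linked g T M' v (h v) := by
    intro v hv
    obtain ⟨k, hk, hkm, hlt⟩ := hκspec v (hreach v hv)
    have := iterate_mem_of_forall_notMem (f := φ) (S := s.matched)
      (C := {z | z ∈ s.P ∧ Linked g T M' v z}) (fun z hz hzm => ⟨hflow' z hz.1 hzm,
        hz.2.trans (((s.linked_ρ z hz.1 0).mono hMM').trans (Linked.of_mem (Or.inr (Or.inl
          ⟨s.ρ_zero_mem_heads hz.1, fun h' => hzm ((s.mem_matched_ρ_iff hz.1 0).1 h')⟩))))⟩)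
      ⟨hv, Linked.refl v⟩ hlt
    rw [← hk] at this
    exact this.2.trans ((s.linked_ρ _ this.1 0).mono hMM')
  let r : Fin (n + 2) → Y → Y := fun i v => if i = 0 then h v else e (s.ρ i (h v))
  have hr0 : ∀ v, r 0 v = h v := fun v => if_pos rfl
  have hri : ∀ i, i ≠ 0 → ∀ v, r i v = e (s.ρ i (h v)) := fun i hi v => if_neg hi
  have hr_h : ∀ v ∈ s.P, ∀ i, h (r i v) = h v := by
    intro v hv i
    rcases Classical.em (i = 0) with rfl | hi
    · rw [hr0, hh_of _ (hh_matched v hv) (hh_heads v hv)]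
    · rw [hri i hi, (he_mem _ (s.ρ_mem_tails (hh_heads v hv).1 hi)).2.2.1,
        hh_ρ _ (hh_heads v hv).1, hh_of _ (hh_matched v hv) (hh_heads v hv)]
  have hr_fix : ∀ v ∈ s.P, ∀ i, r i v ∈ s.P ∧ ∃ j, s.ρ j (r i v) = r i v := by
    intro v hv i
    rcases Classical.em (i = 0) with rfl | hi
    · rw [hr0]
      exact ⟨(hh_heads v hv).1, 0, (hh_heads v hv).2⟩
    · rw [hri i hi]
      obtain ⟨h1, j, -, h2⟩ := (he_mem _ (s.ρ_mem_tails (hh_heads v hv).1 hi)).1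
      exact ⟨h1, j, h2⟩
  have hr_W : ∀ v ∈ s.P, ∀ i, r i v ∉ W ∧ g (r i v) ∉ W := by
    intro v hv i
    rcases Classical.em (i = 0) with rfl | hi
    · rw [hr0]
      refine ⟨fun h' => h'.2 (hh_matched v hv), fun h' => h'.2 ?_⟩
      have := s.map_mem_matched hgg (hh_matched v hv)
      rwa [(hh_heads v hv).2] at this
    · rw [hri i hi]
      obtain ⟨h1, h2, -⟩ := he_mem _ (s.ρ_mem_tails (hh_heads v hv).1 hi)
      exact ⟨fun h' => s.notMem_heads_of_mem_tails h1 h'.1, fun h' => h2 h'.1⟩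
  let s' : Stage g T n :=
    { P := s.P
      M := M'
      O := s.O
      ρ := r
      measurableSet_P := s.measurableSet_P
      measurableSet_M := s.measurableSet_M.union (hW.union (hg hW))
      measurableSet_O := s.measurableSet_O
      measurable_ρ := by
        intro i
        have hhm : Measurable h := (s.measurable_ρ 0).comp hκ
        rcases Classical.em (i = 0) with rfl | hi
        · simpa only [r, if_true] using hhm
        · have : Measurable fun v => e (s.ρ i (h v)) := he.comp ((s.measurable_ρ i).comp hhm)
          simpa only [r, hi, if_false] using this
      map_mem_M := by
        rintro y (hy | hy | hy)
        · exact Or.inl (s.map_mem_M y hy)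
        · refine Or.inr (Or.inr ?_)
          rwa [Set.mem_preimage, hgg]
        · exact Or.inr (Or.inl hy)
      notMem_O := by
        rintro y (hy | hy | hy)
        · exact s.notMem_O y hy
        · rw [← hy.1.2]
          exact s.ρ_notMem_O y hy.1.1 0
        · have := s.map_ρ_notMem_O (g y) hy.1.1 0
          rwa [hy.1.2, hgg] at this
      eq_of_mem_O := s.eq_of_mem_O
      ρ_mem := fun v hv i => (hr_fix v hv i).1
      ρ_ρ := by
        intro v hv i j
        have := hr_h v hv i
        simp only [r] at this ⊢
        simp only [this]
      ρ_injective := by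
        intro v hv i j hij
        have ht := fun i hi => (he_mem _ (s.ρ_mem_tails (hh_heads v hv).1 (i := i) hi)).1
        rcases Classical.em (i = 0) with hi | hi <;> rcases Classical.em (j = 0) with hj | hj
        · rw [hi, hj]
        · rw [hi, hr0, hri j hj] at hij
          exact (s.notMem_heads_of_mem_tails (ht j hj) (by rw [← hij]; exact hh_heads v hv)).elim
        · rw [hj, hr0, hri i hi] at hij
          exact (s.notMem_heads_of_mem_tails (ht i hi) (by rw [hij]; exact hh_heads v hv)).elim
        · rw [hri i hi, hri j hj] at hij
          exact he_inj _ (hh_matched v hv) i j hi hj hij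
      ρ_notMem_M := by
        intro v hv i h'
        obtain ⟨h1, j, h2⟩ := hr_fix v hv i
        rcases h' with h' | h' | h'
        · exact s.ρ_notMem_M _ h1 j (by rwa [h2])
        · exact (hr_W v hv i).1 h'
        · exact (hr_W v hv i).2 h'
      ρ_notMem_O := by
        intro v hv i
        obtain ⟨h1, j, h2⟩ := hr_fix v hv i
        rw [← h2]
        exact s.ρ_notMem_O _ h1 j
      map_ρ_notMem_O := by
        intro v hv i
        obtain ⟨h1, j, h2⟩ := hr_fix v hv i
        rw [← h2]
        exact s.map_ρ_notMem_O _ h1 j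
      linked_ρ := by
        intro v hv i
        rcases Classical.em (i = 0) with rfl | hi
        · rw [hr0]
          exact hlink_h v hv
        · rw [hri i hi]
          exact (hlink_h v hv).trans (((s.linked_ρ _ (hh_heads v hv).1 i).mono hMM').trans
            (he_mem _ (s.ρ_mem_tails (hh_heads v hv).1 hi)).2.2.2)
      exists_linked := by
        intro v hv
        obtain ⟨o, ho, hl⟩ := s.exists_linked v hv
        exact ⟨o, ho, hl.mono hMM'⟩ }
  refine ⟨s', ⟨hMM', subset_rfl, subset_rfl⟩, fun v hv => ⟨hv, ?_⟩⟩
  have hm := hh_matched v hv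
  have hgm := s.map_mem_matched hgg hm
  have hgh := hm.2
  rw [(hh_heads v hv).2] at hgm hgh
  rw [show s'.ρ 0 v = h v from hr0 v]
  refine ⟨⟨hgm.1, ?_⟩, hgh.2⟩
  rw [show s'.ρ 0 (g (h v)) = h (g (h v)) from hr0 _]
  exact hh_of _ hgm hgh.1

/-- Cells can be merged so that all points become matched. -/
lemma exists_matched [MeasurableEq Y] (hg : Measurable g) (hgg : ∀ y, g (g y) = y) :
    ∃ s' : Stage g T n, s.Extends s' ∧ ∀ v ∈ s'.P, v ∈ s'.matched := by
  obtain ⟨s₁, h₁, hfin⟩ := s.exists_finitary hg hgg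
  obtain ⟨s₂, h₂, hfin₂, hflow⟩ := s₁.exists_flow hg hgg hfin
  obtain ⟨s₃, h₃, hm⟩ := s₂.exists_forall_matched hg hgg hfin₂ hflow
  exact ⟨s₃, (h₁.trans h₂).trans h₃, hm⟩

/-- Joining matched triples in pairs yields quadruples. -/
lemma exists_quadruples [StandardBorelSpace Y] (hg : Measurable g) (hgg : ∀ y, g (g y) = y)
    (s : Stage g T 1) (hs : ∀ v ∈ s.P, v ∈ s.matched) :
    ∃ s' : Stage g T 2, s.Extends s' := by
  classical
  obtain ⟨D, hD, hDg⟩ := exists_measurableSet_involution hg hgg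
  let M' : Set Y := s.M ∪ s.heads
  have hMM' : s.M ⊆ M' := Set.subset_union_left
  have hgh : ∀ y ∈ s.heads, g y ∈ s.heads ∧ g y ≠ y := fun y hy => by
    have := (hs y hy.1).2
    rwa [hy.2] at this
  let c : Y → Y := fun v => if s.ρ 0 v ∈ D then s.ρ 0 v else g (s.ρ 0 v)
  have hc : Measurable c :=
    Measurable.ite (s.measurable_ρ 0 hD) (s.measurable_ρ 0) (hg.comp (s.measurable_ρ 0))
  have hc_mem : ∀ v ∈ s.P, c v ∈ s.heads ∧ c v ∈ D := fun v hv => by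
    have hv0 := s.ρ_zero_mem_heads hv
    rcases Classical.em (s.ρ 0 v ∈ D) with h | h
    · simp only [c, h, if_true]
      exact ⟨hv0, trivial⟩
    · simp only [c, h, if_false]
      exact ⟨(hgh _ hv0).1, (hDg _ (hgh _ hv0).2).2 h⟩
  have hc_link : ∀ v ∈ s.P, Linked g T M' v (c v) := fun v hv => by
    have hl := (s.linked_ρ v hv 0).mono hMM'
    rcases Classical.em (s.ρ 0 v ∈ D) with h | h
    · simpa only [c, h, if_true] using hl
    · simpa only [c, h, if_false] using
        hl.trans (Linked.of_mem (Or.inr (s.ρ_zero_mem_heads hv)))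
  let side : Fin 4 → Bool := ![true, true, false, false]
  let pos : Fin 4 → Fin 3 := ![1, 2, 1, 2]
  have hpos : ∀ i, pos i ≠ 0 := by decide
  have hpair : ∀ i j, pos i = pos j → side i = side j → i = j := by decide
  let d : Fin 4 → Y → Y := fun i v => if side i then c v else g (c v)
  have hd_mem : ∀ v ∈ s.P, ∀ i, d i v ∈ s.heads := fun v hv i => by
    cases hi : side i with
    | true => simpa only [d, hi, if_true] using (hc_mem v hv).1
    | false => simpa [d, hi] using (hgh _ (hc_mem v hv).1).1
  have hd_link : ∀ v ∈ s.P, ∀ i, Linked g T M' v (d i v) := fun v hv i => by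
    cases hi : side i with
    | true => simpa only [d, hi, if_true] using hc_link v hv
    | false => simpa [d, hi] using
        (hc_link v hv).trans (Linked.of_mem (Or.inr (hc_mem v hv).1))
  have hd_side : ∀ v ∈ s.P, ∀ i j, d i v = d j v → side i = side j := fun v hv i j h => by
    have := (hgh _ (hc_mem v hv).1).2
    cases hi : side i <;> cases hj : side j
    · rfl
    · exact (this (by simpa [d, hi, hj] using h)).elim
    · exact (this (by simpa [d, hi, hj] using h.symm)).elim
    · rfl
  have hcd : ∀ v ∈ s.P, ∀ i, c (s.ρ (pos i) (d i v)) = c v := fun v hv i => by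
    have h0 : s.ρ 0 (s.ρ (pos i) (d i v)) = d i v := by
      rw [s.ρ_ρ _ (hd_mem v hv i).1, (hd_mem v hv i).2]
    obtain ⟨h1, h2⟩ := hc_mem v hv
    have h3 : g (c v) ∉ D := fun h => (hDg _ (hgh _ h1).2).1 h h2
    have hc_eq : c (s.ρ (pos i) (d i v)) = if d i v ∈ D then d i v else g (d i v) := by
      simp only [c, h0]
    rw [hc_eq]
    cases hi : side i with
    | true => simp [d, hi, h2]
    | false => simp [d, hi, h3, hgg]
  let s' : Stage g T 2 :=
    { P := s.P
      M := M'
      O := s.O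
      ρ := fun i v => s.ρ (pos i) (d i v)
      measurableSet_P := s.measurableSet_P
      measurableSet_M := s.measurableSet_M.union s.measurableSet_heads
      measurableSet_O := s.measurableSet_O
      measurable_ρ := by
        intro i
        refine (s.measurable_ρ _).comp ?_
        cases hi : side i with
        | true => simpa only [d, hi, if_true] using hc
        | false =>
          have : Measurable fun v => g (c v) := hg.comp hc
          simpa [d, hi] using this
      map_mem_M := by
        rintro y (hy | hy)
        · exact Or.inl (s.map_mem_M y hy)
        · exact Or.inr (hgh y hy).1
      notMem_O := by
        rintro y (hy | hy)
        · exact s.notMem_O y hy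
        · rw [← hy.2]
          exact s.ρ_notMem_O y hy.1 0
      eq_of_mem_O := s.eq_of_mem_O
      ρ_mem := fun v hv i => s.ρ_mem _ (hd_mem v hv i).1 _
      ρ_ρ := by
        intro v hv i j
        have : d j (s.ρ (pos i) (d i v)) = d j v := by
          simp only [d] at hcd ⊢
          simp only [hcd v hv i]
        rw [this]
      ρ_injective := by
        intro v hv i j h
        have h0 := congrArg (s.ρ 0) h
        rw [s.ρ_ρ _ (hd_mem v hv i).1, s.ρ_ρ _ (hd_mem v hv j).1, (hd_mem v hv i).2,
          (hd_mem v hv j).2] at h0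
        rw [h0] at h
        exact hpair i j (s.ρ_injective _ (hd_mem v hv j).1 _ _ h) (hd_side v hv i j h0)
      ρ_notMem_M := by
        rintro v hv i (h | h)
        · exact s.ρ_notMem_M _ (hd_mem v hv i).1 _ h
        · exact s.notMem_heads_of_mem_tails (s.ρ_mem_tails (hd_mem v hv i).1 (hpos i)) h
      ρ_notMem_O := fun v hv i => s.ρ_notMem_O _ (hd_mem v hv i).1 _
      map_ρ_notMem_O := fun v hv i => s.map_ρ_notMem_O _ (hd_mem v hv i).1 _
      linked_ρ := fun v hv i =>
        (hd_link v hv i).trans ((s.linked_ρ _ (hd_mem v hv i).1 _).mono hMM')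
      exists_linked := by
        intro v hv
        obtain ⟨o, ho, hl⟩ := s.exists_linked v hv
        exact ⟨o, ho, hl.mono hMM'⟩ }
  exact ⟨s', hMM', subset_rfl, subset_rfl⟩

/-- Choosing the heads on one side of the matching disposes of half of the remaining mass, at the
cost of one point in each cell. -/
lemma exists_half [StandardBorelSpace Y] (ν : Measure Y) (hg : Measurable g)
    (hgg : ∀ y, g (g y) = y) (s : Stage g T (n + 1)) (hs : ∀ v ∈ s.P, v ∈ s.matched) :
    ∃ s' : Stage g T n, s.Extends s' ∧ 2 * ν s'.P ≤ ν s.P := by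
  obtain ⟨D, hD, hDg⟩ := exists_measurableSet_involution hg hgg
  have key : ∀ D : Set Y, MeasurableSet D → (∀ y, g y ≠ y → (g y ∈ D ↔ y ∉ D)) →
      ∃ s' : Stage g T n, s.Extends s' ∧ s'.P = s.P ∩ s.ρ 0 ⁻¹' D := by
    intro D hD hDg
    have hP' : MeasurableSet (s.P ∩ s.ρ 0 ⁻¹' D) := s.measurableSet_P.inter (s.measurable_ρ 0 hD)
    have hsub : s.P ∩ s.ρ 0 ⁻¹' D ⊆ s.P := Set.inter_subset_left
    have hO' : ∀ o ∈ s.heads \ (s.P ∩ s.ρ 0 ⁻¹' D), o ∉ D := fun o ho h =>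
      ho.2 ⟨ho.1.1, by rwa [Set.mem_preimage, ho.1.2]⟩
    refine ⟨s.close Fin.succ (Fin.succ_injective _) (s.P ∩ s.ρ 0 ⁻¹' D)
      (s.heads \ (s.P ∩ s.ρ 0 ⁻¹' D)) hP' (s.measurableSet_heads.diff hP') hgg hsub ?_ ?_ ?_ ?_ ?_,
      ⟨subset_rfl, Set.subset_union_left, hsub⟩, rfl⟩
    · rintro v ⟨hv, hvD⟩ i
      refine ⟨s.ρ_mem v hv _, ?_⟩
      rwa [Set.mem_preimage, s.ρ_ρ v hv]
    · exact fun o ho => ⟨ho.1.1, ho.2, 0, ho.1.2⟩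
    · intro o ho hgo
      refine Classical.byContradiction fun h => hO' _ hgo ((hDg o h).2 (hO' o ho))
    · intro v hv hv'
      refine ⟨0, s.ρ_zero_mem_heads hv, fun h => hv' ⟨hv, ?_⟩⟩
      have := h.2
      rwa [Set.mem_preimage, s.ρ_ρ v hv] at this
    · intro v hv i h
      have h1 := (hs _ h.1.1).2.1
      rw [h.1.2, hgg] at h1
      exact s.notMem_heads_of_mem_tails (s.ρ_mem_tails hv.1 (Fin.succ_ne_zero i)) h1
  have hsum : ν (s.P ∩ s.ρ 0 ⁻¹' D) + ν (s.P ∩ s.ρ 0 ⁻¹' Dᶜ) = ν s.P :=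
    measure_inter_add_sdiff s.P (s.measurable_ρ 0 hD)
  rcases le_total (ν (s.P ∩ s.ρ 0 ⁻¹' D)) (ν (s.P ∩ s.ρ 0 ⁻¹' Dᶜ)) with h | h
  · obtain ⟨s', h1, h2⟩ := key D hD hDg
    refine ⟨s', h1, ?_⟩
    rw [h2, two_mul, ← hsum]
    gcongr
  · obtain ⟨s', h1, h2⟩ := key Dᶜ hD.compl fun y hy => by
      simp only [Set.mem_compl_iff, hDg y hy]
    refine ⟨s', h1, ?_⟩
    rw [h2, two_mul, ← hsum]
    gcongr

/-- One round of the construction halves the remaining mass. -/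
lemma exists_round [StandardBorelSpace Y] (ν : Measure Y) (hg : Measurable g)
    (hgg : ∀ y, g (g y) = y) (s : Stage g T 1) :
    ∃ s' : Stage g T 1, s.Extends s' ∧ 2 * ν s'.P ≤ ν s.P := by
  obtain ⟨s₁, h₁, hm₁⟩ := s.exists_matched hg hgg
  obtain ⟨s₂, h₂⟩ := exists_quadruples hg hgg s₁ hm₁
  obtain ⟨s₃, h₃, hm₃⟩ := s₂.exists_matched hg hgg
  obtain ⟨s₄, h₄, hν⟩ := exists_half ν hg hgg s₃ hm₃
  exact ⟨s₄, ((h₁.trans h₂).trans h₃).trans h₄,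
    hν.trans (measure_mono ((h₁.trans h₂).trans h₃).2.2)⟩

end Stage

/-- Given a Borel involution `g` and a Borel partition into triples, there is a Borel set meeting
almost every triple and containing at most one point of each orbit of `g`. -/
lemma exists_measurableSet_meeting_triples {Y : Type*} [MeasurableSpace Y] [StandardBorelSpace Y]
    (ν : Measure Y) [IsFiniteMeasure ν] {g : Y → Y} (hg : Measurable g) (hgg : ∀ y, g (g y) = y)
    {T : Fin 3 → Y → Y} (hT : ∀ i, Measurable (T i)) (hTT : ∀ y i j, T j (T i y) = T j y)
    (hTinj : ∀ y i j, T i y = T j y → i = j) (hTid : ∀ y, ∃ i, T i y = y) :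
    ∃ A : Set Y, MeasurableSet A ∧ (∀ y ∈ A, g y ∈ A → g y = y) ∧ ∀ᵐ y ∂ν, ∃ i, T i y ∈ A := by
  let s₀ : Stage g T 1 :=
    { P := Set.univ
      M := ∅
      O := ∅
      ρ := T
      measurableSet_P := MeasurableSet.univ
      measurableSet_M := MeasurableSet.empty
      measurableSet_O := MeasurableSet.empty
      measurable_ρ := hT
      map_mem_M := fun _ h => h.elim
      notMem_O := fun _ h => h.elim
      eq_of_mem_O := fun _ h => h.elim
      ρ_mem := fun _ _ _ => trivial
      ρ_ρ := fun v _ => hTT v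
      ρ_injective := fun v _ => hTinj v
      ρ_notMem_M := fun _ _ _ h => h
      ρ_notMem_O := fun _ _ _ h => h
      map_ρ_notMem_O := fun _ _ _ h => h
      linked_ρ := fun v _ i _ h _ => h v i
      exists_linked := fun _ h => (h trivial).elim }
  choose next hnext hνnext using Stage.exists_round (T := T) ν hg hgg
  let s : ℕ → Stage g T 1 := fun k => next^[k] s₀
  have hs : ∀ k, s (k + 1) = next (s k) := fun k => Function.iterate_succ_apply' _ _ _
  have hMmono : Monotone fun k => (s k).M := monotone_nat_of_le_succ fun k => by
    rw [hs]
    exact (hnext _).1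
  have hOmono : Monotone fun k => (s k).O := monotone_nat_of_le_succ fun k => by
    rw [hs]
    exact (hnext _).2.1
  have hν : ∀ k, 2 ^ k * ν (s k).P ≤ ν Set.univ := by
    intro k
    induction k with
    | zero => simpa using measure_mono (Set.subset_univ _)
    | succ k ih =>
      rw [pow_succ, mul_assoc, hs]
      exact (mul_le_mul_right (hνnext (s k)) _).trans ih
  let M : Set Y := ⋃ k, (s k).M
  let O : Set Y := ⋃ k, (s k).O
  have hM : MeasurableSet M := MeasurableSet.iUnion fun k => (s k).measurableSet_M
  have hO : MeasurableSet O := MeasurableSet.iUnion fun k => (s k).measurableSet_O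
  have hMg : ∀ y ∈ M, g y ∈ M := fun y hy => by
    obtain ⟨k, hk⟩ := Set.mem_iUnion.1 hy
    exact Set.mem_iUnion.2 ⟨k, (s k).map_mem_M y hk⟩
  have hMO : ∀ y ∈ M, y ∉ O := fun y hy hyO => by
    obtain ⟨k, hk⟩ := Set.mem_iUnion.1 hy
    obtain ⟨l, hl⟩ := Set.mem_iUnion.1 hyO
    exact (s (max k l)).notMem_O y (hMmono (le_max_left k l) hk) (hOmono (le_max_right k l) hl)
  have hOg : ∀ y ∈ O, g y ∈ O → g y = y := fun y hy hyO => by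
    obtain ⟨k, hk⟩ := Set.mem_iUnion.1 hy
    obtain ⟨l, hl⟩ := Set.mem_iUnion.1 hyO
    exact (s (max k l)).eq_of_mem_O y (hOmono (le_max_left k l) hk) (hOmono (le_max_right k l) hl)
  have hlink : ∀ᵐ y ∂ν, ∃ o ∈ O, Linked g T M y o := by
    have hzero : ν (⋂ k, (s k).P) = 0 := by
      refine Classical.byContradiction fun hne => ?_
      obtain ⟨k, hk⟩ := ENNReal.exists_nat_mul_gt hne (measure_ne_top ν Set.univ)
      refine absurd hk (not_lt.2 ((mul_le_mul' ?_ (measure_mono (Set.iInter_subset _ k))).trans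
        (hν k)))
      exact_mod_cast k.lt_two_pow_self.le
    filter_upwards [measure_eq_zero_iff_ae_notMem.1 hzero] with y hy
    obtain ⟨k, hk⟩ := Classical.not_forall.1 fun h => hy (Set.mem_iInter.2 h)
    obtain ⟨o, ho, h⟩ := (s k).exists_linked y hk
    exact ⟨o, Set.mem_iUnion.2 ⟨k, ho⟩, h.mono (Set.subset_iUnion (fun k => (s k).M) k)⟩
  let R : ℕ → Set Y := fun n => Nat.rec {y | ∃ i, T i y ∈ O}
    (fun _ R => R ∪ {y | ∃ i, T i y ∈ M ∧ g (T i y) ∈ R}) n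
  have hR0 : R 0 = {y | ∃ i, T i y ∈ O} := rfl
  have hRsucc : ∀ n, R (n + 1) = R n ∪ {y | ∃ i, T i y ∈ M ∧ g (T i y) ∈ R n} := fun n => rfl
  have hRm : ∀ n, MeasurableSet (R n) := by
    intro n
    induction n with
    | zero =>
      rw [hR0, Set.ofPred_exists]
      exact MeasurableSet.iUnion fun i => hT i hO
    | succ n ih =>
      rw [hRsucc, Set.ofPred_exists]
      exact ih.union (MeasurableSet.iUnion fun i => (hT i hM).inter ((hg.comp (hT i)) ih))
  have hRmono : Monotone R := monotone_nat_of_le_succ fun n => Set.subset_union_left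
  have hRT : ∀ n y i, y ∈ R n ↔ T i y ∈ R n := by
    intro n y i
    induction n with
    | zero => simp only [hR0, Set.mem_ofPred_eq, hTT]
    | succ n ih => simp only [hRsucc, Set.mem_union, Set.mem_ofPred_eq, hTT, ih]
  have hRM : ∀ y ∈ M, ∀ n, g y ∈ R n → y ∈ R (n + 1) := fun y hy n h => by
    obtain ⟨i, hi⟩ := hTid y
    exact Or.inr ⟨i, by rwa [hi], by rwa [hi]⟩
  refine ⟨O ∪ ⋃ n, {y | y ∈ M ∧ g y ∈ R n ∧ y ∉ R n}, hO.union (MeasurableSet.iUnion fun n =>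
    hM.inter ((hg (hRm n)).inter (hRm n).compl)), ?_, ?_⟩
  · rintro y (hy | hy) (hgy | hgy)
    · exact hOg y hy hgy
    · obtain ⟨n, hn, -⟩ := Set.mem_iUnion.1 hgy
      have := hMg _ hn
      rw [hgg] at this
      exact (hMO y this hy).elim
    · obtain ⟨n, hn, -⟩ := Set.mem_iUnion.1 hy
      exact (hMO _ (hMg y hn) hgy).elim
    · obtain ⟨n, -, h1, h2⟩ := Set.mem_iUnion.1 hy
      obtain ⟨m, -, h3, h4⟩ := Set.mem_iUnion.1 hgy
      rw [hgg] at h3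
      rcases le_total n m with h | h
      · exact (h4 (hRmono h h1)).elim
      · exact (h2 (hRmono h h3)).elim
  · filter_upwards [hlink] with y ⟨o, ho, h⟩
    have hyR : y ∈ ⋃ n, R n := by
      refine (h (⋃ n, R n) (fun x i => ?_) fun x hx => ?_).2 ?_
      · simp only [Set.mem_iUnion, ← hRT]
      · simp only [Set.mem_iUnion]
        refine ⟨fun ⟨n, hn⟩ => ⟨n + 1, hRM _ (hMg x hx) n (by rwa [hgg])⟩,
          fun ⟨n, hn⟩ => ⟨n + 1, hRM x hx n hn⟩⟩
      · obtain ⟨i, hi⟩ := hTid o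
        exact Set.mem_iUnion.2 ⟨0, i, by rwa [hi]⟩
    obtain ⟨n, hn⟩ := Set.mem_iUnion.1 hyR
    induction n with
    | zero =>
      obtain ⟨i, hi⟩ := hn
      exact ⟨i, Or.inl hi⟩
    | succ n ih =>
      rcases Classical.em (y ∈ R n) with h | h
      · exact ih h
      · obtain ⟨i, hi, hi'⟩ := hn.resolve_left h
        exact ⟨i, Or.inr (Set.mem_iUnion.2 ⟨n, hi, hi', fun hr => h ((hRT n y i).2 hr)⟩)⟩

/-- A Borel involution can be transported along a measurable embedding. -/
lemma exists_involution_extending {Z X : Type*} [MeasurableSpace Z] [MeasurableSpace X]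
    {Θ : Z → X} (hΘ : MeasurableEmbedding Θ) {τ : Z → Z} (hτ : Measurable τ)
    (hττ : ∀ z, τ (τ z) = z) :
    ∃ γ : X → X, Measurable γ ∧ (∀ x, γ (γ x) = x) ∧ ∀ z, γ (Θ z) = Θ (τ z) := by
  have h : ∀ z, Function.extend Θ (Θ ∘ τ) id (Θ z) = Θ (τ z) := fun z =>
    hΘ.injective.extend_apply _ _ z
  refine ⟨Function.extend Θ (Θ ∘ τ) id, hΘ.measurable_extend (hΘ.measurable.comp hτ) measurable_id,
    fun x => ?_, h⟩
  rcases Classical.em (∃ z, Θ z = x) with ⟨z, rfl⟩ | hx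
  · rw [h, h, hττ]
  · have : Function.extend Θ (Θ ∘ τ) id x = x := Function.extend_apply' _ _ _ hx
    rw [this, this]

/-- A Borel involution can be restricted along a measurable embedding, fixing the points that are
mapped outside the range. -/
lemma exists_involution_restricting {Y X : Type*} [MeasurableSpace Y]
    [MeasurableSpace X] [Nonempty Y] {Θ : Y → X} (hΘ : MeasurableEmbedding Θ) {γ : X → X}
    (hγ : Measurable γ) (hγγ : ∀ x, γ (γ x) = x) :
    ∃ g : Y → Y, Measurable g ∧ (∀ y, g (g y) = y) ∧ ∀ y y', γ (Θ y) = Θ y' → g y = y' := by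
  classical
  let r : X → Y := Function.extend Θ id fun _ => Classical.arbitrary Y
  have hr : ∀ y, r (Θ y) = y := fun y => hΘ.injective.extend_apply _ _ y
  have hrm : Measurable r := hΘ.measurable_extend measurable_id measurable_const
  have hm : Measurable fun y => γ (Θ y) := hγ.comp hΘ.measurable
  let g : Y → Y := fun y => if γ (Θ y) ∈ Set.range Θ then r (γ (Θ y)) else y
  have hg : ∀ y y', γ (Θ y) = Θ y' → g y = y' := fun y y' h => by
    simp only [g, h, Set.mem_range_self, if_true, hr]
  refine ⟨g, Measurable.ite (hm hΘ.measurableSet_range) (hrm.comp hm) measurable_id,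
    fun y => ?_, hg⟩
  rcases Classical.em (γ (Θ y) ∈ Set.range Θ) with ⟨y', h⟩ | h
  · rw [hg y y' h.symm]
    exact hg y' y (by rw [h, hγγ])
  · have : g y = y := if_neg h
    rw [this, this]

/-- Let `E` and `F` be countable Borel equivalence relations on a standard Borel space
`X` such that every `E`-class has cardinality `≥ 3` and every `F`-class has cardinality
`≥ 2`, and let `μ` be a Borel probability measure on `X`. Then `E` and `F` have Borel
disjoint complete sections modulo a `μ`-null set. -/
theorem stmt_16 (X : Type) [MeasurableSpace X] [StandardBorelSpace X]
    (μ : Measure X) [IsProbabilityMeasure μ]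
    (E F : X → X → Prop)
    (hE : Equivalence E) (hF : Equivalence F)
    (hEBorel : MeasurableSet {p : X × X | E p.1 p.2})
    (hFBorel : MeasurableSet {p : X × X | F p.1 p.2})
    (hECtble : ∀ x, {y | E x y}.Countable)
    (hFCtble : ∀ x, {y | F x y}.Countable)
    (hEcard : ∀ x, 3 ≤ {y | E x y}.encard)
    (hFcard : ∀ x, 2 ≤ {y | F x y}.encard) :
    ∃ A B : Set X, MeasurableSet A ∧ MeasurableSet B ∧ Disjoint A B ∧
      (∀ᵐ x ∂μ, ∃ y, E x y ∧ y ∈ A) ∧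
      (∀ᵐ x ∂μ, ∃ y, F x y ∧ y ∈ B) := by
  have : Nonempty X := μ.nonempty_of_neZero
  obtain ⟨S, t, hS, ht, htinj, htE, htae⟩ := exists_disjoint_tuples μ hE hEBorel (k := 3)
    fun x => by exact_mod_cast hEcard x
  obtain ⟨S', t', hS', ht', htinj', htF, htae'⟩ := exists_disjoint_tuples μ hF hFBorel (k := 2)
    fun x => by exact_mod_cast hFcard x
  have := hS.standardBorel
  have := hS'.standardBorel
  have hSne : Nonempty S := by
    obtain ⟨x, s, hs, -⟩ := htae.exists
    exact ⟨⟨s, hs⟩⟩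
  let Θ : S × Fin 3 → X := fun p => t p.2 p.1
  have hΘ : MeasurableEmbedding Θ := by
    refine Measurable.measurableEmbedding (measurable_from_prod_countable_left fun i =>
      (ht i).comp measurable_subtype_coe) ?_
    rintro ⟨⟨s, hs⟩, i⟩ ⟨⟨s', hs'⟩, j⟩ h
    obtain ⟨rfl, rfl⟩ := htinj s hs s' hs' i j h
    rfl
  let Θ' : S' × Fin 2 → X := fun p => t' p.2 p.1
  have hΘ' : MeasurableEmbedding Θ' := by
    refine Measurable.measurableEmbedding (measurable_from_prod_countable_left fun i =>
      (ht' i).comp measurable_subtype_coe) ?_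
    rintro ⟨⟨s, hs⟩, i⟩ ⟨⟨s', hs'⟩, j⟩ h
    obtain ⟨rfl, rfl⟩ := htinj' s hs s' hs' i j h
    rfl
  obtain ⟨γ, hγ, hγγ, hγΘ⟩ := exists_involution_extending hΘ'
    (τ := fun p => (p.1, Equiv.swap 0 1 p.2))
    (measurable_fst.prodMk ((measurable_of_countable _).comp measurable_snd)) (by simp)
  obtain ⟨g, hg, hgg, hgΘ⟩ := exists_involution_restricting hΘ hγ hγγ
  obtain ⟨f, hf, hfae⟩ := exists_measurable_section_ae μ
    (measurable_fst : Measurable (Prod.fst : X × S → X))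
    (Q := {p | E p.1 (t 0 p.2)})
    ((measurable_fst.prodMk ((ht 0).comp (measurable_subtype_coe.comp measurable_snd))) hEBorel)
  have hm : Measurable fun x => ((f x).2, (0 : Fin 3)) :=
    (measurable_snd.comp hf).prodMk measurable_const
  obtain ⟨A, hA, hAg, hAae⟩ := exists_measurableSet_meeting_triples
    (μ.map fun x => ((f x).2, (0 : Fin 3))) hg hgg (T := fun i p => (p.1, i))
    (fun i => measurable_fst.prodMk measurable_const) (fun _ _ _ => rfl)
    (fun _ _ _ h => congrArg Prod.snd h) (fun p => ⟨p.2, rfl⟩)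
  refine ⟨Θ '' A, (Θ '' A)ᶜ, hΘ.measurableSet_image.2 hA, (hΘ.measurableSet_image.2 hA).compl,
    disjoint_compl_right, ?_, ?_⟩
  · filter_upwards [htae, hfae, ae_of_ae_map hm.aemeasurable hAae] with x ⟨s, hs, j, hj⟩ hfx ⟨i, hi⟩
    obtain ⟨h1, h2⟩ := hfx ⟨(x, ⟨s, hs⟩), hE.trans hj (htE s hs j 0), rfl⟩
    refine ⟨_, ?_, _, hi, rfl⟩
    have h3 : E (f x).1 (t 0 (f x).2) := h1
    rw [h2] at h3
    exact hE.trans h3 (htE _ (f x).2.2 0 i)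
  · filter_upwards [htae'] with x ⟨s, hs, j, hj⟩
    have h : ∃ i, t' i s ∉ Θ '' A := by
      refine Classical.byContradiction fun h => ?_
      obtain ⟨y, hy, hys⟩ := Classical.not_not.1 (not_exists.1 h 0)
      obtain ⟨y', hy', hys'⟩ := Classical.not_not.1 (not_exists.1 h 1)
      have hγs : γ (t' 0 s) = t' 1 s := by
        simpa [Θ'] using hγΘ (⟨s, hs⟩, 0)
      have hgy : g y = y' := hgΘ y y' (by rw [hys, hys', hγs])
      have hyy' := hAg y hy (by rwa [hgy])
      rw [hgy] at hyy'
      have := (htinj' s hs s hs 0 1 (by rw [← hys, ← hys', hyy'])).2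
      exact absurd this (by decide)
    obtain ⟨i, hi⟩ := h
    exact ⟨_, hF.trans hj (htF s hs j i), hi⟩
end

section
/- Let E and F be countable Borel equivalence relations on a Polish space X such that every E-class has cardinality ≥ 3 and every F-class has cardinality ≥ 2. Then E and F have Borel disjoint complete sections modulo a meager set: there exist disjoint Borel sets A, B ⊆ X such that the set of points x whose E-class misses A is meager and the set of points x whose F-class misses B is meager. -/
open Set MeasureTheory Topology Filter

/-- Build a sequence along which an invariant and a transition relation hold. -/
theorem exists_seq_of_forall_step {α : Type*} (P : ℕ → α → Prop) (Q : ℕ → α → α → Prop)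
    (a₀ : α) (h₀ : P 0 a₀) (h : ∀ n a, P n a → ∃ b, P (n + 1) b ∧ Q n a b) :
    ∃ f : ℕ → α, f 0 = a₀ ∧ (∀ n, P n (f n)) ∧ ∀ n, Q n (f n) (f (n + 1)) := by
  choose! g hg using h
  let f : ℕ → α := fun n => Nat.rec a₀ (fun n a => g n a) n
  have hP : ∀ n, P n (f n) := by
    intro n
    induction n with
    | zero => exact h₀
    | succ n ih => exact (hg n _ ih).1
  exact ⟨f, rfl, hP, fun n => (hg n _ (hP n)).2⟩

/-- A countable union of Borel graphs of partial functions. -/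
def IsCountableUnionOfGraphs {X Y : Type*} [MeasurableSpace X] [MeasurableSpace Y]
    (D : Set (X × Y)) : Prop :=
  ∃ G : ℕ → Set (X × Y), (∀ n, MeasurableSet (G n)) ∧
    (∀ n x y y', (x, y) ∈ G n → (x, y') ∈ G n → y = y') ∧ D = ⋃ n, G n

namespace IsCountableUnionOfGraphs

variable {X Y : Type*} [MeasurableSpace X] [MeasurableSpace Y]

theorem measurableSet {D : Set (X × Y)} (h : IsCountableUnionOfGraphs D) : MeasurableSet D := by
  obtain ⟨G, hG, -, rfl⟩ := h
  exact MeasurableSet.iUnion hG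

theorem of_graph {G : Set (X × Y)} (hG : MeasurableSet G)
    (h : ∀ x y y', (x, y) ∈ G → (x, y') ∈ G → y = y') : IsCountableUnionOfGraphs G :=
  ⟨fun _ => G, fun _ => hG, fun _ => h, (iUnion_const G).symm⟩

theorem empty : IsCountableUnionOfGraphs (∅ : Set (X × Y)) :=
  of_graph MeasurableSet.empty (by simp)

theorem iUnion {ι : Type*} [Countable ι] {D : ι → Set (X × Y)}
    (h : ∀ i, IsCountableUnionOfGraphs (D i)) : IsCountableUnionOfGraphs (⋃ i, D i) := by
  rcases isEmpty_or_nonempty ι with hι | hι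
  · simpa using empty
  choose G hG hG' hD using h
  obtain ⟨e, he⟩ := exists_surjective_nat (ι × ℕ)
  refine ⟨fun n => G (e n).1 (e n).2, fun n => hG _ _, fun n => hG' _ _, ?_⟩
  ext p
  simp only [mem_iUnion, hD]
  constructor
  · rintro ⟨i, n, hp⟩
    obtain ⟨k, hk⟩ := he (i, n)
    exact ⟨k, by rwa [hk]⟩
  · rintro ⟨k, hk⟩
    exact ⟨_, _, hk⟩

theorem union {D D' : Set (X × Y)} (h : IsCountableUnionOfGraphs D)
    (h' : IsCountableUnionOfGraphs D') : IsCountableUnionOfGraphs (D ∪ D') := by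
  rw [union_eq_iUnion]
  exact iUnion (by rintro (_ | _) <;> assumption)

end IsCountableUnionOfGraphs

section LusinNovikov

variable {X Y : Type*} [TopologicalSpace X] [PolishSpace X] [MeasurableSpace X] [BorelSpace X]
  [TopologicalSpace Y] [PolishSpace Y] [MeasurableSpace Y] [BorelSpace Y]

theorem MeasureTheory.AnalyticSet.inter_measurableSet {Z B : Set X} (hZ : AnalyticSet Z)
    (hB : MeasurableSet B) : AnalyticSet (Z ∩ B) := by
  rw [inter_eq_iInter]
  exact AnalyticSet.iInter (by rintro (_ | _) <;> [exact hB.analyticSet; exact hZ])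

/-- An analytic set with vertical sections of size at most one is contained in a Borel such set. -/
theorem exists_measurableSet_graph_superset {Z : Set (X × Y)} (hZ : AnalyticSet Z)
    (h : ∀ x y y', (x, y) ∈ Z → (x, y') ∈ Z → y = y') :
    ∃ G, Z ⊆ G ∧ MeasurableSet G ∧ ∀ x y y', (x, y) ∈ G → (x, y') ∈ G → y = y' := by
  let b := TopologicalSpace.countableBasis Y
  have hb := TopologicalSpace.isBasis_countableBasis Y
  have hbm : ∀ U ∈ b, MeasurableSet U := fun U hU => (hb.isOpen hU).measurableSet
  have hsep : ∀ U : b, ∃ W : Set X, MeasurableSet W ∧ ∀ x y, (x, y) ∈ Z → (x ∈ W ↔ y ∈ U.1) := by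
    intro U
    have h1 := (hZ.inter_measurableSet
      (measurable_snd (hbm _ U.2) : MeasurableSet (Prod.snd ⁻¹' U.1))).image_of_continuous
        (continuous_fst)
    have h2 := (hZ.inter_measurableSet
      (measurable_snd (hbm _ U.2).compl : MeasurableSet (Prod.snd ⁻¹' U.1ᶜ))).image_of_continuous
        (continuous_fst)
    obtain ⟨W, hW, hW', hWm⟩ := h1.measurablySeparable h2 (by
      rw [Set.disjoint_left]
      rintro _ ⟨⟨x, y⟩, ⟨hz, hy⟩, rfl⟩ ⟨⟨x', y'⟩, ⟨hz', hy'⟩, hx⟩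
      simp only at hx
      subst hx
      exact hy' (h _ _ _ hz hz' ▸ hy))
    refine ⟨W, hWm, fun x y hz => ⟨fun hx => ?_, fun hy => hW ⟨(x, y), ⟨hz, hy⟩, rfl⟩⟩⟩
    by_contra hy
    exact Set.disjoint_left.1 hW' ⟨(x, y), ⟨hz, hy⟩, rfl⟩ hx
  choose W hWm hW using hsep
  have : Countable b := TopologicalSpace.countable_countableBasis Y
  refine ⟨⋂ U : b, {p | p.1 ∈ W U ↔ p.2 ∈ U.1}, ?_, ?_, ?_⟩
  · rintro ⟨x, y⟩ hz
    simp only [mem_iInter]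
    exact fun U => hW U x y hz
  · exact MeasurableSet.iInter fun U =>
      (measurableSet_setOfPred.1 (measurable_fst (hWm U))).iff
        (measurableSet_setOfPred.1 (measurable_snd (hbm _ U.2))) |>.setOf
  · intro x y y' h1 h2
    by_contra hne
    obtain ⟨U, hU, hyU, hUy⟩ := hb.exists_subset_of_mem_open (show y ∈ ({y'}ᶜ : Set Y) from hne)
      isOpen_compl_singleton
    simp only [mem_iInter] at h1 h2
    have h1 := h1 ⟨U, hU⟩
    have h2 := h2 ⟨U, hU⟩
    simp only [mem_ofPred_eq] at h1 h2
    exact hUy (h2.1 (h1.2 hyU)) rfl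

/-- The sequences extending a given finite sequence. -/
def extensions (s : List ℕ) : Set (ℕ → ℕ) := {z | ∀ i (h : i < s.length), z i = s[i]}

theorem extensions_nil : extensions [] = univ := by
  ext; simp [extensions]

/-- The initial segment of a sequence. -/
def initialSegment (z : ℕ → ℕ) (n : ℕ) : List ℕ := (List.range n).map z

theorem mem_extensions_initialSegment {z w : ℕ → ℕ} {n : ℕ} :
    w ∈ extensions (initialSegment z n) ↔ ∀ i < n, w i = z i := by
  simp [extensions, initialSegment]

theorem extensions_initialSegment_subset {z : ℕ → ℕ} {n : ℕ} {s : List ℕ} (hz : z ∈ extensions s)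
    (hn : s.length ≤ n) : extensions (initialSegment z n) ⊆ extensions s := by
  intro w hw i hi
  rw [mem_extensions_initialSegment.1 hw i (hi.trans_le hn), hz i hi]

theorem isOpen_extensions (s : List ℕ) : IsOpen (extensions s) := by
  have : extensions s = ⋂ i : Fin s.length, (fun z : ℕ → ℕ => z i) ⁻¹' {s[i]} := by
    ext z
    simp only [extensions, mem_ofPred_eq, mem_iInter, mem_preimage, mem_singleton_iff]
    exact ⟨fun h i => h i i.2, fun h i hi => h ⟨i, hi⟩⟩
  rw [this]
  exact isOpen_iInter_of_finite fun i => (isOpen_discrete _).preimage (continuous_apply _)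

theorem exists_extensions_subset {O : Set (ℕ → ℕ)} (hO : IsOpen O) {z : ℕ → ℕ} (hz : z ∈ O) :
    ∃ n, ∀ m ≥ n, extensions (initialSegment z m) ⊆ O := by
  obtain ⟨_, ⟨x, n, rfl⟩, hx, hs⟩ :=
    (PiNat.isTopologicalBasis_cylinders (fun _ : ℕ => ℕ)).exists_subset_of_mem_open hz hO
  refine ⟨n, fun m hm w hw => hs ?_⟩
  rw [PiNat.mem_cylinder_iff] at hx ⊢
  intro i hi
  rw [mem_extensions_initialSegment.1 hw i (hi.trans_le hm), hx i hi]

/-- No countable union of Borel graphs meets every configuration of points, one in each member of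
the family, lying over a common point. -/
def JointlyBig (Q : ℕ → Set (X × Y)) : Prop :=
  ∀ D, IsCountableUnionOfGraphs D → ∃ x, ∀ k, ∃ y, (x, y) ∈ Q k \ D

theorem JointlyBig.exists_split {φ : (ℕ → ℕ) → X × Y} (hφ : Continuous φ) {c : ℕ → List ℕ}
    (hc : JointlyBig fun k => φ '' extensions (c k)) {j j' : ℕ} (N : ℕ) :
    ∃ s t : List ℕ, N ≤ s.length ∧ N ≤ t.length ∧ extensions s ⊆ extensions (c j) ∧
      extensions t ⊆ extensions (c j) ∧
      (∀ z ∈ extensions s, ∀ w ∈ extensions t, (φ z).2 ≠ (φ w).2) ∧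
      JointlyBig fun k => φ '' extensions (Function.update (Function.update c j s) j' t k) := by
  by_contra! hcon
  have hD : ∀ p : List ℕ × List ℕ, ∃ D : Set (X × Y), IsCountableUnionOfGraphs D ∧
      (N ≤ p.1.length → N ≤ p.2.length → extensions p.1 ⊆ extensions (c j) →
      extensions p.2 ⊆ extensions (c j) →
      (∀ z ∈ extensions p.1, ∀ w ∈ extensions p.2, (φ z).2 ≠ (φ w).2) →
      ∀ x, ∃ k, ∀ y, (x, y) ∈
        φ '' extensions (Function.update (Function.update c j p.1) j' p.2 k) → (x, y) ∈ D) := by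
    intro p
    by_cases hp : N ≤ p.1.length ∧ N ≤ p.2.length ∧ extensions p.1 ⊆ extensions (c j) ∧
      extensions p.2 ⊆ extensions (c j) ∧
      (∀ z ∈ extensions p.1, ∀ w ∈ extensions p.2, (φ z).2 ≠ (φ w).2)
    · obtain ⟨h1, h2, h3, h4, h5⟩ := hp
      have := hcon p.1 p.2 h1 h2 h3 h4 h5
      rw [JointlyBig] at this
      push Not at this
      obtain ⟨D, hD, hD'⟩ := this
      refine ⟨D, hD, fun _ _ _ _ _ x => ?_⟩
      obtain ⟨k, hk⟩ := hD' x
      refine ⟨k, fun y hy => ?_⟩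
      by_contra hyD
      exact hk y ⟨hy, hyD⟩
    · exact ⟨∅, .empty, fun h1 h2 h3 h4 h5 => absurd ⟨h1, h2, h3, h4, h5⟩ hp⟩
  choose D hDg hD using hD
  have hDU : IsCountableUnionOfGraphs (⋃ p, D p) := .iUnion hDg
  have hQ : ∀ k, AnalyticSet (φ '' extensions (c k) \ ⋃ p, D p) := fun k =>
    AnalyticSet.inter_measurableSet
      ((isOpen_extensions _).analyticSet_image hφ) hDU.measurableSet.compl
  let Z : Set (X × Y) := (φ '' extensions (c j) \ ⋃ p, D p) ∩
    ⋂ k, Prod.fst ⁻¹' (Prod.fst '' (φ '' extensions (c k) \ ⋃ p, D p))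
  have hZ : AnalyticSet Z := by
    have : Z = ⋂ o : Option ℕ, o.elim (φ '' extensions (c j) \ ⋃ p, D p)
        (fun k => Prod.fst ⁻¹' (Prod.fst '' (φ '' extensions (c k) \ ⋃ p, D p))) := by
      rw [iInter_option]; rfl
    rw [this]
    refine AnalyticSet.iInter ?_
    rintro (_ | k)
    · exact hQ j
    · exact ((hQ k).image_of_continuous continuous_fst).preimage continuous_fst
  obtain ⟨G, hZG, hGm, hG⟩ := exists_measurableSet_graph_superset hZ (by
    rintro x y y' ⟨⟨⟨z, hz, hzy⟩, hyD⟩, hx⟩ ⟨⟨⟨w, hw, hwy⟩, hyD'⟩, -⟩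
    by_contra hne
    obtain ⟨U, V, hU, hV, hyU, hyV, hUV⟩ := t2_separation hne
    obtain ⟨m, hm⟩ := exists_extensions_subset
      (hU.preimage (continuous_snd.comp hφ)) (z := z) (by simpa [hzy] using hyU)
    obtain ⟨m', hm'⟩ := exists_extensions_subset
      (hV.preimage (continuous_snd.comp hφ)) (z := w) (by simpa [hwy] using hyV)
    let M := max (max m m') (max N (c j).length)
    have hM : m ≤ M ∧ m' ≤ M ∧ N ≤ M ∧ (c j).length ≤ M := by
      simp [M]
    obtain ⟨k, hk⟩ := hD (initialSegment z M, initialSegment w M)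
      (by simpa [initialSegment] using hM.2.2.1) (by simpa [initialSegment] using hM.2.2.1)
      (extensions_initialSegment_subset hz hM.2.2.2)
      (extensions_initialSegment_subset hw hM.2.2.2)
      (fun a ha b hb hab => Set.disjoint_left.1 hUV (hm M hM.1 ha)
        (by simpa [hab] using hm' M hM.2.1 hb)) x
    by_cases hkj' : k = j'
    · subst hkj'
      refine hyD' (mem_iUnion.2 ⟨_, hk y' ⟨w, ?_, hwy⟩⟩)
      simp [mem_extensions_initialSegment]
    by_cases hkj : k = j
    · subst hkj
      refine hyD (mem_iUnion.2 ⟨_, hk y ⟨z, ?_, hzy⟩⟩)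
      simp [mem_extensions_initialSegment, hkj']
    obtain ⟨⟨x', y''⟩, ⟨hq, hqD⟩, hx'⟩ := mem_iInter.1 hx k
    simp only at hx'
    subst hx'
    refine hqD (mem_iUnion.2 ⟨_, hk y'' ?_⟩)
    simpa [hkj, hkj'] using hq)
  obtain ⟨x, hx⟩ := hc _ (hDU.union (.of_graph hGm hG))
  obtain ⟨y, hy, hyD⟩ := hx j
  refine hyD (Or.inr (hZG ⟨⟨hy, fun h => hyD (Or.inl h)⟩, mem_iInter.2 fun k => ?_⟩))
  obtain ⟨y', hy', hyD'⟩ := hx k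
  exact ⟨(x, y'), ⟨hy', fun h => hyD' (Or.inl h)⟩, rfl⟩

theorem JointlyBig.exists_uncountable_section {φ : (ℕ → ℕ) → X × Y} (hφ : Continuous φ)
    (h : JointlyBig fun _ => range φ) : ∃ x, ¬ {y | (x, y) ∈ range φ}.Countable := by
  obtain ⟨c, -, hP, hQ⟩ := exists_seq_of_forall_step
    (fun n (c : ℕ → List ℕ) => JointlyBig (fun k => φ '' extensions (c k)) ∧ ∀ k, n < k → c k = [])
    (fun n c c' => (∀ k, extensions (c' k) ⊆ extensions (c k)) ∧
      n + 1 ≤ (c' n.unpair.1).length ∧ extensions (c' (n + 1)) ⊆ extensions (c n.unpair.1) ∧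
      ∀ z ∈ extensions (c' n.unpair.1), ∀ w ∈ extensions (c' (n + 1)), (φ z).2 ≠ (φ w).2)
    (fun _ => []) (by simpa [extensions_nil] using h) (by
      rintro n c ⟨hc, hc'⟩
      obtain ⟨s, t, hs, -, hsc, htc, hst, hbig⟩ :=
        hc.exists_split hφ (j := n.unpair.1) (j' := n + 1) (n + 1)
      have hne : n.unpair.1 ≠ n + 1 := (Nat.lt_succ_of_le (Nat.unpair_left_le n)).ne
      refine ⟨_, ⟨hbig, fun k hk => ?_⟩, fun k => ?_, ?_, ?_, ?_⟩
      · have := Nat.unpair_left_le n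
        rw [Function.update_of_ne (by omega), Function.update_of_ne (by omega), hc' k (by omega)]
      · by_cases hk : k = n + 1
        · subst hk
          rw [hc' (n + 1) (by omega), extensions_nil]
          exact subset_univ _
        by_cases hk' : k = n.unpair.1
        · subst hk'
          simpa [hk] using hsc
        simp [hk, hk']
      · simpa [hne] using hs
      · simpa using htc
      · simpa [hne] using hst)
  have hanti : ∀ k, Antitone fun n => extensions (c n k) := fun k =>
    antitone_nat_of_succ_le fun n => (hQ n).1 k
  have hx : ∀ n, ∃ x, ∀ k, ∃ p ∈ extensions (c n k), (φ p).1 = x := by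
    intro n
    obtain ⟨x, hx⟩ := (hP n).1 ∅ .empty
    refine ⟨x, fun k => ?_⟩
    obtain ⟨y, ⟨p, hp, hpy⟩, -⟩ := hx k
    exact ⟨p, hp, by rw [hpy]⟩
  choose x p hp hpx using hx
  have hlen : ∀ k m, m + 1 ≤ (c (Nat.pair k m + 1) k).length := by
    intro k m
    have := (hQ (Nat.pair k m)).2.1
    rw [Nat.unpair_pair] at this
    exact (Nat.succ_le_succ (Nat.right_le_pair k m)).trans this
  have hstable : ∀ k m n, Nat.pair k m + 1 ≤ n → ∀ z ∈ extensions (c n k),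
      z m = p (Nat.pair k m + 1) k m := by
    intro k m n hn z hz
    have h1 := hanti k hn hz m (hlen k m)
    rw [h1, hp (Nat.pair k m + 1) k m (hlen k m)]
  let z : ℕ → ℕ → ℕ := fun k m => p (Nat.pair k m + 1) k m
  have hz : ∀ n k, z k ∈ extensions (c n k) := by
    intro n k i hi
    rcases le_total n (Nat.pair k i + 1) with hle | hle
    · exact hanti k hle (hp _ k) i hi
    · rw [← hp n k i hi, hstable k i n hle _ (hp n k)]
  have hlim : ∀ k, Tendsto (fun n => p n k) atTop (𝓝 (z k)) := by
    intro k
    refine tendsto_pi_nhds.2 fun m => ?_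
    refine tendsto_const_nhds.congr' ?_
    filter_upwards [eventually_ge_atTop (Nat.pair k m + 1)] with n hn
    exact (hstable k m n hn _ (hp n k)).symm
  have hlim' : ∀ k, Tendsto x atTop (𝓝 (φ (z k)).1) := by
    intro k
    have := ((continuous_fst.comp hφ).tendsto (z k)).comp (hlim k)
    exact this.congr fun n => hpx n k
  have hzx : ∀ k, (φ (z k)).1 = (φ (z 0)).1 := fun k => tendsto_nhds_unique (hlim' k) (hlim' 0)
  refine ⟨(φ (z 0)).1, fun hcount => ?_⟩
  let L : Set (ℕ → ℕ) := closure (range z)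
  have hL : ∀ w ∈ L, (φ w).1 = (φ (z 0)).1 := by
    have : IsClosed {w | (φ w).1 = (φ (z 0)).1} :=
      isClosed_eq (continuous_fst.comp hφ) continuous_const
    exact closure_minimal (by rintro _ ⟨k, rfl⟩; exact hzx k) this
  have hPL : PolishSpace L := isClosed_closure.polishSpace
  have hNL : Nonempty L := ⟨⟨z 0, subset_closure ⟨0, rfl⟩⟩⟩
  have := hcount.to_subtype
  obtain ⟨y, hy⟩ := nonempty_interior_of_iUnion_of_closed
    (f := fun y : {y | ((φ (z 0)).1, y) ∈ range φ} => {w : L | (φ w).2 = y.1})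
    (fun y => isClosed_eq (continuous_snd.comp (hφ.comp continuous_subtype_val)) continuous_const)
    (by
      refine eq_univ_of_forall fun w => mem_iUnion.2 ⟨⟨(φ w).2, w, ?_⟩, rfl⟩
      exact Prod.ext (hL w w.2) rfl)
  obtain ⟨⟨w, hwL⟩, hw⟩ := hy
  obtain ⟨O', hO', hO'o, hwO'⟩ := mem_interior.1 hw
  obtain ⟨O, hO, rfl⟩ := isOpen_induced_iff.1 hO'o
  obtain ⟨_, hkO, ⟨k, rfl⟩⟩ := mem_closure_iff.1 hwL O hO hwO'
  obtain ⟨M, hM⟩ := exists_extensions_subset hO hkO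
  have hlt : Nat.pair k M + 1 ≤ Nat.pair k (M + 1) :=
    Nat.succ_le_of_lt (Nat.pair_lt_pair_right k (Nat.lt_succ_self M))
  set n := Nat.pair k (M + 1) with hn
  obtain ⟨-, -, hsub, hdisj⟩ := hQ n
  have hn1 : n.unpair.1 = k := by simp [hn]
  rw [hn1] at hsub hdisj
  have hzO : z (n + 1) ∈ O := by
    refine hM M le_rfl (mem_extensions_initialSegment.2 fun i hi => ?_)
    have hi' : i < (c (Nat.pair k M + 1) k).length := by have := hlen k M; omega
    rw [hanti k hlt (hsub (hz (n + 1) (n + 1))) i hi', hz (Nat.pair k M + 1) k i hi']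
  have e1 : (φ (z k)).2 = y.1 := hO' (show (⟨z k, subset_closure ⟨k, rfl⟩⟩ : L) ∈ _ from hkO)
  have e2 : (φ (z (n + 1))).2 = y.1 :=
    hO' (show (⟨z (n + 1), subset_closure ⟨n + 1, rfl⟩⟩ : L) ∈ _ from hzO)
  exact hdisj _ (hz _ _) _ (hz _ _) (e1.trans e2.symm)

/-- The **Lusin–Novikov theorem**: an analytic set with countable vertical sections is contained in
a countable union of Borel graphs of partial functions. -/
theorem MeasureTheory.AnalyticSet.exists_isCountableUnionOfGraphs {R : Set (X × Y)} (hR : AnalyticSet R)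
    (h : ∀ x, {y | (x, y) ∈ R}.Countable) : ∃ D, IsCountableUnionOfGraphs D ∧ R ⊆ D := by
  rw [AnalyticSet] at hR
  obtain rfl | ⟨φ, hφ, rfl⟩ := hR
  · exact ⟨∅, .empty, subset_rfl⟩
  by_contra! hcon
  obtain ⟨x, hx⟩ := JointlyBig.exists_uncountable_section hφ (fun D hD => by
    obtain ⟨⟨x, y⟩, hxy, hxyD⟩ := not_subset.1 (hcon D hD)
    exact ⟨x, fun _ => ⟨y, hxy, hxyD⟩⟩)
  exact hx (h x)

/-- The projection of a Borel set with countable sections is Borel. -/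
theorem MeasurableSet.exists_of_countable_sections {R : X → Y → Prop}
    (hR : MeasurableSet {p : X × Y | R p.1 p.2}) (h : ∀ x, {y | R x y}.Countable) :
    MeasurableSet {x | ∃ y, R x y} := by
  obtain ⟨_, ⟨G, hGm, hG, rfl⟩, hRD⟩ := hR.analyticSet.exists_isCountableUnionOfGraphs h
  have : {x | ∃ y, R x y} = ⋃ n, Prod.fst '' ({p : X × Y | R p.1 p.2} ∩ G n) := by
    ext x
    simp only [mem_iUnion]
    constructor
    · rintro ⟨y, hy⟩
      obtain ⟨n, hn⟩ := mem_iUnion.1 (hRD (show (x, y) ∈ {p : X × Y | R p.1 p.2} from hy))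
      exact ⟨n, (x, y), ⟨hy, hn⟩, rfl⟩
    · rintro ⟨n, ⟨x, y⟩, ⟨hy, -⟩, rfl⟩
      exact ⟨y, hy⟩
  rw [this]
  refine MeasurableSet.iUnion fun n =>
    (hR.inter (hGm n)).image_of_measurable_injOn measurable_fst ?_
  rintro ⟨x, y⟩ ⟨-, hp⟩ ⟨x', y'⟩ ⟨-, hp'⟩ hx
  simp only at hx
  subst hx
  rw [hG n _ _ _ hp hp']

/-- A Borel map that is countable-to-one on a Borel set is injective on each piece of a countable
Borel cover of that set. -/
theorem Measurable.exists_injOn_of_countable_fibers {f : X → Y} (hf : Measurable f) {W : Set X}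
    (hW : MeasurableSet W) (h : ∀ y, {x | x ∈ W ∧ f x = y}.Countable) :
    ∃ C : ℕ → Set X, (∀ n, MeasurableSet (C n)) ∧ (∀ n, InjOn f (C n)) ∧ W ⊆ ⋃ n, C n := by
  have hR : MeasurableSet {p : Y × X | p.2 ∈ W ∧ f p.2 = p.1} :=
    (measurable_snd hW).inter (measurableSet_eq_fun (hf.comp measurable_snd) measurable_fst)
  obtain ⟨_, ⟨G, hGm, hG, rfl⟩, hRD⟩ := hR.analyticSet.exists_isCountableUnionOfGraphs h
  refine ⟨fun n => (fun x => (f x, x)) ⁻¹' G n, fun n => (hf.prodMk measurable_id) (hGm n),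
    fun n x hx x' hx' hxx' => hG n _ _ _ hx (by simpa [hxx'] using hx'), fun x hx => ?_⟩
  simpa using hRD (show (f x, x) ∈ {p : Y × X | p.2 ∈ W ∧ f p.2 = p.1} from ⟨hx, rfl⟩)

end LusinNovikov

section CyclicPermutation

variable {X : Type*} [TopologicalSpace X] [PolishSpace X] [MeasurableSpace X] [BorelSpace X]

theorem MeasurableSet.setOf_rel {Y Z : Type*} [MeasurableSpace Y] [MeasurableSpace Z]
    {R : Y → Y → Prop} (hR : MeasurableSet {q : Y × Y | R q.1 q.2}) {f g : Z → Y}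
    (hf : Measurable f) (hg : Measurable g) : MeasurableSet {z | R (f z) (g z)} :=
  hR.preimage (hf.prodMk hg)

/-- The injective `p`-tuples of pairwise `E`-related points. -/
def relatedTuples (E : X → X → Prop) (p : ℕ) : Set (Fin p → X) :=
  {w | Function.Injective w ∧ ∀ a b, E (w a) (w b)}

theorem measurableSet_relatedTuples {E : X → X → Prop}
    (hE : MeasurableSet {q : X × X | E q.1 q.2}) (p : ℕ) :
    MeasurableSet (relatedTuples E p) := by
  have h1 : MeasurableSet (⋂ a : Fin p, ⋂ b : Fin p, {w : Fin p → X | w a = w b → a = b}) := by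
    refine MeasurableSet.iInter fun a => MeasurableSet.iInter fun b => ?_
    by_cases hab : a = b
    · simp [hab]
    · simp only [hab, imp_false]
      exact (measurableSet_eq_fun (measurable_pi_apply a) (measurable_pi_apply b)).compl
  have h2 : MeasurableSet (⋂ a : Fin p, ⋂ b : Fin p, {w : Fin p → X | E (w a) (w b)}) :=
    MeasurableSet.iInter fun a => MeasurableSet.iInter fun b =>
      hE.setOf_rel (measurable_pi_apply a) (measurable_pi_apply b)
  convert h1.inter h2 using 1
  ext w
  simp [relatedTuples, Function.Injective]

/-- Any countable Borel equivalence relation has countably many Borel families of disjoint related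
tuples covering all related tuples. -/
theorem exists_disjoint_tuples_cover {E : X → X → Prop}
    (hEm : MeasurableSet {q : X × X | E q.1 q.2}) (hEc : ∀ x, {y | E x y}.Countable) (p : ℕ) :
    ∃ C : ℕ → Set (Fin p → X), (∀ n, MeasurableSet (C n)) ∧
      (∀ n, ∀ w ∈ C n, ∀ w' ∈ C n, ∀ a b, w a = w' b → w = w' ∧ a = b) ∧
      relatedTuples E p = ⋃ n, C n := by
  have hW := measurableSet_relatedTuples hEm p
  have hinj : ∀ a : Fin p, ∃ C : ℕ → Set (Fin p → X), (∀ n, MeasurableSet (C n)) ∧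
      (∀ n, InjOn (fun w => w a) (C n)) ∧ relatedTuples E p ⊆ ⋃ n, C n := by
    intro a
    refine (measurable_pi_apply a).exists_injOn_of_countable_fibers hW fun y => ?_
    refine (Set.countable_univ_pi (fun _ : Fin p => hEc y)).mono ?_
    rintro w ⟨hw, rfl⟩ b -
    exact hw.2 a b
  choose P hPm hPinj hP using hinj
  let B := TopologicalSpace.countableBasis X
  have hB := TopologicalSpace.isBasis_countableBasis X
  have : Countable B := TopologicalSpace.countable_countableBasis X
  let ι := {q : (Fin p → ℕ) × (Fin p → B) // Pairwise fun a b => Disjoint (q.2 a).1 (q.2 b).1}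
  let C : ι → Set (Fin p → X) := fun q =>
    relatedTuples E p ∩ ⋂ a, (P a (q.1.1 a) ∩ {w | w a ∈ (q.1.2 a).1})
  have hCm : ∀ q, MeasurableSet (C q) := fun q => hW.inter <| MeasurableSet.iInter fun a =>
    (hPm a _).inter (measurable_pi_apply a (hB.isOpen (q.1.2 a).2).measurableSet)
  have hCd : ∀ q, ∀ w ∈ C q, ∀ w' ∈ C q, ∀ a b, w a = w' b → w = w' ∧ a = b := by
    rintro q w ⟨-, hw⟩ w' ⟨-, hw'⟩ a b hab
    rw [mem_iInter] at hw hw'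
    obtain rfl : a = b := by
      by_contra hne
      exact Set.disjoint_left.1 (q.2 hne) (hw a).2 (hab ▸ (hw' b).2)
    exact ⟨hPinj a _ (hw a).1 (hw' a).1 hab, rfl⟩
  have hCW : relatedTuples E p = ⋃ q, C q := by
    refine subset_antisymm (fun w hw => ?_) (iUnion_subset fun q => inter_subset_left)
    obtain ⟨V, hV, hVd⟩ := (Set.finite_range w).t2_separation
    have : ∀ a, ∃ U : B, w a ∈ U.1 ∧ U.1 ⊆ V (w a) := by
      intro a
      obtain ⟨U, hU, h1, h2⟩ := hB.exists_subset_of_mem_open (hV (w a)).1 (hV (w a)).2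
      exact ⟨⟨U, hU⟩, h1, h2⟩
    choose U hU hUV using this
    have hPw : ∀ a, ∃ n, w ∈ P a n := fun a => by simpa using hP a hw
    choose n hn using hPw
    refine mem_iUnion.2 ⟨⟨(n, U), fun a b hab => ?_⟩, hw, mem_iInter.2 fun a => ⟨hn a, hU a⟩⟩
    exact (hVd (mem_range_self a) (mem_range_self b) (hw.1.ne hab)).mono (hUV a) (hUV b)
  rcases isEmpty_or_nonempty ι with hι | hι
  · refine ⟨fun _ => ∅, fun _ => .empty, by simp, ?_⟩
    rw [hCW]
    simp
  obtain ⟨e, he⟩ := exists_surjective_nat ι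
  refine ⟨fun n => C (e n), fun n => hCm _, fun n => hCd _, ?_⟩
  rw [hCW, he.iUnion_comp]

/-- Any countable Borel equivalence relation has a Borel family of disjoint related tuples meeting
every class that contains a related tuple. -/
theorem exists_disjoint_tuples_s17 {E : X → X → Prop} (hE : Equivalence E)
    (hEm : MeasurableSet {q : X × X | E q.1 q.2}) (hEc : ∀ x, {y | E x y}.Countable) (p : ℕ)
    [NeZero p] :
    ∃ T ⊆ relatedTuples E p, MeasurableSet T ∧
      (∀ w ∈ T, ∀ w' ∈ T, ∀ a b, w a = w' b → w = w' ∧ a = b) ∧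
      ∀ w ∈ relatedTuples E p, ∃ w' ∈ T, E (w 0) (w' 0) := by
  obtain ⟨C, hCm, hCd, hCW⟩ := exists_disjoint_tuples_cover hEm hEc p
  have hCW' : ∀ n, C n ⊆ relatedTuples E p := fun n => hCW ▸ subset_iUnion C n
  let N : ℕ → Set (Fin p → X) := fun n => {w | ∃ w', w' ∈ C n ∧ E (w 0) (w' 0)}
  have hNm : ∀ n, MeasurableSet (N n) := by
    intro n
    refine MeasurableSet.exists_of_countable_sections
      (R := fun w w' : Fin p → X => w' ∈ C n ∧ E (w 0) (w' 0)) ?_ fun w => ?_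
    · exact (measurable_snd (hCm n)).inter
        (hEm.setOf_rel ((measurable_pi_apply 0).comp measurable_fst)
          ((measurable_pi_apply 0).comp measurable_snd))
    · refine (Set.countable_univ_pi (fun _ : Fin p => hEc (w 0))).mono ?_
      rintro w' ⟨hw', h0⟩ b -
      exact hE.trans h0 ((hCW' n hw').2 0 b)
  refine ⟨⋃ n, C n \ ⋃ m ∈ Iio n, N m, iUnion_subset fun n => sdiff_subset.trans (hCW' n),
    MeasurableSet.iUnion fun n => (hCm n).diff
      (MeasurableSet.biUnion (to_countable _) fun m _ => hNm m), ?_, ?_⟩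
  · intro w hw w' hw' a b hab
    simp only [mem_iUnion, Set.mem_sdiff, mem_Iio, not_exists] at hw hw'
    obtain ⟨n, hw, hwn⟩ := hw
    obtain ⟨n', hw', hwn'⟩ := hw'
    have hr : E (w 0) (w' 0) :=
      hE.trans ((hCW' n hw).2 0 a) (hab ▸ (hCW' n' hw').2 b 0)
    rcases lt_trichotomy n n' with h | rfl | h
    · exact absurd ⟨w, hw, hE.symm hr⟩ (hwn' n h)
    · exact hCd n w hw w' hw' a b hab
    · exact absurd ⟨w', hw', hr⟩ (hwn n' h)
  · intro w hw
    have hex : ∃ n, w ∈ N n := by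
      obtain ⟨n, hn⟩ := mem_iUnion.1 (hCW ▸ hw)
      exact ⟨n, w, hn, hE.refl _⟩
    classical
    obtain ⟨w', hw', hr⟩ := Nat.find_spec hex
    refine ⟨w', mem_iUnion.2 ⟨Nat.find hex, hw', ?_⟩, hr⟩
    simp only [mem_iUnion, mem_Iio, not_exists]
    rintro m hm ⟨w'', hw'', hr'⟩
    exact Nat.find_min hex hm ⟨w'', hw'', hE.trans hr hr'⟩

/-- A countable Borel equivalence relation all of whose classes have at least `p` elements contains
the orbits of a Borel map of order `p` that moves a point of every class. -/
theorem exists_measurable_cyclic {E : X → X → Prop} (hE : Equivalence E)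
    (hEm : MeasurableSet {q : X × X | E q.1 q.2}) (hEc : ∀ x, {y | E x y}.Countable) (p : ℕ)
    (hp : 2 ≤ p) (hcard : ∀ x, (p : ℕ∞) ≤ {y | E x y}.encard) :
    ∃ σ : X → X, Measurable σ ∧ (∀ x, σ^[p] x = x) ∧ (∀ x, E x (σ x)) ∧
      ∀ x, ∃ y, E x y ∧ σ y ≠ y := by
  have : NeZero p := ⟨by omega⟩
  obtain ⟨T, hTW, hTm, hTd, hT⟩ := exists_disjoint_tuples_s17 hE hEm hEc p
  classical
  let S : Set X := ⋃ a, (fun w : Fin p → X => w a) '' T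
  have himg : ∀ a, ∀ T' ⊆ T, MeasurableSet T' →
      MeasurableSet ((fun w : Fin p → X => w a) '' T') := fun a T' hT' hT'm =>
    hT'm.image_of_measurable_injOn (measurable_pi_apply a)
      fun w hw w' hw' h => (hTd w (hT' hw) w' (hT' hw') a a h).1
  have hS : ∀ x, x ∈ S → ∃ q : (Fin p → X) × Fin p, q.1 ∈ T ∧ q.1 q.2 = x := by
    intro x hx
    obtain ⟨a, w, hw, rfl⟩ := mem_iUnion.1 hx
    exact ⟨(w, a), hw, rfl⟩
  choose! q hqT hq using hS
  let σ : X → X := fun x => if x ∈ S then (q x).1 ((q x).2 + 1) else x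
  have hσ : ∀ w ∈ T, ∀ a, σ (w a) = w (a + 1) := by
    intro w hw a
    have hS : w a ∈ S := mem_iUnion.2 ⟨a, w, hw, rfl⟩
    obtain ⟨h1, h2⟩ := hTd _ (hqT _ hS) w hw _ _ (hq _ hS)
    simp only [σ, hS, if_true, h1, h2]
  have hσ' : ∀ x, x ∉ S → σ x = x := fun x hx => by simp [σ, hx]
  refine ⟨σ, fun B hB => ?_, fun x => ?_, fun x => ?_, fun x => ?_⟩
  · have : σ ⁻¹' B = (⋃ a, (fun w : Fin p → X => w a) '' (T ∩ (fun w => w (a + 1)) ⁻¹' B)) ∪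
        (B \ S) := by
      ext x
      by_cases hx : x ∈ S
      · obtain ⟨a, w, hw, rfl⟩ := mem_iUnion.1 hx
        simp only [mem_preimage, hσ w hw a, mem_union, mem_iUnion, Set.mem_sdiff, hx, not_true,
          and_false, or_false]
        constructor
        · exact fun h => ⟨a, w, ⟨hw, h⟩, rfl⟩
        · rintro ⟨b, w', ⟨hw', h⟩, hab⟩
          obtain ⟨rfl, rfl⟩ := hTd _ hw' _ hw _ _ hab
          exact h
      · simp only [mem_preimage, hσ' x hx, mem_union, Set.mem_sdiff, hx, not_false_iff, and_true]
        refine ⟨Or.inr, ?_⟩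
        rintro (h | h)
        · obtain ⟨a, w, ⟨hw, -⟩, rfl⟩ := mem_iUnion.1 h
          exact absurd (mem_iUnion.2 ⟨a, w, hw, rfl⟩ : _ ∈ S) hx
        · exact h
    rw [this]
    refine (MeasurableSet.iUnion fun a => himg a _ inter_subset_left ?_).union
      (hB.diff (MeasurableSet.iUnion fun a => himg a T subset_rfl hTm))
    exact hTm.inter (measurable_pi_apply _ hB)
  · by_cases hx : x ∈ S
    · obtain ⟨a, w, hw, rfl⟩ := mem_iUnion.1 hx
      have : ∀ k : ℕ, σ^[k] (w a) = w (Fin.ofNat p (a + k)) := by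
        intro k
        induction k with
        | zero => simp
        | succ k ih =>
          rw [Function.iterate_succ_apply', ih, hσ w hw]
          congr 1
          ext
          simp [Fin.val_add, add_assoc]
      simp only [this]
      congr 1
      ext
      simp [Nat.mod_eq_of_lt a.2]
    · exact Function.iterate_fixed (hσ' x hx) p
  · by_cases hx : x ∈ S
    · obtain ⟨a, w, hw, rfl⟩ := mem_iUnion.1 hx
      simp only [hσ w hw]
      exact (hTW hw).2 _ _
    · rw [hσ' x hx]
      exact hE.refl x
  · obtain ⟨t, htx, htc⟩ := Set.exists_subset_encard_eq (hcard x)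
    have htf : t.Finite := Set.finite_of_encard_eq_coe htc
    have hcard : Nat.card t = p := by
      rw [Nat.card_coe_set_eq, Set.ncard, htc]; rfl
    have := htf.to_subtype
    let e := (Finite.equivFinOfCardEq hcard).symm
    obtain ⟨w', hw', hr⟩ := hT (fun a => (e a : X))
      ⟨Subtype.val_injective.comp e.injective, fun a b =>
        hE.trans (hE.symm (htx (e a).2)) (htx (e b).2)⟩
    refine ⟨w' 0, hE.trans (htx (e 0).2) hr, ?_⟩
    rw [hσ w' hw']
    intro h
    have := (hTW hw').1 h
    have h1 : ((0 + 1 : Fin p) : ℕ) = 0 := by rw [this]; rfl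
    rw [zero_add, Fin.val_one', Nat.mod_eq_of_lt (by omega)] at h1
    exact one_ne_zero h1

end CyclicPermutation

section Matching

variable {X : Type*} {σ τ : X → X} {A C : Set X} {g n j : ℕ} {s t x y z : X}

/-- The relation of lying in the same orbit of a map `σ` of order three. -/
def SameOrbit (σ : X → X) (x y : X) : Prop := y = x ∨ y = σ x ∨ y = σ (σ x)

theorem SameOrbit.refl (x : X) : SameOrbit σ x x := .inl rfl

theorem SameOrbit.symm (hσ : ∀ x, σ (σ (σ x)) = x) (h : SameOrbit σ x y) : SameOrbit σ y x := by
  rcases h with rfl | rfl | rfl <;> simp [SameOrbit, hσ]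

theorem SameOrbit.trans (hσ : ∀ x, σ (σ (σ x)) = x) (h : SameOrbit σ x y)
    (h' : SameOrbit σ y z) : SameOrbit σ x z := by
  rcases h with rfl | rfl | rfl <;> rcases h' with rfl | rfl | rfl <;> simp [SameOrbit, hσ]

theorem SameOrbit.apply_ne (hσ : ∀ x, σ (σ (σ x)) = x) (h : SameOrbit σ x y) (hx : σ x ≠ x) :
    σ y ≠ y := by
  rcases h with rfl | rfl | rfl
  · exact hx
  · exact fun h => hx (by simpa [hσ] using congrArg (fun y => σ (σ y)) h)
  · exact fun h => hx (by simpa [hσ] using congrArg σ h)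

/-- The graph metric of the graph generated by the orbits of `σ` and by `τ` is at most `n`. -/
def Near (σ τ : X → X) : ℕ → X → X → Prop
  | 0, x, y => y = x
  | n + 1, x, y => ∃ z, Near σ τ n x z ∧ (SameOrbit σ z y ∨ y = τ z)

theorem Near.step (h : Near σ τ n x y) : Near σ τ (n + 1) x (τ y) := ⟨y, h, .inr rfl⟩

theorem Near.orbit (h : Near σ τ n x y) (h' : SameOrbit σ y z) : Near σ τ (n + 1) x z :=
  ⟨y, h, .inl h'⟩

theorem Near.mono {m : ℕ} (h : Near σ τ n x y) (hnm : n ≤ m) : Near σ τ m x y := by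
  induction hnm with
  | refl => exact h
  | step _ ih => exact ih.orbit (.refl _)

theorem Near.trans {m : ℕ} (h : Near σ τ n x y) (h' : Near σ τ m y z) : Near σ τ (n + m) x z := by
  induction m generalizing z with
  | zero => obtain rfl : z = y := h'; exact h
  | succ m ih => obtain ⟨w, hw, h'⟩ := h'; exact ⟨w, ih hw, h'⟩

theorem Near.symm (hσ : ∀ x, σ (σ (σ x)) = x) (hτ : ∀ x, τ (τ x) = x) (h : Near σ τ n x y) :
    Near σ τ n y x := by
  induction n generalizing y with
  | zero => exact Eq.symm h
  | succ n ih =>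
    obtain ⟨z, hz, h⟩ := h
    have h1 : Near σ τ 1 y z := by
      refine ⟨y, rfl, ?_⟩
      rcases h with h | rfl
      · exact .inl (h.symm hσ)
      · exact .inr (hτ z).symm
    exact (h1.trans (ih hz)).mono (by omega)

/-- The `σ`-orbit of `x` does not meet `A`. -/
def Unsatisfied (σ : X → X) (A : Set X) (x : X) : Prop := x ∉ A ∧ σ x ∉ A ∧ σ (σ x) ∉ A

theorem unsatisfied_iff : Unsatisfied σ A x ↔ ∀ y, SameOrbit σ x y → y ∉ A := by
  simp [Unsatisfied, SameOrbit]

theorem Unsatisfied.congr (hσ : ∀ x, σ (σ (σ x)) = x) (h : SameOrbit σ x y)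
    (hx : Unsatisfied σ A x) : Unsatisfied σ A y :=
  unsatisfied_iff.2 fun z hz => unsatisfied_iff.1 hx z (h.trans hσ hz)

/-- The `σ`-orbit of `x` is nontrivial and does not meet `A`, but `τ` maps a point of it into
`A`. -/
def Critical (σ τ : X → X) (A : Set X) (x : X) : Prop :=
  σ x ≠ x ∧ Unsatisfied σ A x ∧ (τ x ∈ A ∨ τ (σ x) ∈ A ∨ τ (σ (σ x)) ∈ A)

theorem critical_iff : Critical σ τ A x ↔
    σ x ≠ x ∧ Unsatisfied σ A x ∧ ∃ y, SameOrbit σ x y ∧ τ y ∈ A := by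
  simp [Critical, SameOrbit]

theorem Critical.congr (hσ : ∀ x, σ (σ (σ x)) = x) (h : SameOrbit σ x y)
    (hx : Critical σ τ A x) : Critical σ τ A y := by
  rw [critical_iff] at hx ⊢
  obtain ⟨h1, h2, z, hz, hzA⟩ := hx
  exact ⟨h.apply_ne hσ h1, h2.congr hσ h, z, (h.symm hσ).trans hσ hz, hzA⟩

/-- A sequence of `g` points in distinct critical orbits, consecutive ones being linked by `τ`. -/
structure CriticalPath (σ τ : X → X) (A : Set X) (g : ℕ) (e : ℕ → X) : Prop where
  critical : ∀ i < g, Critical σ τ A (e i)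
  linked : ∀ i, i + 1 < g → ∃ a, SameOrbit σ (e i) a ∧ SameOrbit σ (τ a) (e (i + 1))
  distinct : ∀ i j, i < j → j < g → ¬SameOrbit σ (e i) (e j)

theorem CriticalPath.near {e : ℕ → X} (he : CriticalPath σ τ A g e) {i : ℕ} :
    ∀ k, i + k < g → Near σ τ (3 * k) (e i) (e (i + k))
  | 0, _ => rfl
  | k + 1, hk => by
    obtain ⟨a, ha, ha'⟩ := he.linked (i + k) hk
    exact (((he.near k (by omega)).orbit ha).step).orbit ha'

/-- A set of points, thought of as a partial choice of one endpoint from each `τ`-orbit, which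
leaves enough freedom to be extended to any sparse set of nontrivial `σ`-orbits. -/
structure Extendable (σ τ : X → X) (A : Set X) (g : ℕ) : Prop where
  fixed : ∀ x, τ x = x → x ∈ A
  indep : ∀ x, x ∈ A → τ x ∈ A → τ x = x
  unique : ∀ x, σ x ≠ x → Unsatisfied σ A x → ∀ y z, SameOrbit σ x y → SameOrbit σ x z →
    τ y ∈ A → τ z ∈ A → y = z
  noPath : ∀ e, ¬CriticalPath σ τ A g e

theorem extendable_fixedPoints (hτ : ∀ x, τ (τ x) = x) : Extendable σ τ {x | τ x = x} 1 := by
  have key : ∀ x y, Unsatisfied σ {x | τ x = x} x → SameOrbit σ x y → ¬τ (τ y) = τ y := by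
    intro x y hx hy h
    rw [hτ] at h
    exact unsatisfied_iff.1 hx y hy h.symm
  refine ⟨fun _ h => h, fun _ h _ => h, fun x _ hx y z hy _ h _ => absurd h (key x y hx hy), ?_⟩
  intro e he
  obtain ⟨-, hx, y, hy, h⟩ := critical_iff.1 (he.critical 0 one_pos)
  exact key _ y hx hy h

open Classical in
/-- The walk that starts in the orbit of a given point and alternately applies `τ` and moves to the
next available point of the `σ`-orbit. -/
noncomputable def walk (σ τ : X → X) (A : Set X) : ℕ → X → X
  | 0, s => if τ s ∈ A then σ s else s
  | n + 1, s =>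
    let z := τ (walk σ τ A n s)
    if τ (σ z) ∈ A then σ (σ z) else σ z

/-- After `n` steps the walk leaves the critical orbits or comes back to an earlier orbit. -/
def WalkEnds (σ τ : X → X) (A : Set X) (n : ℕ) (s : X) : Prop :=
  ¬Critical σ τ A (τ (walk σ τ A n s)) ∨
    ∃ m ∈ Finset.range (n + 1), SameOrbit σ (τ (walk σ τ A n s)) (walk σ τ A m s)

/-- The starting points in `C` for which the walk has not ended before step `n`. -/
def walkDomain (σ τ : X → X) (A C : Set X) (n : ℕ) : Set X :=
  {s | s ∈ C ∧ σ s ≠ s ∧ Unsatisfied σ A s ∧ ∀ i ∈ Finset.range n, ¬WalkEnds σ τ A i s}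

/-- The set obtained by adding to `A` all points visited by the walks started in `C`. -/
def walkExtension (σ τ : X → X) (A C : Set X) : Set X :=
  A ∪ ⋃ n, walk σ τ A n '' walkDomain σ τ A C n

theorem walkDomain_mono {m : ℕ} (h : m ≤ n) : walkDomain σ τ A C n ⊆ walkDomain σ τ A C m :=
  fun _ hs => ⟨hs.1, hs.2.1, hs.2.2.1, fun i hi => hs.2.2.2 i (by simp at hi ⊢; omega)⟩

theorem not_walkEnds (hs : s ∈ walkDomain σ τ A C (n + 1)) : ¬WalkEnds σ τ A n s :=
  hs.2.2.2 n (by simp)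

theorem walkEnds_of_notMem (hs : s ∈ walkDomain σ τ A C n) (hs' : s ∉ walkDomain σ τ A C (n + 1)) :
    WalkEnds σ τ A n s := by
  by_contra h
  refine hs' ⟨hs.1, hs.2.1, hs.2.2.1, fun i hi => ?_⟩
  rw [Finset.mem_range, Nat.lt_succ_iff, le_iff_lt_or_eq] at hi
  rcases hi with hi | rfl
  · exact hs.2.2.2 i (by simpa)
  · exact h

theorem sameOrbit_walk_zero : SameOrbit σ s (walk σ τ A 0 s) := by
  unfold walk
  split_ifs <;> simp [SameOrbit]

theorem sameOrbit_walk_succ : SameOrbit σ (τ (walk σ τ A n s)) (walk σ τ A (n + 1) s) := by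
  rw [walk]
  split_ifs <;> simp [SameOrbit]

theorem near_walk : ∀ n, Near σ τ (2 * n + 1) s (walk σ τ A n s)
  | 0 => Near.orbit (y := s) rfl sameOrbit_walk_zero
  | n + 1 => (near_walk n).step.orbit sameOrbit_walk_succ

theorem Extendable.walk_residual (hσ : ∀ x, σ (σ (σ x)) = x) (hA : Extendable σ τ A g)
    (hs : s ∈ walkDomain σ τ A C n) :
    σ (walk σ τ A n s) ≠ walk σ τ A n s ∧ walk σ τ A n s ∉ A ∧ τ (walk σ τ A n s) ∉ A := by
  cases n with
  | zero =>
    refine ⟨sameOrbit_walk_zero.apply_ne hσ hs.2.1,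
      unsatisfied_iff.1 hs.2.2.1 _ sameOrbit_walk_zero, ?_⟩
    unfold walk
    split_ifs with h
    · intro h'
      exact hs.2.1 (hA.unique s hs.2.1 hs.2.2.1 _ _ (.inl rfl) (.inr (.inl rfl)) h h').symm
    · exact h
  | succ n =>
    have hz : Critical σ τ A (τ (walk σ τ A n s)) := by
      by_contra h
      exact not_walkEnds hs (.inl h)
    refine ⟨sameOrbit_walk_succ.apply_ne hσ hz.1, unsatisfied_iff.1 hz.2.1 _ sameOrbit_walk_succ, ?_⟩
    rw [walk]
    split_ifs with h
    · intro h'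
      have := hA.unique _ hz.1 hz.2.1 _ _ (.inr (.inl rfl)) (.inr (.inr rfl)) h h'
      exact SameOrbit.apply_ne hσ (.inr (.inl rfl)) hz.1 this.symm
    · exact h

theorem walk_succ_ne (hσ : ∀ x, σ (σ (σ x)) = x) (hs : s ∈ walkDomain σ τ A C (n + 1)) :
    walk σ τ A (n + 1) s ≠ τ (walk σ τ A n s) := by
  have hz : Critical σ τ A (τ (walk σ τ A n s)) := by
    by_contra h
    exact not_walkEnds hs (.inl h)
  rw [walk]
  split_ifs
  · intro h
    exact SameOrbit.apply_ne hσ (.inr (.inr rfl)) hz.1 (by rw [hσ]; exact h.symm)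
  · exact hz.1

theorem not_sameOrbit_walk (hσ : ∀ x, σ (σ (σ x)) = x) {i : ℕ} (hij : i < j)
    (hs : s ∈ walkDomain σ τ A C j) : ¬SameOrbit σ (walk σ τ A i s) (walk σ τ A j s) := by
  intro h
  obtain ⟨j, rfl⟩ := Nat.exists_eq_succ_of_ne_zero (by omega : j ≠ 0)
  exact not_walkEnds hs (.inr ⟨i, by simpa using hij,
    sameOrbit_walk_succ.trans hσ (h.symm hσ)⟩)

theorem Extendable.lt_of_mem_walkDomain (hσ : ∀ x, σ (σ (σ x)) = x) (hA : Extendable σ τ A g)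
    (hs : s ∈ walkDomain σ τ A C n) : n < g := by
  by_contra! h
  have hs : s ∈ walkDomain σ τ A C g := walkDomain_mono h hs
  refine hA.noPath (fun i => walk σ τ A (i + 1) s) ⟨fun i hi => ?_, fun i _ =>
    ⟨_, .refl _, sameOrbit_walk_succ⟩, fun i j hij hj =>
    not_sameOrbit_walk hσ (by omega) (walkDomain_mono hj hs)⟩
  refine Critical.congr hσ sameOrbit_walk_succ ?_
  by_contra h
  exact not_walkEnds (walkDomain_mono hi hs) (.inl h)

theorem Extendable.walk_ne_apply_walk (hσ : ∀ x, σ (σ (σ x)) = x) (hτ : ∀ x, τ (τ x) = x)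
    (hA : Extendable σ τ A g) {i : ℕ} (hi : s ∈ walkDomain σ τ A C i)
    (hj : s ∈ walkDomain σ τ A C j) : walk σ τ A i s ≠ τ (walk σ τ A j s) := by
  have key : ∀ i j, i < j → s ∈ walkDomain σ τ A C j → walk σ τ A j s ≠ τ (walk σ τ A i s) := by
    intro i j hij hj h
    rcases (Nat.succ_le_of_lt hij).eq_or_lt with rfl | hij'
    · exact walk_succ_ne hσ hj h
    · exact not_sameOrbit_walk hσ hij' hj (h ▸ sameOrbit_walk_succ.symm hσ)
  intro h
  rcases lt_trichotomy i j with hij | rfl | hij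
  · exact key i j hij hj (by rw [h, hτ])
  · exact (hA.walk_residual hσ hi).2.1 (hA.fixed _ h.symm)
  · exact key j i hij hi h

/-- Points of `C` that are near each other are equal. -/
def Sparse (σ τ : X → X) (n : ℕ) (C : Set X) : Prop := ∀ x ∈ C, ∀ y ∈ C, Near σ τ n x y → x = y

theorem mem_walkExtension : x ∈ walkExtension σ τ A C ↔
    x ∈ A ∨ ∃ n, ∃ s ∈ walkDomain σ τ A C n, walk σ τ A n s = x := by
  simp [walkExtension]

theorem walk_mem_walkExtension (hs : s ∈ walkDomain σ τ A C n) :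
    walk σ τ A n s ∈ walkExtension σ τ A C :=
  mem_walkExtension.2 (.inr ⟨n, s, hs, rfl⟩)

theorem notMem_walkDomain_succ (hτ : ∀ x, τ (τ x) = x)
    (hz : Unsatisfied σ (walkExtension σ τ A C) z) (h : walk σ τ A n s = τ z) :
    s ∉ walkDomain σ τ A C (n + 1) := fun hs =>
  have ho := sameOrbit_walk_succ (σ := σ) (τ := τ) (A := A) (n := n) (s := s)
  unsatisfied_iff.1 hz _ (by simpa only [h, hτ] using ho) (walk_mem_walkExtension hs)

theorem Unsatisfied.anti {A' : Set X} (hAA' : A ⊆ A') (h : Unsatisfied σ A' x) :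
    Unsatisfied σ A x := ⟨fun h' => h.1 (hAA' h'), fun h' => h.2.1 (hAA' h'),
  fun h' => h.2.2 (hAA' h')⟩

/-- Two walks that end next to nearby unsatisfied orbits coincide. -/
theorem Extendable.eq_of_near (hσ : ∀ x, σ (σ (σ x)) = x) (hτ : ∀ x, τ (τ x) = x)
    (hA : Extendable σ τ A g) (hC : Sparse σ τ (10 * g + 10) C)
    (hy : Unsatisfied σ (walkExtension σ τ A C) y) (hz : Unsatisfied σ (walkExtension σ τ A C) z)
    (hyz : Near σ τ (6 * g + 2) y z) {m n : ℕ} (hs : s ∈ walkDomain σ τ A C m)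
    (ht : t ∈ walkDomain σ τ A C n) (hsy : walk σ τ A m s = τ y) (htz : walk σ τ A n t = τ z) :
    y = z := by
  have hm := hA.lt_of_mem_walkDomain hσ hs
  have hn := hA.lt_of_mem_walkDomain hσ ht
  have h1 : Near σ τ (2 * m + 2) s y := by
    simpa [hsy, hτ] using (near_walk (σ := σ) (τ := τ) (A := A) (s := s) m).step
  have h2 : Near σ τ (2 * n + 2) t z := by
    simpa [htz, hτ] using (near_walk (σ := σ) (τ := τ) (A := A) (s := t) n).step
  obtain rfl : s = t := hC s hs.1 t ht.1
    (((h1.trans hyz).trans (h2.symm hσ hτ)).mono (by omega))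
  have h3 := notMem_walkDomain_succ hτ hy hsy
  have h4 := notMem_walkDomain_succ hτ hz htz
  obtain rfl : m = n := by
    by_contra hne
    rcases lt_or_gt_of_ne hne with h | h
    · exact h3 (walkDomain_mono h ht)
    · exact h4 (walkDomain_mono h hs)
  rw [← hτ y, ← hτ z, ← hsy, htz]

theorem Extendable.extendable_walkExtension (hσ : ∀ x, σ (σ (σ x)) = x) (hτ : ∀ x, τ (τ x) = x)
    (hA : Extendable σ τ A g) (hC : Sparse σ τ (10 * g + 10) C) :
    Extendable σ τ (walkExtension σ τ A C) (2 * g) where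
  fixed x hx := .inl (hA.fixed x hx)
  indep x hx hx' := by
    rw [mem_walkExtension] at hx hx'
    rcases hx with hx | ⟨m, s, hs, rfl⟩ <;> rcases hx' with hx' | ⟨n, t, ht, h⟩
    · exact hA.indep x hx hx'
    · exact absurd hx (by simpa [h, hτ] using (hA.walk_residual hσ ht).2.2)
    · exact absurd hx' (hA.walk_residual hσ hs).2.2
    · have hm := hA.lt_of_mem_walkDomain hσ hs
      have hn := hA.lt_of_mem_walkDomain hσ ht
      have h1 := (near_walk (σ := σ) (τ := τ) (A := A) (s := s) m).step
      rw [← h] at h1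
      obtain rfl : s = t := hC s hs.1 t ht.1
        ((h1.trans ((near_walk n).symm hσ hτ)).mono (by omega))
      exact absurd h (hA.walk_ne_apply_walk hσ hτ ht hs)
  unique x hx hxu y z hy hz hyA hzA := by
    have hyz : SameOrbit σ y z := (hy.symm hσ).trans hσ hz
    have key : ∀ y z, SameOrbit σ x y → SameOrbit σ x z → τ y ∈ A →
        ∀ n, ∀ s ∈ walkDomain σ τ A C n, walk σ τ A n s ≠ τ z := by
      intro y z hy hz hyA n s hs h
      have hzu := hxu.congr hσ hz
      have hτw : τ (walk σ τ A n s) = z := by rw [h, hτ]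
      rcases walkEnds_of_notMem hs (notMem_walkDomain_succ hτ hzu h) with hc | ⟨m, hm, ho⟩
      · rw [hτw, critical_iff] at hc
        exact hc ⟨hz.apply_ne hσ hx, hzu.anti subset_union_left, y,
          (hz.symm hσ).trans hσ hy, hyA⟩
      · rw [hτw] at ho
        exact unsatisfied_iff.1 hzu _ ho
          (walk_mem_walkExtension (walkDomain_mono (by simp at hm; omega) hs))
    rcases mem_walkExtension.1 hyA with hyA | ⟨m, s, hs, hsy⟩ <;>
      rcases mem_walkExtension.1 hzA with hzA | ⟨n, t, ht, htz⟩
    · exact hA.unique x hx (hxu.anti subset_union_left) y z hy hz hyA hzA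
    · exact absurd htz (key y z hy hz hyA n t ht)
    · exact absurd hsy (key z y hz hy hzA m s hs)
    · exact hA.eq_of_near hσ hτ hC (hxu.congr hσ hy) (hxu.congr hσ hz)
        ((Near.orbit (y := y) (n := 0) rfl hyz).mono (by omega)) hs ht hsy htz
  noPath e he := by
    have key : ∀ k ≤ g, ∃ i < g, ∃ z, SameOrbit σ (e (k + i)) z ∧
        ∃ n, ∃ s ∈ walkDomain σ τ A C n, walk σ τ A n s = τ z := by
      intro k hk
      by_contra! hcon
      refine hA.noPath (fun i => e (k + i)) ⟨fun i hi => ?_, fun i hi => he.linked _ (by omega),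
        fun i j hij hj => he.distinct _ _ (by omega) (by omega)⟩
      obtain ⟨h1, h2, z, hz, hzA⟩ := critical_iff.1 (he.critical (k + i) (by omega))
      refine critical_iff.2 ⟨h1, h2.anti subset_union_left, z, hz, ?_⟩
      rcases mem_walkExtension.1 hzA with h | ⟨n, s, hs, h⟩
      · exact h
      · exact absurd h (hcon i hi z hz n s hs)
    obtain ⟨i, hi, y, hy, m, s, hs, hsy⟩ := key 0 (by omega)
    obtain ⟨j, hj, z, hz, n, t, ht, htz⟩ := key g le_rfl
    rw [zero_add] at hy
    have hu : ∀ i < 2 * g, ∀ y, SameOrbit σ (e i) y → Unsatisfied σ (walkExtension σ τ A C) y :=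
      fun i hi y hy => (he.critical i hi).2.1.congr hσ hy
    have hn : Near σ τ (3 * (g + j - i)) (e i) (e (g + j)) := by
      have := he.near (i := i) (g + j - i) (by omega)
      rwa [show i + (g + j - i) = g + j by omega] at this
    have hyz : Near σ τ (6 * g + 2) y z :=
      (((Near.orbit (y := y) (n := 0) rfl (hy.symm hσ)).trans hn).orbit hz).mono (by omega)
    obtain rfl := hA.eq_of_near hσ hτ hC (hu i (by omega) y hy) (hu (g + j) (by omega) z hz) hyz
      hs ht hsy htz
    exact he.distinct i (g + j) (by omega) (by omega) (hy.trans hσ (hz.symm hσ))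

theorem exists_sameOrbit_mem_walkExtension (hs : s ∈ C) (hs' : σ s ≠ s) :
    ∃ y ∈ walkExtension σ τ A C, SameOrbit σ s y := by
  by_cases h : Unsatisfied σ A s
  · exact ⟨_, walk_mem_walkExtension (n := 0) ⟨hs, hs', h, by simp⟩, sameOrbit_walk_zero⟩
  · rw [unsatisfied_iff] at h
    push Not at h
    obtain ⟨y, hy, hyA⟩ := h
    exact ⟨y, .inl hyA, hy⟩

end Matching

section GenericMatching

variable {X : Type*} {σ τ : X → X} {A C : Set X} {g n : ℕ}

theorem exists_finite_near_iff [MeasurableSpace X] (hσ : Measurable σ) (hτ : Measurable τ)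
    (n : ℕ) : ∃ S : Set (X → X), S.Finite ∧ (∀ f ∈ S, Measurable f) ∧
      ∀ x y, Near σ τ n x y ↔ ∃ f ∈ S, y = f x := by
  induction n with
  | zero => exact ⟨{id}, finite_singleton _, by simp [measurable_id], by simp [Near]⟩
  | succ n ih =>
    obtain ⟨S, hS, hSm, h⟩ := ih
    let T : Set (X → X) := {id, σ, σ ∘ σ, τ}
    have hT : ∀ f ∈ T, Measurable f := by
      simp [T, measurable_id, hσ, hτ, hσ.comp hσ]
    have hT' : ∀ z y, (SameOrbit σ z y ∨ y = τ z) ↔ ∃ f ∈ T, y = f z := by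
      simp [T, SameOrbit, or_assoc]
    refine ⟨image2 (· ∘ ·) T S, (toFinite T).image2 _ hS, ?_, fun x y => ?_⟩
    · rintro _ ⟨f, hf, f', hf', rfl⟩
      exact (hT f hf).comp (hSm f' hf')
    · simp only [Near, h, hT', exists_mem_image2, Function.comp_apply]
      constructor
      · rintro ⟨_, ⟨f, hf, rfl⟩, f', hf', rfl⟩
        exact ⟨f', hf', f, hf, rfl⟩
      · rintro ⟨f', hf', f, hf, rfl⟩
        exact ⟨_, ⟨f, hf, rfl⟩, f', hf', rfl⟩

theorem measurableSet_unsatisfied [MeasurableSpace X] (hσ : Measurable σ) (hA : MeasurableSet A) :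
    MeasurableSet {x | Unsatisfied σ A x} :=
  hA.compl.inter ((hσ hA).compl.inter ((hσ.comp hσ) hA).compl)

theorem measurable_walk [MeasurableSpace X] (hσ : Measurable σ) (hτ : Measurable τ)
    (hA : MeasurableSet A) (n : ℕ) : Measurable (walk σ τ A n) := by
  induction n with
  | zero => exact Measurable.ite (hτ hA) hσ measurable_id
  | succ n ih =>
    have hz := hτ.comp ih
    exact Measurable.ite ((hτ.comp (hσ.comp hz)) hA) (hσ.comp (hσ.comp hz)) (hσ.comp hz)

variable [TopologicalSpace X] [PolishSpace X] [MeasurableSpace X] [BorelSpace X]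

/-- A Polish space is a countable union of Borel sets that are sparse for given Borel maps. -/
theorem exists_sparse_cover (hσ : Measurable σ) (hτ : Measurable τ) (n : ℕ) :
    ∃ C : TopologicalSpace.countableBasis X → Set X,
      (∀ i, MeasurableSet (C i) ∧ Sparse σ τ n (C i)) ∧ ⋃ i, C i = univ := by
  obtain ⟨S, hS, hSm, h⟩ := exists_finite_near_iff hσ hτ n
  have hB := TopologicalSpace.isBasis_countableBasis X
  refine ⟨fun U => U.1 ∩ ⋂ f ∈ S, {x | f x ∈ U.1 → f x = x}, fun U => ⟨?_, ?_⟩, ?_⟩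
  · have hU : MeasurableSet U.1 := (hB.isOpen U.2).measurableSet
    refine hU.inter (hS.measurableSet_biInter fun f hf => ?_)
    exact (hSm f hf hU).imp (measurableSet_eq_fun (hSm f hf) measurable_id)
  · rintro x ⟨-, hx⟩ y ⟨hy, -⟩ hxy
    obtain ⟨f, hf, rfl⟩ := (h x y).1 hxy
    exact (mem_iInter₂.1 hx f hf hy).symm
  · refine eq_univ_of_forall fun x => ?_
    have hF : {y | ∃ f ∈ S, f x = y ∧ y ≠ x}.Finite :=
      (hS.image fun f => f x).subset fun y ⟨f, hf, hy, _⟩ => ⟨f, hf, hy⟩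
    obtain ⟨U, hU, hxU, hUF⟩ := hB.exists_subset_of_mem_open
      (show x ∈ {y | ∃ f ∈ S, f x = y ∧ y ≠ x}ᶜ by simp) hF.isClosed.isOpen_compl
    refine mem_iUnion.2 ⟨⟨U, hU⟩, hxU, mem_iInter₂.2 fun f hf hfU => ?_⟩
    by_contra hne
    exact hUF hfU ⟨f, hf, rfl, hne⟩

theorem measurableSet_critical (hσ : Measurable σ) (hτ : Measurable τ) (hA : MeasurableSet A) :
    MeasurableSet {x | Critical σ τ A x} :=
  (measurableSet_eq_fun hσ measurable_id).compl.inter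
    ((measurableSet_unsatisfied hσ hA).inter ((hτ hA).union
      (((hτ.comp hσ) hA).union ((hτ.comp (hσ.comp hσ)) hA))))

theorem measurableSet_sameOrbit (hσ : Measurable σ) {f f' : X → X} (hf : Measurable f)
    (hf' : Measurable f') : MeasurableSet {x | SameOrbit σ (f x) (f' x)} :=
  (measurableSet_eq_fun hf' hf).union ((measurableSet_eq_fun hf' (hσ.comp hf)).union
    (measurableSet_eq_fun hf' (hσ.comp (hσ.comp hf))))

theorem measurableSet_walkDomain (hσ : Measurable σ) (hτ : Measurable τ) (hA : MeasurableSet A)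
    (hC : MeasurableSet C) (n : ℕ) : MeasurableSet (walkDomain σ τ A C n) := by
  have hw := measurable_walk hσ hτ hA
  have hE : ∀ n, MeasurableSet {s | WalkEnds σ τ A n s} := by
    intro n
    refine (hτ.comp (hw n) (measurableSet_critical hσ hτ hA)).compl.union ?_
    have : MeasurableSet (⋃ m ∈ Finset.range (n + 1),
        {s | SameOrbit σ (τ (walk σ τ A n s)) (walk σ τ A m s)}) :=
      Finset.measurableSet_biUnion _ fun m _ =>
        measurableSet_sameOrbit hσ (hτ.comp (hw n)) (hw m)
    convert this
    simp only [← ofPred_exists, exists_prop]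
    rfl
  refine hC.inter ((measurableSet_eq_fun hσ measurable_id).compl.inter
    ((measurableSet_unsatisfied hσ hA).inter ?_))
  have : MeasurableSet (⋂ i ∈ Finset.range n, {s | ¬WalkEnds σ τ A i s}) :=
    Finset.measurableSet_biInter _ fun i _ => (hE i).compl
  convert this
  simp only [← ofPred_forall]
  rfl

theorem Extendable.measurableSet_walkExtension (hσ : ∀ x, σ (σ (σ x)) = x)
    (hτ : ∀ x, τ (τ x) = x) (hσm : Measurable σ) (hτm : Measurable τ) (hA : Extendable σ τ A g)
    (hC : Sparse σ τ (10 * g + 10) C) (hAm : MeasurableSet A) (hCm : MeasurableSet C) :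
    MeasurableSet (walkExtension σ τ A C) := by
  refine hAm.union (MeasurableSet.iUnion fun n =>
    (measurableSet_walkDomain hσm hτm hAm hCm n).image_of_measurable_injOn
      (measurable_walk hσm hτm hAm n) fun s hs t ht hst => ?_)
  have hn := hA.lt_of_mem_walkDomain hσ hs
  have h1 := near_walk (σ := σ) (τ := τ) (A := A) (s := s) n
  rw [hst] at h1
  exact hC s hs.1 t ht.1 ((h1.trans ((near_walk n).symm hσ hτ)).mono (by omega))

/-- Inside any nonempty open set, an extendable set can be extended so that its saturation becomes
nonmeager. -/
theorem Extendable.exists_superset (hσ : ∀ x, σ (σ (σ x)) = x)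
    (hτ : ∀ x, τ (τ x) = x) (hσm : Measurable σ) (hτm : Measurable τ) {E : X → X → Prop}
    (hE : Equivalence E) (hEσ : ∀ x, E x (σ x)) (hne : ∀ x, ∃ y, E x y ∧ σ y ≠ y)
    (hA : Extendable σ τ A g) (hAm : MeasurableSet A) {V : Set X} (hV : IsOpen V)
    (hVne : V.Nonempty) :
    ∃ A', (MeasurableSet A' ∧ Extendable σ τ A' (2 * g)) ∧ A ⊆ A' ∧
      ¬IsMeagre (V ∩ {x | ∃ y, E x y ∧ y ∈ A'}) := by
  obtain ⟨C, hC, hCu⟩ := exists_sparse_cover hσm hτm (10 * g + 10)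
  have : Countable (TopologicalSpace.countableBasis X) := TopologicalSpace.countable_countableBasis X
  by_contra! hcon
  refine not_isMeagre_of_isOpen hV hVne (IsMeagre.mono (fun x hx => ?_) (isMeagre_iUnion fun i => hcon
    (walkExtension σ τ A (C i)) ⟨hA.measurableSet_walkExtension hσ hτ hσm hτm (hC i).2 hAm (hC i).1,
      hA.extendable_walkExtension hσ hτ (hC i).2⟩ subset_union_left))
  obtain ⟨y, hxy, hy⟩ := hne x
  obtain ⟨i, hi⟩ := mem_iUnion.1 (hCu.ge (mem_univ y))
  obtain ⟨z, hz, hyz⟩ := exists_sameOrbit_mem_walkExtension (τ := τ) (A := A) hi hy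
  refine mem_iUnion.2 ⟨i, hx, z, hE.trans hxy ?_, hz⟩
  rcases hyz with rfl | rfl | rfl
  exacts [hE.refl _, hEσ _, hE.trans (hEσ _) (hEσ _)]

/-- There is a Borel set that contains no nontrivial orbit of the involution `τ` and meets
generically every `E`-class. -/
theorem exists_measurableSet_of_extendable (hσ : ∀ x, σ (σ (σ x)) = x)
    (hτ : ∀ x, τ (τ x) = x) (hσm : Measurable σ) (hτm : Measurable τ) {E : X → X → Prop}
    (hE : Equivalence E) (hEm : MeasurableSet {p : X × X | E p.1 p.2})
    (hEc : ∀ x, {y | E x y}.Countable) (hEσ : ∀ x, E x (σ x))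
    (hne : ∀ x, ∃ y, E x y ∧ σ y ≠ y) :
    ∃ A, MeasurableSet A ∧ (∀ x ∈ A, τ x ∈ A → τ x = x) ∧ IsMeagre {x | ¬∃ y, E x y ∧ y ∈ A} := by
  have hB := TopologicalSpace.isBasis_countableBasis X
  let B := {V : Set X // V ∈ TopologicalSpace.countableBasis X ∧ V.Nonempty}
  have : Countable B := (TopologicalSpace.countable_countableBasis X).mono (fun _ h => h.1)
  rcases isEmpty_or_nonempty X with hX | hX
  · exact ⟨∅, .empty, by simp, by simpa [eq_empty_of_isEmpty] using IsMeagre.empty⟩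
  have : Nonempty B := by
    obtain ⟨V, hV, hx, -⟩ := hB.exists_subset_of_mem_open (mem_univ hX.some) isOpen_univ
    exact ⟨V, hV, _, hx⟩
  obtain ⟨V, hV⟩ := exists_surjective_nat B
  obtain ⟨A, -, hA, hstep⟩ := exists_seq_of_forall_step
    (P := fun n A => MeasurableSet A ∧ Extendable σ τ A (2 ^ n))
    (Q := fun n A A' => A ⊆ A' ∧ ¬IsMeagre ((V n).1 ∩ {x | ∃ y, E x y ∧ y ∈ A'}))
    {x | τ x = x} ⟨measurableSet_eq_fun hτm measurable_id, extendable_fixedPoints hτ⟩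
    fun n A hA => by
      simpa only [pow_succ'] using hA.2.exists_superset hσ hτ hσm hτm hE hEσ hne hA.1
        (hB.isOpen (V n).2.1) (V n).2.2
  have hmono : Monotone A := monotone_nat_of_le_succ fun n => (hstep n).1
  have hAm : MeasurableSet (⋃ n, A n) := .iUnion fun n => (hA n).1
  refine ⟨⋃ n, A n, hAm, fun x hx hx' => ?_, ?_⟩
  · obtain ⟨m, hm⟩ := mem_iUnion.1 hx
    obtain ⟨n, hn⟩ := mem_iUnion.1 hx'
    exact (hA (max m n)).2.indep x (hmono (le_max_left m n) hm) (hmono (le_max_right m n) hn)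
  · have hS : MeasurableSet {x | ∃ y, E x y ∧ y ∈ ⋃ n, A n} :=
      MeasurableSet.exists_of_countable_sections (R := fun x y => E x y ∧ y ∈ ⋃ n, A n)
        (hEm.inter (measurable_snd hAm)) fun x => (hEc x).mono fun y hy => hy.1
    obtain ⟨U, hU, hSU⟩ := hS.compl.residualEq_isOpen
    rcases U.eq_empty_or_nonempty with rfl | ⟨x, hx⟩
    · filter_upwards [hSU] with x hx hx'
      exact (hx.mp hx' : x ∈ (∅ : Set X))
    obtain ⟨W, hW, hxW, hWU⟩ := hB.exists_subset_of_mem_open hx hU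
    obtain ⟨n, hn⟩ := hV ⟨W, hW, x, hxW⟩
    refine absurd ?_ (hstep n).2
    filter_upwards [hSU] with y hy
    rintro ⟨hyW, z, hyz, hz⟩
    rw [hn] at hyW
    exact (hy.mpr (hWU hyW) : ¬ _) ⟨z, hyz, mem_iUnion.2 ⟨n + 1, hz⟩⟩

end GenericMatching

/-- Let `E` and `F` be countable Borel equivalence relations on a Polish space `X` such
that every `E`-class has cardinality `≥ 3` and every `F`-class has cardinality `≥ 2`.
Then `E` and `F` have Borel disjoint complete sections modulo a meager set: there are
disjoint Borel sets `A`, `B` such that the set of points whose `E`-class misses `A` is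
meager, and the set of points whose `F`-class misses `B` is meager. -/
theorem stmt_17 (X : Type) [TopologicalSpace X] [PolishSpace X]
    [MeasurableSpace X] [BorelSpace X]
    (E F : X → X → Prop)
    (hE : Equivalence E) (hF : Equivalence F)
    (hEBorel : MeasurableSet {p : X × X | E p.1 p.2})
    (hFBorel : MeasurableSet {p : X × X | F p.1 p.2})
    (hECtble : ∀ x, {y | E x y}.Countable)
    (hFCtble : ∀ x, {y | F x y}.Countable)
    (hEcard : ∀ x, 3 ≤ {y | E x y}.encard)
    (hFcard : ∀ x, 2 ≤ {y | F x y}.encard) :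
    ∃ A B : Set X, MeasurableSet A ∧ MeasurableSet B ∧ Disjoint A B ∧
      IsMeagre {x | ¬∃ y, E x y ∧ y ∈ A} ∧
      IsMeagre {x | ¬∃ y, F x y ∧ y ∈ B} := by
  obtain ⟨σ, hσm, hσ, hEσ, hσne⟩ :=
    exists_measurable_cyclic hE hEBorel hECtble 3 (by norm_num) hEcard
  obtain ⟨τ, hτm, hτ, hFτ, hτne⟩ := exists_measurable_cyclic hF hFBorel hFCtble 2 le_rfl hFcard
  obtain ⟨A, hA, hAτ, hAE⟩ :=
    exists_measurableSet_of_extendable hσ hτ hσm hτm hE hEBorel hECtble hEσ hσne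
  refine ⟨A, Aᶜ, hA, hA.compl, disjoint_compl_right, hAE, ?_⟩
  convert IsMeagre.empty
  refine eq_empty_of_forall_notMem fun x hx => hx ?_
  obtain ⟨y, hxy, hy⟩ := hτne x
  by_cases hyA : y ∈ A
  · exact ⟨τ y, hF.trans hxy (hFτ y), fun h => hy (hAτ y hyA h)⟩
  · exact ⟨y, hxy, hyA⟩
end
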